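/- Let d ≥ 2 and let P ∈ ℂ[X_1,…,X_d] be elliptic. Let X ⊆ ℝ^d be open, n ∈ ℕ, X_n := {x ∈ X : |x| < n and dist(x, ℝ^d∖X) > 1/n}, and let x ∈ X∖X_n and ε > 0 be such that the closed ball B̄(x,ε) ⊆ X∖cl(X_n). Then the restriction map C_P^∞(X) → C_P^∞(X_n ∪ B(x,ε)) has dense range for the compact-open topology: for every f ∈ C^∞(X_n ∪ B(x,ε)) with P(∂)f = 0, every compact K ⊆ X_n ∪ B(x,ε) and every δ > 0 there exists g ∈ C^∞(X) with P(∂)g = 0 on X and sup_{y∈K} |g(y) − f(y)| < δ. -/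

import Mathlib

open scoped BigOperators

noncomputable section

/-- Partial derivative in the `i`-th coordinate direction. -/
def pderivE {d : ℕ} {F : Type*} [NormedAddCommGroup F] [NormedSpace ℝ F] (i : Fin d)
    (f : EuclideanSpace ℝ (Fin d) → F) : EuclideanSpace ℝ (Fin d) → F :=
  fun x => fderiv ℝ f x (EuclideanSpace.single i 1)

/-- Iterated partial derivative `∂^α f` for a multi-index `α : Fin d → ℕ`. -/
def mderivE {d : ℕ} {F : Type*} [NormedAddCommGroup F] [NormedSpace ℝ F] (α : Fin d → ℕ)
    (f : EuclideanSpace ℝ (Fin d) → F) : EuclideanSpace ℝ (Fin d) → F :=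
  (List.finRange d).foldr (fun i g => (pderivE i)^[α i] g) f

/-- The constant coefficient linear partial differential operator `P(∂)`. -/
def PDop {d : ℕ} (P : MvPolynomial (Fin d) ℂ) (f : EuclideanSpace ℝ (Fin d) → ℂ) :
    EuclideanSpace ℝ (Fin d) → ℂ :=
  fun x => ∑ α ∈ P.support, P.coeff α * mderivE (fun i => α i) f x

/-- `P` is elliptic: the principal part `P_m` has no nontrivial real zero. -/
def IsElliptic {d : ℕ} (P : MvPolynomial (Fin d) ℂ) : Prop :=
  ∀ ξ : Fin d → ℝ, ξ ≠ 0 →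
    MvPolynomial.eval (fun i => (ξ i : ℂ))
      (MvPolynomial.homogeneousComponent P.totalDegree P) ≠ 0

/-- The canonical exhaustion `X_n = {x ∈ X : |x| < n, dist(x, ℝ^d∖X) > 1/n}`
(with `dist(x, ∅) = ∞`). -/
def exhSet {d : ℕ} (X : Set (EuclideanSpace ℝ (Fin d))) (n : ℕ) :
    Set (EuclideanSpace ℝ (Fin d)) :=
  {x | x ∈ X ∧ ‖x‖ < (n : ℝ) ∧ ENNReal.ofReal (1 / (n : ℝ)) < EMetric.infEdist x Xᶜ}



section Aux
open MeasureTheory Set Filter Topology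
open scoped ContDiff

abbrev EE (d : ℕ) := EuclideanSpace ℝ (Fin d)

variable {d : ℕ}

/-- Directional derivative. -/
def dd (w : EE d) (f : EE d → ℂ) : EE d → ℂ := fun x => fderiv ℝ f x w

/-- Derivative along a word. -/
def wd : List (Fin d) → (EE d → ℂ) → (EE d → ℂ)
  | [], f => f
  | i :: l, f => dd (EuclideanSpace.single i 1) (wd l f)

def mword (α : Fin d → ℕ) : List (Fin d) :=
  (List.finRange d).flatMap fun i => List.replicate (α i) i

lemma wd_append (l l' : List (Fin d)) (f : EE d → ℂ) : wd (l ++ l') f = wd l (wd l' f) := by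
  induction l with
  | nil => rfl
  | cons i l ih => simp [wd, ih]

lemma iter_pderivE (i : Fin d) (k : ℕ) (f : EE d → ℂ) :
    (pderivE i)^[k] f = wd (List.replicate k i) f := by
  induction k with
  | zero => rfl
  | succ k ih =>
    rw [Function.iterate_succ_apply', ih, List.replicate_succ]
    rfl

lemma mderivE_eq (α : Fin d → ℕ) (f : EE d → ℂ) : mderivE α f = wd (mword α) f := by
  unfold mderivE mword
  induction List.finRange d with
  | nil => rfl
  | cons i l ih => rw [List.foldr_cons, ih, iter_pderivE, List.flatMap_cons, wd_append]

lemma mword_length (α : Fin d → ℕ) : (mword α).length = ∑ i, α i := by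
  unfold mword
  rw [List.length_flatMap]
  simp only [List.length_replicate]
  rw [← List.ofFn_eq_map, List.sum_ofFn]

/-- The operator `P(σ∂)`. -/
def OpS (σ : ℂ) (P : MvPolynomial (Fin d) ℂ) (f : EE d → ℂ) : EE d → ℂ :=
  fun x => ∑ α ∈ P.support, P.coeff α * (σ ^ (mword (fun i => α i)).length *
    wd (mword (fun i => α i)) f x)

lemma PDop_eq (P : MvPolynomial (Fin d) ℂ) (f : EE d → ℂ) : PDop P f = OpS 1 P f := by
  funext x
  simp [PDop, OpS, mderivE_eq]

lemma dd_smooth {f : EE d → ℂ} (hf : ContDiff ℝ ∞ f) (w : EE d) : ContDiff ℝ ∞ (dd w f) := by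
  unfold dd
  exact (hf.fderiv_right (m := ∞) (by simp)).clm_apply contDiff_const

lemma wd_smooth {f : EE d → ℂ} (hf : ContDiff ℝ ∞ f) (l : List (Fin d)) :
    ContDiff ℝ ∞ (wd l f) := by
  induction l with
  | nil => exact hf
  | cons i l ih => exact dd_smooth ih _

lemma smooth_diff {f : EE d → ℂ} (hf : ContDiff ℝ ∞ f) : Differentiable ℝ f :=
  hf.differentiable (by simp)

lemma OpS_smooth {f : EE d → ℂ} (hf : ContDiff ℝ ∞ f) (σ : ℂ) (P : MvPolynomial (Fin d) ℂ) :
    ContDiff ℝ ∞ (OpS σ P f) := by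
  unfold OpS
  refine ContDiff.sum fun α _ => ?_
  exact contDiff_const.mul (contDiff_const.mul (wd_smooth hf _))

lemma dd_tsupport (w : EE d) (f : EE d → ℂ) : tsupport (dd w f) ⊆ tsupport f :=
  tsupport_fderiv_apply_subset ℝ w

lemma wd_tsupport (l : List (Fin d)) (f : EE d → ℂ) : tsupport (wd l f) ⊆ tsupport f := by
  induction l with
  | nil => exact le_rfl
  | cons i l ih => exact (dd_tsupport _ _).trans ih

lemma wd_zero_off (l : List (Fin d)) {f : EE d → ℂ} {x : EE d} (hx : x ∉ tsupport f) :
    wd l f x = 0 := image_eq_zero_of_notMem_tsupport fun h => hx (wd_tsupport l f h)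

lemma OpS_zero_off (σ : ℂ) (P : MvPolynomial (Fin d) ℂ) {f : EE d → ℂ} {x : EE d}
    (hx : x ∉ tsupport f) : OpS σ P f x = 0 := by
  unfold OpS
  exact Finset.sum_eq_zero fun α _ => by rw [wd_zero_off _ hx]; simp

lemma OpS_tsupport (σ : ℂ) (P : MvPolynomial (Fin d) ℂ) (f : EE d → ℂ) :
    tsupport (OpS σ P f) ⊆ tsupport f := by
  refine closure_minimal (fun x hx => ?_) (isClosed_tsupport f)
  by_contra h
  exact hx (OpS_zero_off σ P h)

lemma OpS_compact (σ : ℂ) (P : MvPolynomial (Fin d) ℂ) {f : EE d → ℂ} (hf : HasCompactSupport f) :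
    HasCompactSupport (OpS σ P f) := hf.of_isClosed_subset (isClosed_tsupport _) (OpS_tsupport σ P f)

lemma wd_compact (l : List (Fin d)) {f : EE d → ℂ} (hf : HasCompactSupport f) :
    HasCompactSupport (wd l f) := hf.of_isClosed_subset (isClosed_tsupport _) (wd_tsupport l f)

lemma dd_compact (w : EE d) {f : EE d → ℂ} (hf : HasCompactSupport f) :
    HasCompactSupport (dd w f) := hf.of_isClosed_subset (isClosed_tsupport _) (dd_tsupport w f)

lemma dd_comm {f : EE d → ℂ} (hf : ContDiff ℝ ∞ f) (v w : EE d) :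
    dd v (dd w f) = dd w (dd v f) := by
  funext x
  have h2 : DifferentiableAt ℝ (fderiv ℝ f) x :=
    (hf.fderiv_right (m := ∞) (by simp)).differentiable (by simp) x
  have e : ∀ u u' : EE d, dd u (dd u' f) x = fderiv ℝ (fderiv ℝ f) x u u' := by
    intro u u'
    show fderiv ℝ (fun y => fderiv ℝ f y u') x u = _
    rw [fderiv_clm_apply h2 (differentiableAt_const _)]
    simp
  rw [e, e]
  exact (hf.contDiffAt.isSymmSndFDerivAt (by simp; exact WithTop.coe_le_coe.2 (le_top (a := (2 : ℕ∞))))).eq v w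

lemma dd_wd_comm {f : EE d → ℂ} (hf : ContDiff ℝ ∞ f) (w : EE d) (l : List (Fin d)) :
    dd w (wd l f) = wd l (dd w f) := by
  induction l with
  | nil => rfl
  | cons i l ih =>
    show dd w (dd _ (wd l f)) = dd _ (wd l (dd w f))
    rw [dd_comm (wd_smooth hf l), ih]

lemma dd_add {f g : EE d → ℂ} (hf : ContDiff ℝ ∞ f) (hg : ContDiff ℝ ∞ g) (w : EE d) :
    dd w (fun x => f x + g x) = fun x => dd w f x + dd w g x := by
  funext x
  simp only [dd]
  rw [fderiv_fun_add (smooth_diff hf x) (smooth_diff hg x)]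
  rfl

lemma dd_const_mul {f : EE d → ℂ} (hf : ContDiff ℝ ∞ f) (c : ℂ) (w : EE d) :
    dd w (fun x => c * f x) = fun x => c * dd w f x := by
  funext x
  simp only [dd]
  rw [fderiv_const_mul (smooth_diff hf x)]
  rfl

lemma wd_add {f g : EE d → ℂ} (hf : ContDiff ℝ ∞ f) (hg : ContDiff ℝ ∞ g) (l : List (Fin d)) :
    wd l (fun x => f x + g x) = fun x => wd l f x + wd l g x := by
  induction l with
  | nil => rfl
  | cons i l ih => simp only [wd]; rw [ih, dd_add (wd_smooth hf l) (wd_smooth hg l)]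

lemma wd_const_mul {f : EE d → ℂ} (hf : ContDiff ℝ ∞ f) (c : ℂ) (l : List (Fin d)) :
    wd l (fun x => c * f x) = fun x => c * wd l f x := by
  induction l with
  | nil => rfl
  | cons i l ih => simp only [wd]; rw [ih, dd_const_mul (wd_smooth hf l)]

lemma OpS_add {f g : EE d → ℂ} (hf : ContDiff ℝ ∞ f) (hg : ContDiff ℝ ∞ g) (σ : ℂ)
    (P : MvPolynomial (Fin d) ℂ) :
    OpS σ P (fun x => f x + g x) = fun x => OpS σ P f x + OpS σ P g x := by
  funext x
  simp only [OpS, wd_add hf hg, ← Finset.sum_add_distrib]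
  exact Finset.sum_congr rfl fun α _ => by ring

lemma OpS_const_mul {f : EE d → ℂ} (hf : ContDiff ℝ ∞ f) (c : ℂ) (σ : ℂ)
    (P : MvPolynomial (Fin d) ℂ) :
    OpS σ P (fun x => c * f x) = fun x => c * OpS σ P f x := by
  funext x
  simp only [OpS, wd_const_mul hf, Finset.mul_sum]
  exact Finset.sum_congr rfl fun α _ => by ring

lemma dd_OpS_comm {f : EE d → ℂ} (hf : ContDiff ℝ ∞ f) (w : EE d) (σ : ℂ)
    (P : MvPolynomial (Fin d) ℂ) : dd w (OpS σ P f) = OpS σ P (dd w f) := by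
  funext x
  show fderiv ℝ (fun y => ∑ α ∈ P.support, P.coeff α * (σ ^ (mword (fun i => α i)).length *
    wd (mword (fun i => α i)) f y)) x w = _
  simp only [OpS]
  rw [fderiv_fun_sum]
  · rw [sum_apply]
    refine Finset.sum_congr rfl fun α _ => ?_
    have := (dd_wd_comm hf w (mword fun i => α i))
    rw [fderiv_const_mul (((wd_smooth hf _).differentiable (by simp) x).const_mul _),
      fderiv_const_mul ((wd_smooth hf _).differentiable (by simp) x)]
    have h2 := congrFun this x
    simp only [dd] at h2
    simp only [smul_apply, smul_eq_mul, h2]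
  · intro α _
    exact (((wd_smooth hf _).differentiable (by simp) x).const_mul _).const_mul _

lemma wd_congr {f g : EE d → ℂ} {x : EE d} (h : f =ᶠ[𝓝 x] g) (l : List (Fin d)) :
    wd l f =ᶠ[𝓝 x] wd l g := by
  induction l with
  | nil => exact h
  | cons i l ih =>
    have := ih.fderiv (𝕜 := ℝ)
    filter_upwards [this] with y hy
    simp only [wd, dd, hy]

lemma OpS_congr {f g : EE d → ℂ} {x : EE d} (h : f =ᶠ[𝓝 x] g) (σ : ℂ)
    (P : MvPolynomial (Fin d) ℂ) : OpS σ P f x = OpS σ P g x := by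
  unfold OpS
  exact Finset.sum_congr rfl fun α _ => by rw [(wd_congr h _).eq_of_nhds]

lemma int_mul {u φ : EE d → ℂ} (hu : Continuous u) (hφ : Continuous φ) (h : HasCompactSupport φ) :
    Integrable (fun x => u x * φ x) :=
  (hu.mul hφ).integrable_of_hasCompactSupport h.mul_left

lemma ibp_dd {u φ : EE d → ℂ} (hu : ContDiff ℝ ∞ u) (hφ : ContDiff ℝ ∞ φ)
    (hc : HasCompactSupport φ) (w : EE d) :
    ∫ x, u x * dd w φ x = - ∫ x, dd w u x * φ x := by
  refine integral_mul_fderiv_eq_neg_fderiv_mul_of_integrable ?_ ?_ ?_ ?_ ?_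
  · exact int_mul (dd_smooth hu w).continuous hφ.continuous hc
  · exact int_mul hu.continuous (dd_smooth hφ w).continuous (dd_compact w hc)
  · exact int_mul hu.continuous hφ.continuous hc
  · exact fun x _ => smooth_diff hu x
  · exact fun x _ => smooth_diff hφ x

lemma ibp_wd {u φ : EE d → ℂ} (hu : ContDiff ℝ ∞ u) (hφ : ContDiff ℝ ∞ φ)
    (hc : HasCompactSupport φ) (l : List (Fin d)) :
    ∫ x, u x * wd l φ x = (-1) ^ l.length * ∫ x, wd l u x * φ x := by
  induction l generalizing φ with
  | nil => simp [wd]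
  | cons i l ih =>
    have : wd (i :: l) φ = wd l (dd (EuclideanSpace.single i 1) φ) := dd_wd_comm hφ _ l
    rw [this, ih (dd_smooth hφ _) (dd_compact _ hc), ibp_dd (wd_smooth hu l) hφ hc,
      List.length_cons, pow_succ]
    simp only [wd]
    ring

lemma ibp_OpS {u φ : EE d → ℂ} (hu : ContDiff ℝ ∞ u) (hφ : ContDiff ℝ ∞ φ)
    (hc : HasCompactSupport φ) (σ : ℂ) (P : MvPolynomial (Fin d) ℂ) :
    ∫ x, u x * OpS σ P φ x = ∫ x, OpS (-σ) P u x * φ x := by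
  simp only [OpS, Finset.mul_sum, Finset.sum_mul]
  rw [integral_finsetSum, integral_finsetSum]
  · refine Finset.sum_congr rfl fun α _ => ?_
    have h := ibp_wd hu hφ hc (mword fun i => α i)
    have e1 : ∀ x, u x * (P.coeff α * (σ ^ (mword fun i => α i).length * wd (mword fun i => α i) φ x))
      = (P.coeff α * σ ^ (mword fun i => α i).length) * (u x * wd (mword fun i => α i) φ x) :=
      fun x => by ring
    have e2 : ∀ x, (P.coeff α * ((-σ) ^ (mword fun i => α i).length * wd (mword fun i => α i) u x)) * φ x
      = (P.coeff α * (-σ) ^ (mword fun i => α i).length) * (wd (mword fun i => α i) u x * φ x) :=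
      fun x => by ring
    simp only [e1, e2]
    rw [integral_const_mul, integral_const_mul, h, neg_pow σ]
    ring
  · intro α _
    refine int_mul (continuous_const.mul (continuous_const.mul (wd_smooth hu _).continuous))
      hφ.continuous hc
  · intro α _
    refine int_mul hu.continuous
      (continuous_const.mul (continuous_const.mul (wd_smooth hφ _).continuous)) ?_
    exact ((wd_compact _ hc).mul_left).mul_left

/-- Test functions in `Ω`. -/
structure IsT (Ω : Set (EE d)) (φ : EE d → ℂ) : Prop where
  sm : ContDiff ℝ ∞ φ
  cs : HasCompactSupport φ
  ts : tsupport φ ⊆ Ω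

lemma IsT.mono {Ω Ω' : Set (EE d)} {φ : EE d → ℂ} (h : IsT Ω φ) (hs : Ω ⊆ Ω') : IsT Ω' φ :=
  ⟨h.sm, h.cs, h.ts.trans hs⟩

lemma IsT.dd {Ω : Set (EE d)} {φ : EE d → ℂ} (h : IsT Ω φ) (w : EE d) : IsT Ω (dd w φ) :=
  ⟨dd_smooth h.sm w, dd_compact w h.cs, (dd_tsupport w φ).trans h.ts⟩

lemma IsT.op {Ω : Set (EE d)} {φ : EE d → ℂ} (h : IsT Ω φ) (σ : ℂ) (P : MvPolynomial (Fin d) ℂ) :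
    IsT Ω (OpS σ P φ) :=
  ⟨OpS_smooth h.sm σ P, OpS_compact σ P h.cs, (OpS_tsupport σ P φ).trans h.ts⟩

/-- Weak solutions of `P(σ∂) u = 0` on `Ω`. -/
def WSol (σ : ℂ) (P : MvPolynomial (Fin d) ℂ) (Ω : Set (EE d)) (u : EE d → ℂ) : Prop :=
  ∀ φ, IsT Ω φ → ∫ x, u x * OpS (-σ) P φ x = 0

lemma WSol.mono {σ : ℂ} {P : MvPolynomial (Fin d) ℂ} {Ω Ω' : Set (EE d)} {u : EE d → ℂ}
    (h : WSol σ P Ω u) (hs : Ω' ⊆ Ω) : WSol σ P Ω' u := fun φ hφ => h φ (hφ.mono hs)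

lemma WSol.congr {σ : ℂ} {P : MvPolynomial (Fin d) ℂ} {Ω : Set (EE d)} {u v : EE d → ℂ}
    (h : WSol σ P Ω u) (hs : EqOn u v Ω) : WSol σ P Ω v := by
  intro φ hφ
  rw [← h φ hφ]
  refine integral_congr_ae (Eventually.of_forall fun x => ?_)
  by_cases hx : x ∈ tsupport φ
  · simp only [hs (hφ.ts hx)]
  · simp [OpS_zero_off _ _ hx]

/-- A smooth cutoff. -/
lemma exists_cutoff {K U : Set (EE d)} (hK : IsCompact K) (hU : IsOpen U) (hKU : K ⊆ U) :
    ∃ κ : EE d → ℂ, IsT U κ ∧ (∀ᶠ x in 𝓝ˢ K, κ x = 1) := by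
  obtain ⟨K', hK', hKK', hK'U⟩ := exists_compact_between hK hU hKU
  obtain ⟨K2, hK2, hKK2, hK2'⟩ := exists_compact_between hK isOpen_interior hKK'
  obtain ⟨f, hf1, hf0, hf⟩ := exists_contMDiffMap_zero_one_of_isClosed (n := ⊤)
    (modelWithCornersSelf ℝ (EE d)) (s := (interior K')ᶜ) (t := K2)
    isOpen_interior.isClosed_compl hK2.isClosed (by
      rw [disjoint_compl_left_iff_subset]; exact hK2')
  have hts : tsupport (fun x => ((f x : ℝ) : ℂ)) ⊆ K' := by
    refine closure_minimal (fun x hx => ?_) hK'.isClosed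
    by_contra h
    exact hx (by
      have := hf1 (show x ∈ (interior K')ᶜ from fun h' => h (interior_subset h'))
      simp [this])
  refine ⟨fun x => ((f x : ℝ) : ℂ), ⟨?_, ?_, hts.trans hK'U⟩, ?_⟩
  · exact Complex.ofRealCLM.contDiff.comp f.contMDiff.contDiff
  · exact hK'.of_isClosed_subset (isClosed_tsupport _) hts
  · rw [eventually_nhdsSet_iff_forall]
    intro x hx
    filter_upwards [mem_interior_iff_mem_nhds.1 (hKK2 hx)] with y hy
    simp [hf0 hy]

lemma cutoff_mul {Ω : Set (EE d)} (hΩ : IsOpen Ω) {f κ : EE d → ℂ} (hf : ContDiffOn ℝ ∞ f Ω)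
    (hκ : IsT Ω κ) : IsT Ω (fun x => κ x * f x) := by
  have hts : tsupport (fun x => κ x * f x) ⊆ tsupport κ := tsupport_mul_subset_left
  refine ⟨?_, hκ.cs.mul_right, hts.trans hκ.ts⟩
  rw [contDiff_iff_contDiffAt]
  intro x
  by_cases hx : x ∈ tsupport κ
  · exact hκ.sm.contDiffAt.mul (hf.contDiffAt (hΩ.mem_nhds (hκ.ts hx)))
  · have : (fun x => κ x * f x) =ᶠ[𝓝 x] fun _ => 0 := by
      filter_upwards [(isClosed_tsupport κ).isOpen_compl.mem_nhds hx] with y hy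
      rw [image_eq_zero_of_notMem_tsupport hy, zero_mul]
    exact contDiffAt_const.congr_of_eventuallyEq this

/-- localisation of a smooth function -/
lemma exists_local {Ω : Set (EE d)} (hΩ : IsOpen Ω) {f : EE d → ℂ} (hf : ContDiffOn ℝ ∞ f Ω)
    {K : Set (EE d)} (hK : IsCompact K) (hKΩ : K ⊆ Ω) :
    ∃ F, IsT Ω F ∧ ∀ x ∈ K, F =ᶠ[𝓝 x] f := by
  obtain ⟨κ, hκ, h1⟩ := exists_cutoff hK hΩ hKΩ
  refine ⟨_, cutoff_mul hΩ hf hκ, fun x hx => ?_⟩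
  filter_upwards [(eventually_nhdsSet_iff_forall.1 h1) x hx] with y hy
  rw [hy, one_mul]

lemma ibp_local {Ω : Set (EE d)} (hΩ : IsOpen Ω) {f φ : EE d → ℂ} (hf : ContDiffOn ℝ ∞ f Ω)
    (hφ : IsT Ω φ) (σ : ℂ) (P : MvPolynomial (Fin d) ℂ) :
    ∫ x, f x * OpS (-σ) P φ x = ∫ x, OpS σ P f x * φ x := by
  obtain ⟨F, hF, hFf⟩ := exists_local hΩ hf hφ.cs hφ.ts
  have h := ibp_OpS hF.sm hφ.sm hφ.cs (-σ) P
  rw [neg_neg] at h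
  have e1 : ∫ x, f x * OpS (-σ) P φ x = ∫ x, F x * OpS (-σ) P φ x := by
    refine integral_congr_ae (Eventually.of_forall fun x => ?_)
    by_cases hx : x ∈ tsupport φ
    · simp only [(hFf x hx).eq_of_nhds]
    · simp [OpS_zero_off _ _ hx]
  have e2 : ∫ x, OpS σ P f x * φ x = ∫ x, OpS σ P F x * φ x := by
    refine integral_congr_ae (Eventually.of_forall fun x => ?_)
    by_cases hx : x ∈ tsupport φ
    · simp only [OpS_congr (hFf x hx)]
    · simp [image_eq_zero_of_notMem_tsupport hx]
  rw [e1, e2, h]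

lemma WSol_of_smooth {Ω : Set (EE d)} (hΩ : IsOpen Ω) {f : EE d → ℂ} (hf : ContDiffOn ℝ ∞ f Ω)
    {σ : ℂ} {P : MvPolynomial (Fin d) ℂ} (h : ∀ x ∈ Ω, OpS σ P f x = 0) : WSol σ P Ω f := by
  intro φ hφ
  rw [ibp_local hΩ hf hφ]
  refine integral_eq_zero_of_ae (Eventually.of_forall fun x => ?_)
  by_cases hx : x ∈ tsupport φ
  · simp [h x (hφ.ts hx)]
  · simp [image_eq_zero_of_notMem_tsupport hx]

lemma OpS_contOn {Ω : Set (EE d)} (hΩ : IsOpen Ω) {f : EE d → ℂ} (hf : ContDiffOn ℝ ∞ f Ω)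
    (σ : ℂ) (P : MvPolynomial (Fin d) ℂ) : ContinuousOn (OpS σ P f) Ω := by
  intro x hx
  obtain ⟨F, hF, hFf⟩ := exists_local hΩ hf isCompact_singleton (singleton_subset_iff.2 hx)
  have h1 : OpS σ P F =ᶠ[𝓝 x] OpS σ P f := by
    filter_upwards [(hFf x rfl).eventually_nhds] with y hy
    exact OpS_congr hy σ P
  exact ((OpS_smooth hF.sm σ P).continuous.continuousAt.congr h1).continuousWithinAt

lemma smooth_of_WSol {Ω : Set (EE d)} (hΩ : IsOpen Ω) {f : EE d → ℂ} (hf : ContDiffOn ℝ ∞ f Ω)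
    {σ : ℂ} {P : MvPolynomial (Fin d) ℂ} (h : WSol σ P Ω f) : ∀ x ∈ Ω, OpS σ P f x = 0 := by
  have hc := OpS_contOn hΩ hf σ P
  have h0 : ∀ᵐ x, x ∈ Ω → OpS σ P f x = 0 := by
    refine hΩ.ae_eq_zero_of_integral_contDiff_smul_eq_zero
      (hc.locallyIntegrableOn hΩ.measurableSet) ?_
    intro g hg hgc hgs
    have := h (fun x => (g x : ℂ)) ⟨Complex.ofRealCLM.contDiff.comp hg,
      hgc.comp_left (g := fun r : ℝ => (r : ℂ)) (by simp), ?_⟩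
    · rw [ibp_local hΩ hf] at this
      · rw [← this]
        congr 1
        funext x
        simp [mul_comm]
      · refine ⟨Complex.ofRealCLM.contDiff.comp hg,
          hgc.comp_left (g := fun r : ℝ => (r : ℂ)) (by simp), ?_⟩
        exact (tsupport_comp_subset (g := fun r : ℝ => (r : ℂ)) (by simp) _).trans hgs
    · exact (tsupport_comp_subset (g := fun r : ℝ => (r : ℂ)) (by simp) _).trans hgs
  have h1 : OpS σ P f =ᵐ[volume.restrict Ω] fun _ => 0 :=
    (ae_restrict_iff' hΩ.measurableSet).2 h0
  have := Measure.eqOn_open_of_ae_eq h1 hΩ hc continuousOn_const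
  exact fun x hx => this hx

end Aux


section Aux2
open MeasureTheory Set Filter Topology
open scoped ContDiff

variable {d : ℕ}

lemma mword_prod (α : Fin d → ℕ) (f : Fin d → ℂ) :
    ((mword α).map f).prod = ∏ i, f i ^ α i := by
  unfold mword
  have key : ∀ L : List (Fin d), ((L.flatMap fun i => List.replicate (α i) i).map f).prod =
      (L.map fun i => f i ^ α i).prod := by
    intro L
    induction L with
    | nil => rfl
    | cons i L ih =>
      rw [List.flatMap_cons, List.map_append, List.prod_append, ih]
      simp
  rw [key, ← List.ofFn_eq_map, List.prod_ofFn]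

/-- frequency vector -/
def fv (ξ : EE d) (i : Fin d) : ℂ := -(2 * Real.pi * Complex.I) * (ξ i : ℂ)

lemma fv_norm (ξ : EE d) (i : Fin d) : ‖fv ξ i‖ ≤ (2 * Real.pi) * ‖ξ‖ := by
  unfold fv
  have h := EuclideanSpace.norm_eq ξ
  have : |ξ i| ≤ ‖ξ‖ := by simpa using PiLp.norm_apply_le ξ i
  simp only [norm_neg, norm_mul, Complex.norm_I, mul_one, Complex.norm_real, Real.norm_eq_abs,
    Complex.norm_ofNat, abs_of_pos Real.pi_pos]
  have := Real.pi_pos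
  gcongr

/-- symbol -/
def sym (σ : ℂ) (P : MvPolynomial (Fin d) ℂ) (ζ : Fin d → ℂ) : ℂ :=
  ∑ α ∈ P.support, P.coeff α * (σ ^ (mword (fun i => α i)).length *
    ((mword (fun i => α i)).map ζ).prod)

lemma prod_fv_norm (ξ : EE d) (l : List (Fin d)) :
    ‖(l.map (fv ξ)).prod‖ ≤ (2 * Real.pi) ^ l.length * ‖ξ‖ ^ l.length := by
  induction l with
  | nil => simp
  | cons i l ih =>
    simp only [List.map_cons, List.prod_cons, List.length_cons, norm_mul]
    calc _ ≤ ((2 * Real.pi) * ‖ξ‖) * ((2 * Real.pi) ^ l.length * ‖ξ‖ ^ l.length) := by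
          gcongr
          exact fv_norm ξ i
      _ = _ := by ring

lemma degree_eq_len (α : Fin d →₀ ℕ) : (mword (fun i => α i)).length = α.degree := by
  rw [mword_length, Finsupp.degree_eq_sum]

/-- principal part as a sum -/
lemma eval_hom (P : MvPolynomial (Fin d) ℂ) (m : ℕ) (ζ : Fin d → ℂ) :
    MvPolynomial.eval ζ (MvPolynomial.homogeneousComponent m P) =
      ∑ α ∈ P.support.filter (fun α => α.degree = m), P.coeff α * ∏ i, ζ i ^ α i := by
  rw [MvPolynomial.homogeneousComponent_apply, map_sum]
  refine Finset.sum_congr rfl fun α _ => ?_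
  rw [MvPolynomial.eval_monomial, Finsupp.prod_fintype]
  simp

lemma elliptic_lower (hd : 2 ≤ d) {P : MvPolynomial (Fin d) ℂ} (hell : IsElliptic P) :
    ∃ c > 0, ∀ ξ : EE d, c * ‖ξ‖ ^ P.totalDegree ≤
      ‖MvPolynomial.eval (fun i => ((ξ i : ℝ) : ℂ))
        (MvPolynomial.homogeneousComponent P.totalDegree P)‖ := by
  set m := P.totalDegree with hm
  let h : EE d → ℂ := fun ξ => MvPolynomial.eval (fun i => ((ξ i : ℝ) : ℂ))
        (MvPolynomial.homogeneousComponent m P)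
  have hcont : Continuous h := by
    show Continuous fun ξ : EE d => MvPolynomial.eval (fun i => ((ξ i : ℝ) : ℂ))
        (MvPolynomial.homogeneousComponent m P)
    simp only [eval_hom]
    fun_prop
  have : Nonempty (Fin d) := ⟨⟨0, by omega⟩⟩
  have : Nontrivial (EE d) := inferInstance
  obtain ⟨ξ0, hξ0, hmin⟩ := (isCompact_sphere (0 : EE d) 1).exists_isMinOn
    ((NormedSpace.sphere_nonempty (x := (0 : EE d)) (r := 1)).2 zero_le_one)
    hcont.norm.continuousOn
  have hξ1 : ‖ξ0‖ = 1 := by simpa using hξ0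
  have hpos : 0 < ‖h ξ0‖ := by
    rw [norm_pos_iff]
    refine hell (fun i => ξ0 i) fun h0 => ?_
    have : ξ0 = 0 := by ext i; exact congrFun h0 i
    rw [this] at hξ1
    simp at hξ1
  have hhom : ∀ (r : ℝ) (ξ : EE d), h (r • ξ) = (r : ℂ) ^ m * h ξ := by
    intro r ξ
    simp only [h, eval_hom, Finset.mul_sum]
    refine Finset.sum_congr rfl fun α hα => ?_
    have hα' := (Finset.mem_filter.1 hα).2
    rw [Finsupp.degree_eq_sum] at hα'
    simp only [PiLp.smul_apply, smul_eq_mul, Complex.ofReal_mul, mul_pow]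
    rw [Finset.prod_mul_distrib, Finset.prod_pow_eq_pow_sum, hα']
    ring
  refine ⟨‖h ξ0‖, hpos, fun ξ => ?_⟩
  by_cases hξ : ξ = 0
  · subst hξ
    rcases Nat.eq_zero_or_pos m with h0 | h0
    · have e := hhom 0 ξ0
      rw [h0] at e
      simp only [zero_smul, pow_zero, one_mul] at e
      simp only [h0, pow_zero, mul_one, ← e]
      simp [h, h0]
    · simp [zero_pow h0.ne']
  · have hn : 0 < ‖ξ‖ := norm_pos_iff.2 hξ
    have h1 : ‖h ξ0‖ ≤ ‖h (‖ξ‖⁻¹ • ξ)‖ := hmin (by simp [norm_smul, hn.ne'])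
    have h2 := hhom ‖ξ‖ (‖ξ‖⁻¹ • ξ)
    rw [smul_smul, mul_inv_cancel₀ hn.ne', one_smul] at h2
    show _ ≤ ‖h ξ‖
    rw [h2, norm_mul, norm_pow, Complex.norm_real, norm_norm, mul_comm]
    gcongr

lemma sym_bound (hd : 2 ≤ d) {P : MvPolynomial (Fin d) ℂ} (hell : IsElliptic P)
    (σ : ℂ) (hσ : ‖σ‖ = 1) :
    ∃ c > 0, ∃ C ≥ 0, ∀ (τ : ℝ) (ξ : EE d), 1 ≤ τ →
      c * (τ + ‖ξ‖) ^ (P.totalDegree + 1) ≤ C * (τ * (τ + ‖ξ‖) ^ P.totalDegree)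
        + (τ + ‖ξ‖) * ‖sym σ P (fv ξ)‖ := by
  obtain ⟨c0, hc0, hlow⟩ := elliptic_lower hd hell
  set m := P.totalDegree with hm
  have hpi := Real.pi_pos
  let B : ℝ := ∑ α ∈ P.support, ‖P.coeff α‖ * (2 * Real.pi) ^ (mword (fun i => α i)).length
  have hB : 0 ≤ B := Finset.sum_nonneg fun α _ => by positivity
  let c1 := (2 * Real.pi) ^ m * c0
  have hc1 : 0 < c1 := by positivity
  refine ⟨c1 / 2 ^ m, by positivity, B + 2 * (c1 / 2 ^ m), by positivity, fun τ ξ hτ => ?_⟩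
  set s := τ + ‖ξ‖ with hs
  have hs1 : 1 ≤ s := by have := norm_nonneg ξ; linarith
  have hs0 : 0 < s := by linarith
  have hξs : ‖ξ‖ ≤ s := by linarith
  -- split
  let M : ℂ := ∑ α ∈ P.support.filter (fun α => α.degree = m),
    P.coeff α * (σ ^ (mword (fun i => α i)).length * ((mword (fun i => α i)).map (fv ξ)).prod)
  let Q : ℂ := ∑ α ∈ P.support.filter (fun α => ¬ α.degree = m),
    P.coeff α * (σ ^ (mword (fun i => α i)).length * ((mword (fun i => α i)).map (fv ξ)).prod)
  have hsplit : sym σ P (fv ξ) = M + Q := (Finset.sum_filter_add_sum_filter_not _ _ _).symm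
  have hM : c1 * ‖ξ‖ ^ m ≤ ‖M‖ := by
    have e : M = (σ * -(2 * Real.pi * Complex.I)) ^ m *
        MvPolynomial.eval (fun i => ((ξ i : ℝ) : ℂ)) (MvPolynomial.homogeneousComponent m P) := by
      rw [eval_hom, Finset.mul_sum]
      refine Finset.sum_congr rfl fun α hα => ?_
      have hα' := (Finset.mem_filter.1 hα).2
      rw [mword_prod, degree_eq_len, hα']
      rw [Finsupp.degree_eq_sum] at hα'
      simp only [fv, mul_pow]
      rw [Finset.prod_mul_distrib, Finset.prod_pow_eq_pow_sum, hα']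
      ring
    rw [e, norm_mul, norm_pow, norm_mul, hσ]
    simp only [norm_neg, norm_mul, Complex.norm_I, mul_one, Complex.norm_real, Real.norm_eq_abs,
      Complex.norm_ofNat, abs_of_pos Real.pi_pos, one_mul, c1]
    rw [mul_assoc]
    gcongr
    exact hlow ξ
  have hQ : s * ‖Q‖ ≤ B * (τ * s ^ m) := by
    have : ‖Q‖ * s ≤ B * s ^ m := by
      calc ‖Q‖ * s ≤ (∑ α ∈ P.support.filter (fun α => ¬ α.degree = m),
            ‖P.coeff α‖ * ((2 * Real.pi) ^ (mword (fun i => α i)).length *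
              ‖ξ‖ ^ (mword (fun i => α i)).length)) * s := by
            gcongr
            refine (norm_sum_le _ _).trans (Finset.sum_le_sum fun α _ => ?_)
            rw [norm_mul, norm_mul, norm_pow, hσ, one_pow, one_mul]
            gcongr
            exact prod_fv_norm ξ _
        _ = ∑ α ∈ P.support.filter (fun α => ¬ α.degree = m),
            (‖P.coeff α‖ * (2 * Real.pi) ^ (mword (fun i => α i)).length) *
              (‖ξ‖ ^ (mword (fun i => α i)).length * s) := by
            rw [Finset.sum_mul]
            exact Finset.sum_congr rfl fun α _ => by ring
        _ ≤ ∑ α ∈ P.support.filter (fun α => ¬ α.degree = m),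
            (‖P.coeff α‖ * (2 * Real.pi) ^ (mword (fun i => α i)).length) * s ^ m := by
            refine Finset.sum_le_sum fun α hα => ?_
            obtain ⟨h1, h2⟩ := Finset.mem_filter.1 hα
            have h3 : α.degree ≤ m := MvPolynomial.le_totalDegree h1
            have h4 : (mword (fun i => α i)).length + 1 ≤ m := by rw [degree_eq_len]; omega
            gcongr
            calc ‖ξ‖ ^ (mword (fun i => α i)).length * s
                ≤ s ^ (mword (fun i => α i)).length * s := by gcongr
              _ = s ^ ((mword (fun i => α i)).length + 1) := by ring
              _ ≤ s ^ m := pow_le_pow_right₀ hs1 h4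
        _ ≤ ∑ α ∈ P.support,
            (‖P.coeff α‖ * (2 * Real.pi) ^ (mword (fun i => α i)).length) * s ^ m :=
            Finset.sum_le_sum_of_subset_of_nonneg (Finset.filter_subset _ _)
              fun α _ _ => by positivity
        _ = B * s ^ m := by rw [Finset.sum_mul]
    calc s * ‖Q‖ = ‖Q‖ * s := mul_comm _ _
      _ ≤ B * s ^ m := this
      _ ≤ B * (τ * s ^ m) := by
        gcongr
        exact le_mul_of_one_le_left (by positivity) hτ
  have hMQ : ‖M‖ ≤ ‖sym σ P (fv ξ)‖ + ‖Q‖ := by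
    rw [hsplit]
    calc ‖M‖ = ‖(M + Q) - Q‖ := by ring_nf
      _ ≤ _ := norm_sub_le _ _
  have key : c1 / 2 ^ m * s ^ (m + 1) ≤ 2 * (c1 / 2 ^ m) * (τ * s ^ m) + s * (c1 * ‖ξ‖ ^ m) := by
    rcases le_total ‖ξ‖ τ with h | h
    · have : s ≤ 2 * τ := by linarith
      have h2 : 0 ≤ s * (c1 * ‖ξ‖ ^ m) := by positivity
      calc c1 / 2 ^ m * s ^ (m + 1) = c1 / 2 ^ m * (s * s ^ m) := by ring
        _ ≤ c1 / 2 ^ m * (2 * τ * s ^ m) := by gcongr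
        _ = 2 * (c1 / 2 ^ m) * (τ * s ^ m) := by ring
        _ ≤ _ := by linarith
    · have : s ≤ 2 * ‖ξ‖ := by linarith
      have h2 : 0 ≤ 2 * (c1 / 2 ^ m) * (τ * s ^ m) := by positivity
      calc c1 / 2 ^ m * s ^ (m + 1) = c1 / 2 ^ m * (s * s ^ m) := by ring
        _ ≤ c1 / 2 ^ m * (s * (2 * ‖ξ‖) ^ m) := by gcongr
        _ = s * (c1 * ‖ξ‖ ^ m) := by rw [mul_pow]; field_simp
        _ ≤ _ := by linarith
  have : s * (c1 * ‖ξ‖ ^ m) ≤ s * ‖sym σ P (fv ξ)‖ + B * (τ * s ^ m) := by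
    calc s * (c1 * ‖ξ‖ ^ m) ≤ s * (‖sym σ P (fv ξ)‖ + ‖Q‖) := by
          gcongr
          exact hM.trans hMQ
      _ = s * ‖sym σ P (fv ξ)‖ + s * ‖Q‖ := by ring
      _ ≤ _ := by linarith
  calc _ ≤ _ := key
    _ ≤ 2 * (c1 / 2 ^ m) * (τ * s ^ m) + (s * ‖sym σ P (fv ξ)‖ + B * (τ * s ^ m)) := by linarith
    _ = _ := by ring

end Aux2

section Aux3
open MeasureTheory Set Filter Topology
open scoped ContDiff

variable {d : ℕ}

/-- The exponential. -/
def ee (ξ x : EE d) : ℂ := Complex.exp (-(2 * Real.pi * Complex.I) * ((inner ℝ x ξ : ℝ) : ℂ))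

lemma ee_smooth (ξ : EE d) : ContDiff ℝ ∞ (ee ξ) := by
  unfold ee
  refine ContDiff.cexp (contDiff_const.mul ?_)
  exact Complex.ofRealCLM.contDiff.comp (contDiff_id.inner ℝ contDiff_const)

lemma ee_norm (ξ x : EE d) : ‖ee ξ x‖ = 1 := by
  unfold ee
  rw [Complex.norm_exp]
  simp

lemma dd_ee (ξ : EE d) (i : Fin d) (x : EE d) :
    dd (EuclideanSpace.single i 1) (ee ξ) x = fv ξ i * ee ξ x := by
  have h1 : HasFDerivAt (fun x : EE d => (inner ℝ x ξ : ℝ)) (innerSL ℝ ξ) x := by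
    have := (innerSL ℝ ξ).hasFDerivAt (x := x)
    refine this.congr_of_eventuallyEq (Eventually.of_forall fun y => ?_)
    simp [real_inner_comm]
  have h2 := Complex.ofRealCLM.hasFDerivAt.comp x h1
  have h3 := (h2.const_mul (-(2 * Real.pi * Complex.I))).cexp
  have h4 : HasFDerivAt (ee ξ) _ x := h3
  unfold dd
  rw [h4.fderiv]
  simp [fv, ee, EuclideanSpace.inner_single_right]
  ring

/-- modulated, rescaled bump -/
def mo (τ : ℝ) (x0 ξ : EE d) (χ : EE d → ℂ) : EE d → ℂ := fun x => χ (τ • (x - x0)) * ee ξ x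

lemma sc_smooth (τ : ℝ) (x0 : EE d) {χ : EE d → ℂ} (hχ : ContDiff ℝ ∞ χ) :
    ContDiff ℝ ∞ (fun x => χ (τ • (x - x0))) :=
  hχ.comp ((contDiff_id.sub contDiff_const).const_smul τ)

lemma mo_smooth (τ : ℝ) (x0 ξ : EE d) {χ : EE d → ℂ} (hχ : ContDiff ℝ ∞ χ) :
    ContDiff ℝ ∞ (mo τ x0 ξ χ) := (sc_smooth τ x0 hχ).mul (ee_smooth ξ)

lemma dd_sc (τ : ℝ) (x0 : EE d) {χ : EE d → ℂ} (hχ : ContDiff ℝ ∞ χ) (w x : EE d) :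
    dd w (fun x => χ (τ • (x - x0))) x = τ * dd w χ (τ • (x - x0)) := by
  have h1 : HasFDerivAt (fun x : EE d => τ • (x - x0)) (τ • ContinuousLinearMap.id ℝ (EE d)) x :=
    ((hasFDerivAt_id x).sub_const x0).const_smul τ
  have h2 := (smooth_diff hχ (τ • (x - x0))).hasFDerivAt.comp x h1
  unfold dd
  have h3 : HasFDerivAt (fun x => χ (τ • (x - x0))) _ x := h2
  rw [h3.fderiv]
  simp

lemma dd_mul {f g : EE d → ℂ} (hf : ContDiff ℝ ∞ f) (hg : ContDiff ℝ ∞ g) (w x : EE d) :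
    dd w (fun x => f x * g x) x = dd w f x * g x + f x * dd w g x := by
  unfold dd
  rw [fderiv_fun_mul (smooth_diff hf x) (smooth_diff hg x)]
  simp
  ring

lemma dd_mo (τ : ℝ) (x0 ξ : EE d) {χ : EE d → ℂ} (hχ : ContDiff ℝ ∞ χ) (i : Fin d) :
    dd (EuclideanSpace.single i 1) (mo τ x0 ξ χ) = fun x =>
      τ * mo τ x0 ξ (dd (EuclideanSpace.single i 1) χ) x + fv ξ i * mo τ x0 ξ χ x := by
  funext x
  have := dd_mul (sc_smooth τ x0 hχ) (ee_smooth ξ) (EuclideanSpace.single i 1) x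
  rw [dd_sc τ x0 hχ, dd_ee] at this
  unfold mo
  rw [this]
  ring

lemma sc_T {τ : ℝ} (hτ : 1 ≤ τ) (x0 : EE d) {χ : EE d → ℂ} (hχ : IsT (Metric.ball 0 1) χ) :
    IsT (Metric.ball x0 τ⁻¹) (fun x => χ (τ • (x - x0))) := by
  have h0 : 0 < τ := by linarith
  have hc : Continuous fun x : EE d => τ • (x - x0) := by fun_prop
  have hts : tsupport (fun x => χ (τ • (x - x0))) ⊆ Metric.ball x0 τ⁻¹ := by
    refine (tsupport_comp_subset_preimage χ hc).trans fun x hx => ?_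
    have := hχ.ts hx
    rw [Metric.mem_ball, dist_zero_right, norm_smul, Real.norm_of_nonneg h0.le] at this
    rw [Metric.mem_ball, dist_eq_norm, inv_eq_one_div, lt_div_iff₀ h0]
    linarith
  exact ⟨sc_smooth τ x0 hχ.sm, (isCompact_closedBall x0 τ⁻¹).of_isClosed_subset
    (isClosed_tsupport _) (hts.trans Metric.ball_subset_closedBall), hts⟩

lemma mo_T {τ : ℝ} (hτ : 1 ≤ τ) (x0 ξ : EE d) {χ : EE d → ℂ} (hχ : IsT (Metric.ball 0 1) χ) :
    IsT (Metric.ball x0 τ⁻¹) (mo τ x0 ξ χ) := by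
  have h := sc_T hτ x0 hχ
  exact ⟨mo_smooth τ x0 ξ hχ.sm, h.cs.mul_right, (tsupport_mul_subset_left).trans h.ts⟩

lemma int_mul' {u φ : EE d → ℂ} (hu : Integrable u) (hφ : Continuous φ) (h : HasCompactSupport φ) :
    Integrable (fun x => u x * φ x) := by
  obtain ⟨C, hC⟩ := hφ.bounded_above_of_compact_support h
  exact hu.mul_bdd hφ.aestronglyMeasurable (Eventually.of_forall hC)

def Ival (u : EE d → ℂ) (τ : ℝ) (x0 ξ : EE d) (l : List (Fin d)) (χ : EE d → ℂ) : ℂ :=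
  ∫ x, u x * wd l (mo τ x0 ξ χ) x

lemma Ival_cons {u : EE d → ℂ} (hu : Integrable u) {τ : ℝ} (hτ : 1 ≤ τ) (x0 ξ : EE d)
    (i : Fin d) (l : List (Fin d)) {χ : EE d → ℂ} (hχ : IsT (Metric.ball 0 1) χ) :
    Ival u τ x0 ξ (i :: l) χ = τ * Ival u τ x0 ξ l (dd (EuclideanSpace.single i 1) χ) +
      fv ξ i * Ival u τ x0 ξ l χ := by
  unfold Ival
  simp only [wd]
  have t1 := mo_T hτ x0 ξ hχ
  have t2 := mo_T hτ x0 ξ (hχ.dd (EuclideanSpace.single i 1))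
  rw [dd_wd_comm t1.sm, dd_mo τ x0 ξ hχ.sm,
    wd_add (contDiff_const.mul t2.sm) (contDiff_const.mul t1.sm),
    wd_const_mul t2.sm, wd_const_mul t1.sm]
  rw [← integral_const_mul, ← integral_const_mul, ← integral_add]
  · congr 1
    funext x
    ring
  · exact (int_mul' hu (wd_smooth t2.sm l).continuous (wd_compact l t2.cs)).const_mul _
  · exact (int_mul' hu (wd_smooth t1.sm l).continuous (wd_compact l t1.cs)).const_mul _

structure Adm (σ : ℂ) (P : MvPolynomial (Fin d) ℂ) (u : EE d → ℂ) (τ : ℝ) (x0 : EE d) : Prop where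
  i : Integrable u
  t : 1 ≤ τ
  w : WSol σ P (Metric.ball x0 τ⁻¹) u

/-- decay of order `k` -/
def Dec (σ : ℂ) (P : MvPolynomial (Fin d) ℂ) (k : ℕ) : Prop :=
  ∀ χ : EE d → ℂ, IsT (Metric.ball 0 1) χ → ∃ C ≥ 0, ∀ (u : EE d → ℂ) (τ : ℝ) (x0 ξ : EE d),
    Adm σ P u τ x0 → (τ + ‖ξ‖) ^ k * ‖Ival u τ x0 ξ [] χ‖ ≤ C * (τ ^ k * ∫ x, ‖u x‖)

lemma Dec_zero (σ : ℂ) (P : MvPolynomial (Fin d) ℂ) : Dec σ P 0 := by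
  intro χ hχ
  obtain ⟨C, hC⟩ := hχ.sm.continuous.bounded_above_of_compact_support hχ.cs
  have hC0 : 0 ≤ C := (norm_nonneg _).trans (hC 0)
  refine ⟨C, hC0, fun u τ x0 ξ h => ?_⟩
  simp only [pow_zero, one_mul, Ival, wd]
  calc _ ≤ ∫ x, ‖u x * mo τ x0 ξ χ x‖ := norm_integral_le_integral_norm _
    _ ≤ ∫ x, C * ‖u x‖ := by
      refine integral_mono (int_mul' h.i (mo_smooth _ _ _ hχ.sm).continuous
        (mo_T h.t x0 ξ hχ).cs).norm (h.i.norm.const_mul C) fun x => ?_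
      simp only [norm_mul, mo, ee_norm, mul_one]
      rw [mul_comm]
      gcongr
      exact hC _
    _ = _ := integral_const_mul _ _

lemma Dec_word {σ : ℂ} {P : MvPolynomial (Fin d) ℂ} {k : ℕ} (hk : Dec σ P k) (l : List (Fin d)) :
    ∀ χ : EE d → ℂ, IsT (Metric.ball 0 1) χ → ∃ C ≥ 0, ∀ (u : EE d → ℂ) (τ : ℝ) (x0 ξ : EE d),
    Adm σ P u τ x0 → (τ + ‖ξ‖) ^ k * ‖Ival u τ x0 ξ l χ‖ ≤
      C * (τ ^ k * (τ + ‖ξ‖) ^ l.length * ∫ x, ‖u x‖) := by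
  induction l with
  | nil => intro χ hχ; simpa using hk χ hχ
  | cons i l ih =>
    intro χ hχ
    obtain ⟨C1, hC1, h1⟩ := ih χ hχ
    obtain ⟨C2, hC2, h2⟩ := ih _ (hχ.dd (EuclideanSpace.single i 1))
    have hpi := Real.pi_pos
    refine ⟨C2 + 2 * Real.pi * C1, by positivity, fun u τ x0 ξ h => ?_⟩
    have ht := h.t
    have hI : 0 ≤ ∫ x, ‖u x‖ := integral_nonneg fun _ => norm_nonneg _
    have h1' := h1 u τ x0 ξ h
    have h2' := h2 u τ x0 ξ h
    have hf := fv_norm ξ i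
    rw [Ival_cons h.i h.t x0 ξ i l hχ]
    set s := τ + ‖ξ‖ with hs
    have hts : τ ≤ s := by have := norm_nonneg ξ; linarith
    have hxs : ‖ξ‖ ≤ s := by linarith
    have hs0 : 0 < s := by linarith
    set I := ∫ x, ‖u x‖
    set A := Ival u τ x0 ξ l χ
    set B := Ival u τ x0 ξ l (dd (EuclideanSpace.single i 1) χ)
    calc s ^ k * ‖τ * B + fv ξ i * A‖ ≤ s ^ k * (τ * ‖B‖ + 2 * Real.pi * ‖ξ‖ * ‖A‖) := by
          gcongr
          refine (norm_add_le _ _).trans ?_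
          rw [norm_mul, norm_mul, Complex.norm_real, Real.norm_of_nonneg (by linarith)]
          gcongr
      _ = τ * (s ^ k * ‖B‖) + 2 * Real.pi * ‖ξ‖ * (s ^ k * ‖A‖) := by ring
      _ ≤ s * (C2 * (τ ^ k * s ^ l.length * I)) +
          2 * Real.pi * s * (C1 * (τ ^ k * s ^ l.length * I)) := by gcongr
      _ = _ := by rw [List.length_cons]; ring

lemma Dec_rem {σ : ℂ} {P : MvPolynomial (Fin d) ℂ} {k : ℕ} (hk : Dec σ P k) (l : List (Fin d))
    (χ : EE d → ℂ) (hχ : IsT (Metric.ball 0 1) χ) : ∃ C ≥ 0, ∀ (u : EE d → ℂ) (τ : ℝ) (x0 ξ : EE d),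
    Adm σ P u τ x0 → (τ + ‖ξ‖) ^ (k + 1) *
      ‖Ival u τ x0 ξ l χ - (l.map (fv ξ)).prod * Ival u τ x0 ξ [] χ‖ ≤
      C * (τ ^ (k + 1) * (τ + ‖ξ‖) ^ l.length * ∫ x, ‖u x‖) := by
  induction l with
  | nil => exact ⟨0, le_rfl, fun u τ x0 ξ _ => by simp⟩
  | cons i l ih =>
    obtain ⟨C1, hC1, h1⟩ := ih
    obtain ⟨C2, hC2, h2⟩ := Dec_word hk l _ (hχ.dd (EuclideanSpace.single i 1))
    have hpi := Real.pi_pos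
    refine ⟨C2 + 2 * Real.pi * C1, by positivity, fun u τ x0 ξ h => ?_⟩
    have ht := h.t
    have hI : 0 ≤ ∫ x, ‖u x‖ := integral_nonneg fun _ => norm_nonneg _
    have h1' := h1 u τ x0 ξ h
    have h2' := h2 u τ x0 ξ h
    have hf := fv_norm ξ i
    rw [Ival_cons h.i h.t x0 ξ i l hχ]
    set s := τ + ‖ξ‖ with hs
    have hts : τ ≤ s := by have := norm_nonneg ξ; linarith
    have hxs : ‖ξ‖ ≤ s := by linarith
    have hs0 : 0 < s := by linarith
    set I := ∫ x, ‖u x‖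
    set A := Ival u τ x0 ξ l χ
    set A0 := Ival u τ x0 ξ [] χ
    set B := Ival u τ x0 ξ l (dd (EuclideanSpace.single i 1) χ)
    set Q := (l.map (fv ξ)).prod
    have e : τ * B + fv ξ i * A - ((i :: l).map (fv ξ)).prod * A0 =
        τ * B + fv ξ i * (A - Q * A0) := by
      simp only [List.map_cons, List.prod_cons, Q]; ring
    rw [e]
    calc s ^ (k + 1) * ‖τ * B + fv ξ i * (A - Q * A0)‖
        ≤ s ^ (k + 1) * (τ * ‖B‖ + 2 * Real.pi * ‖ξ‖ * ‖A - Q * A0‖) := by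
          gcongr
          refine (norm_add_le _ _).trans ?_
          rw [norm_mul, norm_mul, Complex.norm_real, Real.norm_of_nonneg (by linarith)]
          gcongr
      _ = s * τ * (s ^ k * ‖B‖) + 2 * Real.pi * ‖ξ‖ * (s ^ (k + 1) * ‖A - Q * A0‖) := by ring
      _ ≤ s * τ * (C2 * (τ ^ k * s ^ l.length * I)) +
          2 * Real.pi * s * (C1 * (τ ^ (k + 1) * s ^ l.length * I)) := by gcongr
      _ = _ := by rw [List.length_cons]; ring

lemma Dec_succ (hd : 2 ≤ d) {P : MvPolynomial (Fin d) ℂ} (hell : IsElliptic P) {σ : ℂ}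
    (hσ : ‖σ‖ = 1) {k : ℕ} (hk : Dec σ P k) : Dec σ P (k + 1) := by
  intro χ hχ
  obtain ⟨c, hc, C0, hC0, hsym⟩ := sym_bound hd hell (-σ) (by simpa using hσ)
  obtain ⟨C1, hC1, h1⟩ := hk χ hχ
  choose R hR0 hR using fun l : List (Fin d) => Dec_rem hk l χ hχ
  set m := P.totalDegree with hm
  let D : ℝ := ∑ α ∈ P.support, ‖P.coeff α‖ * R (mword fun i => α i)
  have hD : 0 ≤ D := Finset.sum_nonneg fun α _ => mul_nonneg (norm_nonneg _) (hR0 _)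
  refine ⟨(C0 * C1 + D) / c, by positivity, fun u τ x0 ξ h => ?_⟩
  have ht := h.t
  have hI : 0 ≤ ∫ x, ‖u x‖ := integral_nonneg fun _ => norm_nonneg _
  have h1' := h1 u τ x0 ξ h
  have hR' := fun l => hR l u τ x0 ξ h
  have hsym' := hsym τ ξ ht
  have T := mo_T ht x0 ξ hχ
  have h0 := h.w _ T
  have hexp : ∑ α ∈ P.support, P.coeff α * ((-σ) ^ (mword (fun i => α i)).length *
      Ival u τ x0 ξ (mword fun i => α i) χ) = 0 := by
    rw [← h0]
    simp only [OpS, Finset.mul_sum]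
    rw [integral_finsetSum]
    · refine Finset.sum_congr rfl fun α _ => ?_
      unfold Ival
      rw [← integral_const_mul, ← integral_const_mul]
      congr 1
      funext x
      ring
    · intro α _
      have := ((int_mul' h.i (wd_smooth T.sm (mword fun i => α i)).continuous
        (wd_compact _ T.cs)).const_mul ((-σ) ^ (mword (fun i => α i)).length)).const_mul
          (P.coeff α)
      refine this.congr (Eventually.of_forall fun x => ?_)
      simp only
      ring
  set s := τ + ‖ξ‖ with hs
  have hts : τ ≤ s := by have := norm_nonneg ξ; linarith
  have hxs : ‖ξ‖ ≤ s := by linarith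
  have hs1 : 1 ≤ s := by linarith
  have hs0 : 0 < s := by linarith
  set I := ∫ x, ‖u x‖
  set A0 := Ival u τ x0 ξ [] χ
  have hS : s ^ (k + 1) * ‖sym (-σ) P (fv ξ) * A0‖ ≤ D * (τ ^ (k + 1) * s ^ m * I) := by
    have e : sym (-σ) P (fv ξ) * A0 = - ∑ α ∈ P.support, P.coeff α *
        ((-σ) ^ (mword (fun i => α i)).length * (Ival u τ x0 ξ (mword fun i => α i) χ -
          ((mword fun i => α i).map (fv ξ)).prod * A0)) := by
      have : ∑ α ∈ P.support, P.coeff α *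
        ((-σ) ^ (mword (fun i => α i)).length * (Ival u τ x0 ξ (mword fun i => α i) χ -
          ((mword fun i => α i).map (fv ξ)).prod * A0)) =
          ∑ α ∈ P.support, P.coeff α * ((-σ) ^ (mword (fun i => α i)).length *
      Ival u τ x0 ξ (mword fun i => α i) χ) - sym (-σ) P (fv ξ) * A0 := by
        rw [sym, Finset.sum_mul, ← Finset.sum_sub_distrib]
        exact Finset.sum_congr rfl fun α _ => by ring
      rw [this, hexp]
      ring
    rw [e, norm_neg]
    calc _ ≤ s ^ (k + 1) * ∑ α ∈ P.support, ‖P.coeff α‖ *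
          ‖Ival u τ x0 ξ (mword fun i => α i) χ -
            ((mword fun i => α i).map (fv ξ)).prod * A0‖ := by
          gcongr
          refine (norm_sum_le _ _).trans (Finset.sum_le_sum fun α _ => le_of_eq ?_)
          rw [norm_mul, norm_mul, norm_pow, norm_neg, hσ, one_pow, one_mul]
      _ = ∑ α ∈ P.support, ‖P.coeff α‖ *
          (s ^ (k + 1) * ‖Ival u τ x0 ξ (mword fun i => α i) χ -
            ((mword fun i => α i).map (fv ξ)).prod * A0‖) := by
          rw [Finset.mul_sum]
          exact Finset.sum_congr rfl fun α _ => by ring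
      _ ≤ ∑ α ∈ P.support, ‖P.coeff α‖ *
          (R (mword fun i => α i) * (τ ^ (k + 1) * s ^ m * I)) := by
          refine Finset.sum_le_sum fun α hα => ?_
          have h3 : (mword fun i => α i).length ≤ m := by
            rw [degree_eq_len]; exact MvPolynomial.le_totalDegree hα
          refine mul_le_mul_of_nonneg_left ((hR' _).trans ?_) (norm_nonneg _)
          refine mul_le_mul_of_nonneg_left ?_ (hR0 _)
          gcongr
      _ = _ := by
          simp only [D, Finset.sum_mul]
          exact Finset.sum_congr rfl fun α _ => by ring
  have hsm : 0 < s ^ m := by positivity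
  have key : c * (s ^ (k + 1) * ‖A0‖) ≤ (C0 * C1 + D) * (τ ^ (k + 1) * I) := by
    refine le_of_mul_le_mul_left ?_ hsm
    calc s ^ m * (c * (s ^ (k + 1) * ‖A0‖)) = (c * s ^ (m + 1)) * (s ^ k * ‖A0‖) := by ring
      _ ≤ (C0 * (τ * s ^ m) + s * ‖sym (-σ) P (fv ξ)‖) * (s ^ k * ‖A0‖) := by gcongr
      _ = C0 * (τ * s ^ m) * (s ^ k * ‖A0‖) + s ^ (k + 1) * ‖sym (-σ) P (fv ξ) * A0‖ := by
        rw [norm_mul]; ring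
      _ ≤ C0 * (τ * s ^ m) * (C1 * (τ ^ k * I)) + D * (τ ^ (k + 1) * s ^ m * I) := by
        gcongr
      _ = _ := by ring
  rw [div_mul_eq_mul_div, le_div_iff₀ hc]
  linarith

lemma Dec_all (hd : 2 ≤ d) {P : MvPolynomial (Fin d) ℂ} (hell : IsElliptic P) {σ : ℂ}
    (hσ : ‖σ‖ = 1) (k : ℕ) : Dec σ P k := by
  induction k with
  | zero => exact Dec_zero σ P
  | succ k ih => exact Dec_succ hd hell hσ ih

end Aux3

section Aux4
open MeasureTheory Set Filter Topology
open scoped ContDiff FourierTransform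

variable {d : ℕ}

lemma fourier_ee (v : EE d → ℂ) (ξ : EE d) : 𝓕 v ξ = ∫ x, v x * ee ξ x := by
  rw [Real.fourier_eq']
  congr 1
  funext x
  rw [smul_eq_mul, mul_comm, ee]
  congr 2
  push_cast
  ring

lemma integrable_pow_inv : Integrable (fun ξ : EE d => ((1 + ‖ξ‖) ^ (d + 1))⁻¹) := by
  have h := integrable_one_add_norm (E := EE d) (μ := volume) (r := ((d + 1 : ℕ) : ℝ)) (by simp)
  refine h.congr (Eventually.of_forall fun ξ => ?_)
  simp only
  rw [Real.rpow_neg (by positivity), Real.rpow_natCast]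

lemma integrable_pow_inv' {τ : ℝ} (hτ : 1 ≤ τ) :
    Integrable (fun ξ : EE d => ((τ + ‖ξ‖) ^ (d + 1))⁻¹) := by
  refine (integrable_pow_inv (d := d)).mono' ?_ (Eventually.of_forall fun ξ => ?_)
  · refine Continuous.aestronglyMeasurable (Continuous.inv₀ (by fun_prop) fun ξ => ?_)
    have := norm_nonneg ξ
    positivity
  · rw [Real.norm_of_nonneg (by positivity)]
    gcongr

lemma integral_pow_inv {τ : ℝ} (hτ : 1 ≤ τ) :
    ∫ ξ : EE d, ((τ + ‖ξ‖) ^ (d + 1))⁻¹ = τ⁻¹ * ∫ ξ : EE d, ((1 + ‖ξ‖) ^ (d + 1))⁻¹ := by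
  have h0 : 0 < τ := by linarith
  have h := Measure.integral_comp_smul (volume : Measure (EE d))
    (fun ξ : EE d => ((1 + ‖ξ‖) ^ (d + 1))⁻¹) τ⁻¹
  have e : ∀ ξ : EE d, ((τ + ‖ξ‖) ^ (d + 1))⁻¹ = (τ ^ (d + 1))⁻¹ *
      ((1 + ‖τ⁻¹ • ξ‖) ^ (d + 1))⁻¹ := by
    intro ξ
    rw [norm_smul, norm_inv, Real.norm_of_nonneg h0.le, ← mul_inv, ← mul_pow]
    congr 2
    field_simp
  simp only [e]
  rw [integral_const_mul, h, smul_eq_mul, ← mul_assoc]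
  congr 1
  rw [finrank_euclideanSpace_fin, abs_of_nonneg (by positivity), inv_pow, inv_inv]
  field_simp
  ring

/-- the decay estimate at a point for a continuous weak solution -/
lemma local_decay (hd : 2 ≤ d) {P : MvPolynomial (Fin d) ℂ} (hell : IsElliptic P) {σ : ℂ}
    (hσ : ‖σ‖ = 1) : ∃ χ : EE d → ℂ, IsT (Metric.ball 0 1) χ ∧ (∀ᶠ x in 𝓝 0, χ x = 1) ∧
    ∀ k : ℕ, ∃ C ≥ 0, ∀ (Ω : Set (EE d)) (u : EE d → ℂ) (τ : ℝ) (x0 : EE d),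
      ContinuousOn u Ω → WSol σ P Ω u → 1 ≤ τ → Metric.closedBall x0 τ⁻¹ ⊆ Ω →
      ∀ M, (∀ x ∈ Metric.closedBall x0 τ⁻¹, ‖u x‖ ≤ M) → ∀ ξ,
      (τ + ‖ξ‖) ^ k * ‖𝓕 (fun x => χ (τ • (x - x0)) * u x) ξ‖ ≤ C * (τ ^ k * ((τ ^ d)⁻¹ * M)) := by
  obtain ⟨χ, hχ, h1⟩ := exists_cutoff (K := {(0 : EE d)}) isCompact_singleton
    (Metric.isOpen_ball (x := 0) (ε := 1)) (by simp)
  rw [nhdsSet_singleton] at h1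
  refine ⟨χ, hχ, h1, fun k => ?_⟩
  obtain ⟨C, hC, h⟩ := Dec_all hd hell hσ k χ hχ
  let V := volume.real (Metric.closedBall (0 : EE d) 1)
  refine ⟨C * V, by positivity, fun Ω u τ x0 hu hw hτ hb M hM ξ => ?_⟩
  have h0 : 0 < τ := by linarith
  let B := Metric.closedBall x0 τ⁻¹
  let u' := B.indicator u
  have hui : Integrable u' := by
    rw [integrable_indicator_iff Metric.isClosed_closedBall.measurableSet]
    exact (hu.mono hb).integrableOn_compact (isCompact_closedBall _ _)
  have hadm : Adm σ P u' τ x0 := by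
    refine ⟨hui, hτ, (hw.mono (Metric.ball_subset_closedBall.trans hb)).congr fun x hx => ?_⟩
    exact (indicator_of_mem (Metric.ball_subset_closedBall hx) u).symm
  have h2 := h u' τ x0 ξ hadm
  have e : 𝓕 (fun x => χ (τ • (x - x0)) * u x) ξ = Ival u' τ x0 ξ [] χ := by
    rw [fourier_ee, Ival]
    congr 1
    funext x
    simp only [wd, mo, u']
    by_cases hx : x ∈ B
    · rw [indicator_of_mem hx]; ring
    · have : χ (τ • (x - x0)) = 0 := by
        have hT := sc_T hτ x0 hχ
        by_contra h'
        exact hx (Metric.ball_subset_closedBall (hT.ts (subset_tsupport _ h')))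
      rw [this]; ring
  have hI : ∫ x, ‖u' x‖ ≤ V * ((τ ^ d)⁻¹ * M) := by
    have e2 : ∫ x, ‖u' x‖ = ∫ x in B, ‖u x‖ := by
      rw [← integral_indicator Metric.isClosed_closedBall.measurableSet]
      congr 1
      funext x
      exact norm_indicator_eq_indicator_norm u x
    rw [e2]
    have h3 : volume B < ⊤ := (isCompact_closedBall _ _).measure_lt_top
    have := norm_setIntegral_le_of_norm_le_const (f := fun x => ‖u x‖) (C := M) h3 (fun x hx => by
      simpa using hM x hx)
    refine (le_abs_self _).trans (this.trans (le_of_eq ?_))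
    have hv : volume.real B = (τ⁻¹) ^ d * V := by
      have := Measure.addHaar_real_closedBall' (volume : Measure (EE d)) x0 (r := τ⁻¹)
        (by positivity)
      rw [finrank_euclideanSpace_fin] at this
      exact this
    rw [hv, inv_pow]
    ring
  rw [e]
  refine h2.trans ?_
  calc C * (τ ^ k * ∫ x, ‖u' x‖) ≤ C * (τ ^ k * (V * ((τ ^ d)⁻¹ * M))) := by gcongr
    _ = _ := by ring

lemma grad_est (hd : 2 ≤ d) {P : MvPolynomial (Fin d) ℂ} (hell : IsElliptic P) {σ : ℂ}
    (hσ : ‖σ‖ = 1) : ∃ A ≥ 0, ∀ (Ω : Set (EE d)) (u : EE d → ℂ) (τ : ℝ) (x0 : EE d),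
      IsOpen Ω → ContinuousOn u Ω → WSol σ P Ω u → 1 ≤ τ → Metric.closedBall x0 τ⁻¹ ⊆ Ω →
      ContDiffAt ℝ ∞ u x0 ∧ ∀ M, (∀ x ∈ Metric.closedBall x0 τ⁻¹, ‖u x‖ ≤ M) →
        ∀ w : EE d, ‖w‖ ≤ 1 → ‖dd w u x0‖ ≤ A * τ * M := by
  obtain ⟨χ, hχ, h1, hk⟩ := local_decay hd hell hσ
  choose C hC0 hC using hk
  have hpi := Real.pi_pos
  obtain ⟨J, hJe⟩ : ∃ J, J = ∫ ξ : EE d, ((1 + ‖ξ‖) ^ (d + 1))⁻¹ := ⟨_, rfl⟩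
  have hJ : 0 ≤ J := by rw [hJe]; exact integral_nonneg fun ξ => by positivity
  refine ⟨2 * Real.pi * (C (d + 2) * J), by have := hC0 (d + 2); positivity,
    fun Ω u τ x0 hΩ hu hw hτ hb => ?_⟩
  have h0 : 0 < τ := by linarith
  have hT := sc_T hτ x0 hχ
  have hbo : Metric.ball x0 τ⁻¹ ⊆ Ω := Metric.ball_subset_closedBall.trans hb
  let v : EE d → ℂ := fun x => χ (τ • (x - x0)) * u x
  have hvc : Continuous v := by
    rw [continuous_iff_continuousAt]
    intro x
    by_cases hx : x ∈ tsupport (fun x => χ (τ • (x - x0)))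
    · exact hT.sm.continuous.continuousAt.mul (hu.continuousAt (hΩ.mem_nhds (hbo (hT.ts hx))))
    · have : v =ᶠ[𝓝 x] fun _ => 0 := by
        filter_upwards [(isClosed_tsupport _).isOpen_compl.mem_nhds hx] with y hy
        have : (fun x => χ (τ • (x - x0))) y = 0 :=
          image_eq_zero_of_notMem_tsupport (f := fun x => χ (τ • (x - x0))) hy
        simp only [v]
        simp only at this
        rw [this, zero_mul]
      exact continuousAt_const.congr this.symm
  have hvcs : HasCompactSupport v := hT.cs.mul_right
  have hvi : Integrable v := hvc.integrable_of_hasCompactSupport hvcs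
  let G : EE d → ℂ := fun ξ => 𝓕 v (-ξ)
  have hGc : Continuous G := by
    have : Continuous (𝓕 v) := VectorFourier.fourierIntegral_continuous Real.continuous_fourierChar
      (by exact continuous_inner) hvi
    exact this.comp continuous_neg
  obtain ⟨M0, hM0⟩ := (isCompact_closedBall x0 τ⁻¹).exists_bound_of_continuousOn (hu.mono hb)
  have hdec : ∀ k M, (∀ x ∈ Metric.closedBall x0 τ⁻¹, ‖u x‖ ≤ M) → ∀ ξ,
      ‖ξ‖ ^ k * ‖G ξ‖ ≤ C (k + (d + 1)) * (τ ^ (k + (d + 1)) * ((τ ^ d)⁻¹ * M)) *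
        ((τ + ‖ξ‖) ^ (d + 1))⁻¹ := by
    intro k M hM ξ
    have := hC (k + (d + 1)) Ω u τ x0 hu hw hτ hb M hM (-ξ)
    rw [norm_neg] at this
    have hp : 0 < (τ + ‖ξ‖) ^ (d + 1) := by positivity
    rw [← div_eq_mul_inv, le_div_iff₀ hp]
    refine le_trans ?_ this
    rw [pow_add (τ + ‖ξ‖) k (d + 1)]
    calc ‖ξ‖ ^ k * ‖G ξ‖ * (τ + ‖ξ‖) ^ (d + 1) = ‖ξ‖ ^ k * (τ + ‖ξ‖) ^ (d + 1) * ‖G ξ‖ := by ring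
      _ ≤ (τ + ‖ξ‖) ^ k * (τ + ‖ξ‖) ^ (d + 1) * ‖G ξ‖ := by
        gcongr
        linarith
      _ = _ := rfl
  have hIntk : ∀ k : ℕ, Integrable (fun ξ => ‖ξ‖ ^ k * ‖G ξ‖) := by
    intro k
    refine ((integrable_pow_inv' hτ).const_mul
      (C (k + (d + 1)) * (τ ^ (k + (d + 1)) * ((τ ^ d)⁻¹ * M0)))).mono' ?_ ?_
    · exact ((continuous_norm.pow k).mul hGc.norm).aestronglyMeasurable
    · refine Eventually.of_forall fun ξ => ?_
      rw [Real.norm_of_nonneg (by positivity)]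
      exact hdec k M0 hM0 ξ
  have hGi : Integrable G := by
    have := hIntk 0
    simp only [pow_zero, one_mul] at this
    exact (integrable_norm_iff hGc.aestronglyMeasurable).1 this
  have hFv : Integrable (𝓕 v) := by
    have := hGi.comp_neg
    simpa [G] using this
  have hv : 𝓕 G = v := by
    rw [← hvc.fourierInv_fourier_eq hvi hFv, Real.fourierInv_eq_fourier_comp_neg]
  have hvs : ContDiff ℝ ∞ v := by
    rw [← hv]
    exact Real.contDiff_fourier (N := ⊤) fun n _ => hIntk n
  have huv : v =ᶠ[𝓝 x0] u := by
    have hc : ContinuousAt (fun x : EE d => τ • (x - x0)) x0 := by fun_prop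
    have hc' : Tendsto (fun x : EE d => τ • (x - x0)) (𝓝 x0) (𝓝 0) := by
      have := hc.tendsto
      simpa using this
    filter_upwards [hc'.eventually h1] with x hx
    simp only [v, hx, one_mul]
  refine ⟨hvs.contDiffAt.congr_of_eventuallyEq huv.symm, fun M hM w hw1 => ?_⟩
  unfold dd
  rw [← huv.fderiv_eq, ← hv]
  rw [Real.fderiv_fourier hGi (by simpa using hIntk 1)]
  have hn : ‖𝓕 (VectorFourier.fourierSMulRight (innerSL ℝ) G) x0‖ ≤
      ∫ ξ, 2 * Real.pi * (‖ξ‖ * ‖G ξ‖) := by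
    refine (VectorFourier.norm_fourierIntegral_le_integral_norm _ _ _ _ _).trans (le_of_eq ?_)
    congr 1
    funext ξ
    rw [VectorFourier.norm_fourierSMulRight, innerSL_apply_norm]
    ring
  have hM00 : 0 ≤ M := (norm_nonneg _).trans (hM x0 (Metric.mem_closedBall_self (by positivity)))
  calc _ ≤ ‖𝓕 (VectorFourier.fourierSMulRight (innerSL ℝ) G) x0‖ * ‖w‖ :=
        ContinuousLinearMap.le_opNorm _ _
    _ ≤ (∫ ξ, 2 * Real.pi * (‖ξ‖ * ‖G ξ‖)) * 1 := by
      gcongr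
    _ = 2 * Real.pi * ∫ ξ, ‖ξ‖ * ‖G ξ‖ := by rw [mul_one, integral_const_mul]
    _ ≤ 2 * Real.pi * ∫ ξ, C (1 + (d + 1)) * (τ ^ (1 + (d + 1)) * ((τ ^ d)⁻¹ * M)) *
        ((τ + ‖ξ‖) ^ (d + 1))⁻¹ := by
      refine mul_le_mul_of_nonneg_left (integral_mono (by simpa using hIntk 1)
        ((integrable_pow_inv' hτ).const_mul _) fun ξ => ?_) (by positivity)
      simpa using hdec 1 M hM ξ
    _ = _ := by
      rw [integral_const_mul, integral_pow_inv hτ, ← hJe, show 1 + (d + 1) = d + 2 by ring]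
      field_simp
      ring

end Aux4

section Aux5
open MeasureTheory Set Filter Topology
open scoped ContDiff

variable {d : ℕ}

/-- Classical solutions. -/
structure Sol (σ : ℂ) (P : MvPolynomial (Fin d) ℂ) (Ω : Set (EE d)) (u : EE d → ℂ) : Prop where
  sm : ContDiffOn ℝ ∞ u Ω
  eq : ∀ x ∈ Ω, OpS σ P u x = 0

lemma WSol.sol (hd : 2 ≤ d) {P : MvPolynomial (Fin d) ℂ} (hell : IsElliptic P) {σ : ℂ}
    (hσ : ‖σ‖ = 1) {Ω : Set (EE d)} (hΩ : IsOpen Ω) {u : EE d → ℂ} (hu : ContinuousOn u Ω)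
    (h : WSol σ P Ω u) : Sol σ P Ω u := by
  obtain ⟨A, hA, hg⟩ := grad_est hd hell hσ
  have hs : ContDiffOn ℝ ∞ u Ω := by
    intro x hx
    obtain ⟨r, hr, hb⟩ := Metric.nhds_basis_closedBall.mem_iff.1 (hΩ.mem_nhds hx)
    have h1 : 1 ≤ max 1 r⁻¹ := le_max_left _ _
    have h2 : (max 1 r⁻¹)⁻¹ ≤ r := by
      have : r⁻¹ ≤ max 1 r⁻¹ := le_max_right _ _
      calc (max 1 r⁻¹)⁻¹ ≤ (r⁻¹)⁻¹ := by gcongr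
        _ = r := inv_inv r
    exact ((hg Ω u _ x hΩ hu h h1 ((Metric.closedBall_subset_closedBall h2).trans hb)).1
      ).contDiffWithinAt
  exact ⟨hs, smooth_of_WSol hΩ hs h⟩

lemma Sol.dd {σ : ℂ} {P : MvPolynomial (Fin d) ℂ} {Ω : Set (EE d)} (hΩ : IsOpen Ω) {u : EE d → ℂ}
    (h : Sol σ P Ω u) (w : EE d) : Sol σ P Ω (dd w u) := by
  have key : ∀ x ∈ Ω, ContDiffAt ℝ ∞ (_root_.dd w u) x ∧ OpS σ P (_root_.dd w u) x = 0 := by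
    intro x hx
    obtain ⟨F, hF, hFu⟩ := exists_local hΩ h.sm isCompact_singleton (singleton_subset_iff.2 hx)
    have e := hFu x rfl
    have e' : _root_.dd w F =ᶠ[𝓝 x] _root_.dd w u := by
      filter_upwards [e.fderiv (𝕜 := ℝ)] with y hy
      simp only [_root_.dd, hy]
    refine ⟨(dd_smooth hF.sm w).contDiffAt.congr_of_eventuallyEq e'.symm, ?_⟩
    rw [← OpS_congr e', ← dd_OpS_comm hF.sm]
    have e2 : OpS σ P F =ᶠ[𝓝 x] fun _ => 0 := by
      filter_upwards [e.eventually_nhds, hΩ.mem_nhds hx] with y hy hyΩ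
      rw [OpS_congr hy, h.eq y hyΩ]
    unfold _root_.dd
    rw [e2.fderiv_eq]
    simp
  exact ⟨fun x hx => (key x hx).1.contDiffWithinAt, fun x hx => (key x hx).2⟩

lemma Sol.iter {σ : ℂ} {P : MvPolynomial (Fin d) ℂ} {Ω : Set (EE d)} (hΩ : IsOpen Ω) {u : EE d → ℂ}
    (h : Sol σ P Ω u) (w : EE d) (j : ℕ) : Sol σ P Ω ((_root_.dd w)^[j] u) := by
  induction j with
  | zero => exact h
  | succ j ih => rw [Function.iterate_succ_apply']; exact ih.dd hΩ w

lemma iter_zero {u : EE d → ℂ} {x : EE d} (h : u =ᶠ[𝓝 x] 0) (w : EE d) (j : ℕ) :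
    (dd w)^[j] u =ᶠ[𝓝 x] 0 := by
  induction j with
  | zero => exact h
  | succ j ih =>
    rw [Function.iterate_succ_apply']
    filter_upwards [ih.fderiv (𝕜 := ℝ)] with y hy
    simp only [dd, hy]
    simp

lemma taylor_bound {g : ℕ → ℝ → ℂ} {ρ B : ℝ} {k : ℕ}
    (hg : ∀ j, ∀ t ∈ Icc 0 ρ, HasDerivAt (g j) (g (j + 1) t) t)
    (h0 : ∀ j, g j 0 = 0) (hB : ∀ t ∈ Icc 0 ρ, ‖g k t‖ ≤ B) :
    ∀ i ≤ k, ∀ t ∈ Icc 0 ρ, ‖g (k - i) t‖ ≤ B * (t ^ i / i.factorial) := by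
  intro i
  induction i with
  | zero => intro _ t ht; simpa using hB t ht
  | succ i ih =>
    intro hi
    have ih' := ih (by omega)
    have e : k - (i + 1) + 1 = k - i := by omega
    refine image_norm_le_of_norm_deriv_right_le_deriv_boundary (f' := g (k - i))
      (B' := fun t => B * (t ^ i / i.factorial)) ?_ ?_ ?_ ?_ ?_
    · exact fun t ht => (hg _ t ht).continuousAt.continuousWithinAt
    · intro t ht
      have := hg (k - (i + 1)) t (Ico_subset_Icc_self ht)
      rw [e] at this
      exact this.hasDerivWithinAt
    · simp [h0]
    · intro t
      have := ((hasDerivAt_pow (i + 1) t).div_const ((i + 1).factorial : ℝ)).const_mul B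
      refine this.congr_deriv ?_
      rw [Nat.factorial_succ]
      push_cast
      have : (0 : ℝ) < i.factorial := by exact_mod_cast i.factorial_pos
      field_simp
    · intro t ht
      exact ih' t (Ico_subset_Icc_self ht)

lemma uc_local (hd : 2 ≤ d) {P : MvPolynomial (Fin d) ℂ} (hell : IsElliptic P) {σ : ℂ}
    (hσ : ‖σ‖ = 1) : ∃ c > 0, c ≤ 1 ∧ ∀ (Ω : Set (EE d)) (u : EE d → ℂ) (x0 : EE d) (ρ : ℝ),
      IsOpen Ω → Sol σ P Ω u → 0 < ρ → ρ ≤ 1 → Metric.closedBall x0 (2 * ρ) ⊆ Ω →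
      u =ᶠ[𝓝 x0] 0 → ∀ x ∈ Metric.ball x0 (c * ρ), u x = 0 := by
  obtain ⟨A, hA, hg⟩ := grad_est hd hell hσ
  have he := Real.exp_pos 1
  refine ⟨(A * Real.exp 1 + 1)⁻¹, by positivity, inv_le_one_of_one_le₀ (by
    have : 0 ≤ A * Real.exp 1 := by positivity
    linarith), fun Ω u x0 ρ hΩ hu hρ hρ1 hb h0 x hx => ?_⟩
  obtain ⟨M, hM⟩ := (isCompact_closedBall x0 (2 * ρ)).exists_bound_of_continuousOn
    (hu.sm.continuousOn.mono hb)
  have hM0 : 0 ≤ M := (norm_nonneg _).trans (hM x0 (Metric.mem_closedBall_self (by positivity)))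
  by_cases hxx : x = x0
  · rw [hxx]; exact h0.eq_of_nhds
  have hn : 0 < ‖x - x0‖ := norm_pos_iff.2 (sub_ne_zero.2 hxx)
  set T := ‖x - x0‖ with hTdef
  let w : EE d := T⁻¹ • (x - x0)
  have hw : ‖w‖ = 1 := by
    simp only [w, norm_smul, norm_inv, Real.norm_of_nonneg hn.le]
    exact inv_mul_cancel₀ hn.ne'
  have hxw : x0 + T • w = x := by
    simp only [w, smul_smul, mul_inv_cancel₀ hn.ne', one_smul]; abel
  have hT : T < (A * Real.exp 1 + 1)⁻¹ * ρ := by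
    rw [Metric.mem_ball, dist_eq_norm] at hx; exact hx
  have hD : 0 < A * Real.exp 1 + 1 := by positivity
  have hT' : (A * Real.exp 1 + 1) * T < ρ := by
    rwa [inv_mul_eq_div, lt_div_iff₀ hD, mul_comm] at hT
  have hAe : 0 ≤ A * Real.exp 1 * T := by positivity
  have hTρ : T < ρ := by nlinarith
  -- iterated bounds
  have hiter : ∀ k : ℕ, 1 ≤ k → ∀ j ≤ k, ∀ y ∈ Metric.closedBall x0 (2 * ρ - j * (ρ / k)),
      ‖(dd w)^[j] u y‖ ≤ (A * (k / ρ)) ^ j * M := by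
    intro k hk j
    have hk0 : (0 : ℝ) < k := by exact_mod_cast hk
    induction j with
    | zero => intro _ y hy; simpa using hM y (by simpa using hy)
    | succ j ih =>
      intro hj y hy
      have ih' := ih (by omega)
      rw [Function.iterate_succ_apply']
      have hs := hu.iter hΩ w j
      have hτ : 1 ≤ k / ρ := by
        rw [le_div_iff₀ hρ]
        have : (1 : ℝ) ≤ k := by exact_mod_cast hk
        linarith
      have hinv : (k / ρ)⁻¹ = ρ / k := inv_div _ _
      have hsub : Metric.closedBall y (k / ρ)⁻¹ ⊆ Metric.closedBall x0 (2 * ρ - j * (ρ / k)) := by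
        rw [hinv]
        refine Metric.closedBall_subset_closedBall' ?_
        rw [Metric.mem_closedBall] at hy
        push_cast at hy
        linarith
      have hsub2 : Metric.closedBall x0 (2 * ρ - j * (ρ / k)) ⊆ Ω := by
        refine (Metric.closedBall_subset_closedBall ?_).trans hb
        have : 0 ≤ j * (ρ / k) := by positivity
        linarith
      have := (hg Ω _ (k / ρ) y hΩ hs.sm.continuousOn (WSol_of_smooth hΩ hs.sm hs.eq) hτ
        (hsub.trans hsub2)).2 _ (fun z hz => ih' z (hsub hz)) w hw.le
      refine this.trans (le_of_eq ?_)
      ring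
  have hfin : ∀ k : ℕ, 1 ≤ k → ‖u x‖ ≤ M * (A * Real.exp 1 * T / ρ) ^ k := by
    intro k hk
    have hk0 : (0 : ℝ) < k := by exact_mod_cast hk
    let g : ℕ → ℝ → ℂ := fun j t => (dd w)^[j] u (x0 + t • w)
    have hmem : ∀ t ∈ Icc 0 T, x0 + t • w ∈ Metric.closedBall x0 ρ := by
      intro t ht
      rw [Metric.mem_closedBall, dist_eq_norm]
      simp only [add_sub_cancel_left, norm_smul, hw, mul_one, Real.norm_of_nonneg ht.1]
      linarith [ht.2]
    have hb1 : Metric.closedBall x0 ρ ⊆ Ω :=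
      (Metric.closedBall_subset_closedBall (by linarith)).trans hb
    have hder : ∀ j, ∀ t ∈ Icc 0 T, HasDerivAt (g j) (g (j + 1) t) t := by
      intro j t ht
      have hs := hu.iter hΩ w j
      have h1 : HasFDerivAt ((dd w)^[j] u) _ (x0 + t • w) :=
        ((hs.sm.contDiffAt (hΩ.mem_nhds (hb1 (hmem t ht)))).differentiableAt (by simp)).hasFDerivAt
      have h2 : HasDerivAt (fun t : ℝ => x0 + t • w) w t := by
        simpa using ((hasDerivAt_id t).smul_const w).const_add x0
      have := h1.comp_hasDerivAt t h2
      refine this.congr_deriv ?_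
      simp only [g, Function.iterate_succ_apply']
      rfl
    have hz : ∀ j, g j 0 = 0 := by
      intro j
      simpa [g] using (iter_zero h0 w j).eq_of_nhds
    have hBk : ∀ t ∈ Icc 0 T, ‖g k t‖ ≤ (A * (k / ρ)) ^ k * M := by
      intro t ht
      refine hiter k hk k le_rfl _ ?_
      have : 2 * ρ - k * (ρ / k) = ρ := by field_simp; ring
      rw [this]
      exact hmem t ht
    have := taylor_bound hder hz hBk k le_rfl T ⟨hn.le, le_rfl⟩
    simp only [Nat.sub_self, g, Function.iterate_zero, id, hxw] at this
    refine this.trans ?_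
    have hexp := Real.pow_div_factorial_le_exp (x := (k : ℝ)) hk0.le k
    have he1 : Real.exp k = Real.exp 1 ^ k := by rw [← Real.exp_nat_mul, mul_one]
    calc (A * (k / ρ)) ^ k * M * (T ^ k / k.factorial)
        = M * (A * T / ρ) ^ k * ((k : ℝ) ^ k / k.factorial) := by
          simp only [mul_pow, div_pow]; ring
      _ ≤ M * (A * T / ρ) ^ k * Real.exp 1 ^ k := by rw [← he1]; gcongr
      _ = _ := by simp only [mul_pow, div_pow]; ring
  have hq : A * Real.exp 1 * T / ρ < 1 := by
    rw [div_lt_one hρ]; nlinarith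
  have hlim : Tendsto (fun k : ℕ => M * (A * Real.exp 1 * T / ρ) ^ k) atTop (𝓝 (M * 0)) :=
    (tendsto_pow_atTop_nhds_zero_of_lt_one (by positivity) hq).const_mul M
  rw [mul_zero] at hlim
  have := ge_of_tendsto hlim ((eventually_ge_atTop 1).mono fun k hk => hfin k hk)
  exact norm_le_zero_iff.1 this

lemma uc (hd : 2 ≤ d) {P : MvPolynomial (Fin d) ℂ} (hell : IsElliptic P) {σ : ℂ}
    (hσ : ‖σ‖ = 1) {Ω : Set (EE d)} {u : EE d → ℂ} (hΩ : IsOpen Ω) (hu : Sol σ P Ω u)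
    {C : Set (EE d)} (hC : IsPreconnected C) (hCΩ : C ⊆ Ω) {z : EE d} (hz : z ∈ C)
    (h0 : u =ᶠ[𝓝 z] 0) : ∀ x ∈ C, u x = 0 := by
  obtain ⟨c, hc, hc1, H⟩ := uc_local hd hell hσ
  let Z : Set (EE d) := {x | u =ᶠ[𝓝 x] 0}
  have hZ : IsOpen Z := isOpen_setOfPred_eventually_nhds
  have hsub : C ⊆ Z := by
    refine hC.subset_of_closure_inter_subset hZ ⟨z, hz, h0⟩ ?_
    rintro x ⟨hx, hxC⟩
    obtain ⟨r, hr, hb⟩ := Metric.nhds_basis_closedBall.mem_iff.1 (hΩ.mem_nhds (hCΩ hxC))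
    let ρ := min 1 (r / 3)
    have hρ : 0 < ρ := lt_min one_pos (by positivity)
    obtain ⟨x0, hx0, hd0⟩ := Metric.mem_closure_iff.1 hx (c * ρ) (by positivity)
    have hcρ : c * ρ ≤ ρ := mul_le_of_le_one_left hρ.le hc1
    have h3 : 3 * ρ ≤ r := by have := min_le_right 1 (r / 3); simp only [ρ]; linarith
    have hz := H Ω u x0 ρ hΩ hu hρ (min_le_left _ _)
      ((Metric.closedBall_subset_closedBall' (by rw [dist_comm]; linarith)).trans hb) hx0
    show u =ᶠ[𝓝 x] 0
    filter_upwards [Metric.isOpen_ball.mem_nhds (show x ∈ Metric.ball x0 (c * ρ) from hd0)]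
      with y hy
    exact hz y hy
  exact fun x hx => (show u =ᶠ[𝓝 x] 0 from hsub hx).eq_of_nhds

end Aux5

section Aux6
open MeasureTheory Set Filter Topology
open scoped ContDiff FourierTransform

variable {d : ℕ}

lemma circle_bound (p : Polynomial ℂ) (m : ℕ) (hp : p.natDegree ≤ m) (h : ℂ → ℂ)
    (hh : Differentiable ℂ h) (M : ℝ) (hM : ∀ l : ℂ, ‖l‖ = 1 → ‖p.eval l * h l‖ ≤ M) :
    ‖p.coeff m‖ * ‖h 0‖ ≤ M := by
  let Q := (p.reflect m).map (starRingEnd ℂ)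
  have h0 : ‖Q.eval 0‖ = ‖p.coeff m‖ := by
    rw [← Polynomial.coeff_zero_eq_eval_zero, Polynomial.coeff_map, Polynomial.coeff_reflect,
      RCLike.norm_conj]
    congr 2
  have h1 : ∀ l : ℂ, ‖l‖ = 1 → ‖Q.eval l‖ = ‖p.eval l‖ := by
    intro l hl
    have hc : l * (starRingEnd ℂ) l = 1 := by
      rw [Complex.mul_conj, Complex.normSq_eq_norm_sq, hl]; simp
    have hc' : (starRingEnd ℂ) l * l = 1 := by rw [mul_comm]; exact hc
    have e1 : Q.eval l = (starRingEnd ℂ) ((p.reflect m).eval ((starRingEnd ℂ) l)) := by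
      rw [Polynomial.eval_map, ← Polynomial.eval₂_hom, Complex.conj_conj]
    let _ : Invertible l := ⟨(starRingEnd ℂ) l, hc', hc⟩
    have e2 := Polynomial.eval₂_reflect_mul_pow (RingHom.id ℂ) l m p hp
    have e3 : ⅟l = (starRingEnd ℂ) l := rfl
    rw [e3] at e2
    rw [e1, RCLike.norm_conj]
    have e4 : ‖(p.reflect m).eval ((starRingEnd ℂ) l)‖ * ‖l ^ m‖ = ‖p.eval l‖ := by
      rw [← norm_mul]
      exact congrArg norm e2
    rw [← e4, norm_pow, hl]; simp
  have hd : Differentiable ℂ (fun l => Q.eval l * h l) := Q.differentiable.mul hh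
  have := Complex.norm_le_of_forall_mem_frontier_norm_le (F := ℂ) (f := fun l => Q.eval l * h l)
    (U := Metric.ball (0 : ℂ) 1) Metric.isBounded_ball hd.diffContOnCl (C := M) (z := 0) ?_
    (subset_closure (by simp))
  · simpa [h0] using this
  · intro z hz
    rw [frontier_ball _ one_ne_zero] at hz
    have hz1 : ‖z‖ = 1 := by simpa using hz
    have := hM z hz1
    rw [norm_mul] at this ⊢
    rwa [h1 z hz1]

/-- Exponentials with complex frequency. -/
def ec (i0 : Fin d) (ξ : EE d) (l : ℂ) (x : EE d) : ℂ := ee ξ x * Complex.exp (l * (x i0 : ℂ))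

lemma coord_smooth (i : Fin d) : ContDiff ℝ ∞ (fun x : EE d => ((x i : ℝ) : ℂ)) :=
  Complex.ofRealCLM.contDiff.comp (EuclideanSpace.proj (𝕜 := ℝ) i).contDiff

lemma exl_smooth (i0 : Fin d) (l : ℂ) :
    ContDiff ℝ ∞ (fun x : EE d => Complex.exp (l * (x i0 : ℂ))) :=
  (contDiff_const.mul (coord_smooth i0)).cexp

lemma ec_smooth (i0 : Fin d) (ξ : EE d) (l : ℂ) : ContDiff ℝ ∞ (ec i0 ξ l) :=
  (ee_smooth ξ).mul (exl_smooth i0 l)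

/-- frequency vector -/
def zv (i0 : Fin d) (ξ : EE d) (l : ℂ) (i : Fin d) : ℂ := fv ξ i + if i = i0 then l else 0

lemma dd_exl (i0 i : Fin d) (l : ℂ) (x : EE d) :
    dd (EuclideanSpace.single i 1) (fun x : EE d => Complex.exp (l * (x i0 : ℂ))) x =
      (if i = i0 then l else 0) * Complex.exp (l * (x i0 : ℂ)) := by
  have h1 : HasFDerivAt (fun x : EE d => ((x i0 : ℝ) : ℂ))
      (Complex.ofRealCLM.comp (EuclideanSpace.proj (𝕜 := ℝ) i0)) x :=
    (Complex.ofRealCLM.comp (EuclideanSpace.proj (𝕜 := ℝ) i0)).hasFDerivAt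
  have h2 := (h1.const_mul l).cexp
  unfold dd
  rw [h2.fderiv]
  by_cases h : i = i0
  · subst h; simp; ring
  · simp [h, Ne.symm h]

lemma dd_ec (i0 i : Fin d) (ξ : EE d) (l : ℂ) (x : EE d) :
    dd (EuclideanSpace.single i 1) (ec i0 ξ l) x = zv i0 ξ l i * ec i0 ξ l x := by
  have := dd_mul (ee_smooth ξ) (exl_smooth i0 l) (EuclideanSpace.single i 1) x
  unfold ec
  rw [this, dd_ee, dd_exl]
  unfold zv
  ring

lemma wd_ec (i0 : Fin d) (ξ : EE d) (l : ℂ) (w : List (Fin d)) :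
    wd w (ec i0 ξ l) = fun x => (w.map (zv i0 ξ l)).prod * ec i0 ξ l x := by
  induction w with
  | nil => funext x; simp [wd]
  | cons i w ih =>
    funext x
    simp only [wd, ih, List.map_cons, List.prod_cons]
    rw [dd_const_mul (ec_smooth i0 ξ l)]
    simp only [dd_ec]
    ring

lemma OpS_ec (i0 : Fin d) (ξ : EE d) (l : ℂ) (σ : ℂ) (P : MvPolynomial (Fin d) ℂ) (x : EE d) :
    OpS σ P (ec i0 ξ l) x = sym σ P (zv i0 ξ l) * ec i0 ξ l x := by
  simp only [OpS, wd_ec, sym, Finset.sum_mul]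
  exact Finset.sum_congr rfl fun α _ => by ring

/-- symbol as polynomial -/
def zp (i0 : Fin d) (ξ : EE d) (i : Fin d) : Polynomial ℂ :=
  Polynomial.C (fv ξ i) + if i = i0 then Polynomial.X else 0

def symp (i0 : Fin d) (ξ : EE d) (σ : ℂ) (P : MvPolynomial (Fin d) ℂ) : Polynomial ℂ :=
  ∑ α ∈ P.support, Polynomial.C (P.coeff α) * (Polynomial.C (σ ^ (mword (fun i => α i)).length) *
    ((mword (fun i => α i)).map (zp i0 ξ)).prod)

lemma zp_eval (i0 : Fin d) (ξ : EE d) (i : Fin d) (l : ℂ) : (zp i0 ξ i).eval l = zv i0 ξ l i := by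
  unfold zp zv
  split_ifs <;> simp

lemma symp_eval (i0 : Fin d) (ξ : EE d) (σ : ℂ) (P : MvPolynomial (Fin d) ℂ) (l : ℂ) :
    (symp i0 ξ σ P).eval l = sym σ P (zv i0 ξ l) := by
  simp only [symp, sym, Polynomial.eval_finsetSum, Polynomial.eval_mul, Polynomial.eval_C]
  refine Finset.sum_congr rfl fun α _ => ?_
  rw [Polynomial.eval_list_prod, List.map_map]
  congr 4
  funext i
  exact zp_eval i0 ξ i l

lemma zp_deg (i0 : Fin d) (ξ : EE d) (i : Fin d) : (zp i0 ξ i).natDegree ≤ 1 := by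
  unfold zp
  split_ifs
  · refine (Polynomial.natDegree_add_le _ _).trans ?_
    simp
  · simp

lemma zw_deg (i0 : Fin d) (ξ : EE d) (w : List (Fin d)) :
    ((w.map (zp i0 ξ)).prod).natDegree ≤ w.length := by
  induction w with
  | nil => simp
  | cons i w ih =>
    simp only [List.map_cons, List.prod_cons, List.length_cons]
    refine (Polynomial.natDegree_mul_le).trans ?_
    have := zp_deg i0 ξ i
    omega

lemma zw_coeff (i0 : Fin d) (ξ : EE d) (w : List (Fin d)) :
    ((w.map (zp i0 ξ)).prod).coeff w.length = (w.map (fun i => if i = i0 then (1:ℂ) else 0)).prod := by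
  induction w with
  | nil => simp
  | cons i w ih =>
    simp only [List.map_cons, List.prod_cons, List.length_cons]
    rw [add_comm, Polynomial.coeff_mul_add_eq_of_natDegree_le (zp_deg i0 ξ i) (zw_deg i0 ξ w), ih]
    congr 1
    unfold zp
    split_ifs <;> simp [Polynomial.coeff_C]

lemma len_le {P : MvPolynomial (Fin d) ℂ} {α : Fin d →₀ ℕ} (hα : α ∈ P.support) :
    (mword (fun i => α i)).length ≤ P.totalDegree := by
  rw [degree_eq_len]
  exact MvPolynomial.le_totalDegree hα

lemma symp_deg (i0 : Fin d) (ξ : EE d) (σ : ℂ) (P : MvPolynomial (Fin d) ℂ) :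
    (symp i0 ξ σ P).natDegree ≤ P.totalDegree := by
  refine Polynomial.natDegree_sum_le_of_forall_le _ _ fun α hα => ?_
  refine (Polynomial.natDegree_C_mul_le _ _).trans ((Polynomial.natDegree_C_mul_le _ _).trans ?_)
  exact (zw_deg i0 ξ _).trans (len_le hα)

lemma symp_coeff (i0 : Fin d) (ξ : EE d) (σ : ℂ) (P : MvPolynomial (Fin d) ℂ) :
    (symp i0 ξ σ P).coeff P.totalDegree = σ ^ P.totalDegree *
      MvPolynomial.eval (fun i => if i = i0 then (1:ℂ) else 0)
        (MvPolynomial.homogeneousComponent P.totalDegree P) := by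
  rw [eval_hom, Finset.sum_filter, Finset.mul_sum, symp, Polynomial.finsetSum_coeff]
  refine Finset.sum_congr rfl fun α hα => ?_
  rw [Polynomial.coeff_C_mul, Polynomial.coeff_C_mul]
  split_ifs with h
  · rw [← degree_eq_len] at h
    have e := zw_coeff i0 ξ (mword fun i => α i)
    rw [mword_prod, h] at e
    rw [e, h]; ring
  · have : (mword fun i => α i).length < P.totalDegree :=
      lt_of_le_of_ne (len_le hα) (by rwa [degree_eq_len])
    rw [Polynomial.coeff_eq_zero_of_natDegree_lt (lt_of_le_of_lt (zw_deg i0 ξ _) this)]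
    simp

lemma abs_coord (i0 : Fin d) (x : EE d) : |x i0| ≤ ‖x‖ := by
  simpa using PiLp.norm_apply_le x i0

lemma ec_norm (i0 : Fin d) (ξ : EE d) (l : ℂ) (x : EE d) :
    ‖ec i0 ξ l x‖ ≤ Real.exp (‖l‖ * ‖x‖) := by
  rw [ec, norm_mul, ee_norm, one_mul]
  refine (Complex.norm_exp_le_exp_norm _).trans (Real.exp_le_exp.2 ?_)
  rw [norm_mul, Complex.norm_real]
  exact mul_le_mul_of_nonneg_left (abs_coord i0 x) (norm_nonneg _)

lemma hdiff (i0 : Fin d) (ξ : EE d) {φ : EE d → ℂ} (hφ : ContDiff ℝ ∞ φ)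
    (hc : HasCompactSupport φ) : Differentiable ℂ (fun l : ℂ => ∫ x, ec i0 ξ l x * φ x) := by
  intro l0
  have hcx : Continuous fun x : EE d => ((x i0 : ℝ) : ℂ) := (coord_smooth i0).continuous
  have := hasDerivAt_integral_of_dominated_loc_of_deriv_le (μ := (volume : Measure (EE d)))
    (F := fun l x => ec i0 ξ l x * φ x)
    (F' := fun l x => ec i0 ξ l x * (x i0 : ℂ) * φ x) (x₀ := l0) (s := Metric.ball l0 1)
    (bound := fun x => Real.exp ((‖l0‖ + 1) * ‖x‖) * ‖x‖ * ‖φ x‖)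
    (Metric.ball_mem_nhds l0 one_pos)
    (Eventually.of_forall fun l => ((ec_smooth i0 ξ l).continuous.mul
      hφ.continuous).aestronglyMeasurable)
    (int_mul (ec_smooth i0 ξ l0).continuous hφ.continuous hc)
    (((ec_smooth i0 ξ l0).continuous.mul hcx).mul hφ.continuous).aestronglyMeasurable ?_ ?_ ?_
  · exact this.2.differentiableAt
  · refine Eventually.of_forall fun x l hl => ?_
    rw [norm_mul, norm_mul]
    refine mul_le_mul_of_nonneg_right ?_ (norm_nonneg _)
    refine mul_le_mul ?_ ?_ (norm_nonneg _) (Real.exp_nonneg _)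
    · refine (ec_norm i0 ξ l x).trans (Real.exp_le_exp.2 ?_)
      refine mul_le_mul_of_nonneg_right ?_ (norm_nonneg _)
      have h1 : ‖l - l0‖ < 1 := by simpa [dist_eq_norm] using hl
      have := norm_le_norm_add_norm_sub l0 l
      rw [norm_sub_rev] at this
      linarith
    · rw [Complex.norm_real]; exact abs_coord i0 x
  · refine Continuous.integrable_of_hasCompactSupport ?_ hc.norm.mul_left
    exact (by fun_prop : Continuous fun x : EE d => Real.exp ((‖l0‖ + 1) * ‖x‖) * ‖x‖).mul
      hφ.continuous.norm
  · refine Eventually.of_forall fun x l _ => ?_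
    have h1 : HasDerivAt (fun l : ℂ => l * (x i0 : ℂ)) (x i0 : ℂ) l := by
      simpa using (hasDerivAt_id l).mul_const (x i0 : ℂ)
    have h2 := ((h1.cexp).const_mul (ee ξ x)).mul_const (φ x)
    unfold ec
    simpa [mul_assoc] using h2

lemma malgrange (hd : 2 ≤ d) {P : MvPolynomial (Fin d) ℂ} (hell : IsElliptic P) {σ : ℂ}
    (hσ : ‖σ‖ = 1) (R : ℝ) (hR : 0 ≤ R) : ∃ C ≥ 0, ∀ φ : EE d → ℂ, IsT (Metric.closedBall 0 R) φ →
      ∀ ξ, ‖𝓕 φ ξ‖ ≤ C * ∫ x, ‖OpS σ P φ x‖ := by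
  let i0 : Fin d := ⟨0, by omega⟩
  set b := ‖MvPolynomial.eval (fun i => if i = i0 then (1:ℂ) else 0)
        (MvPolynomial.homogeneousComponent P.totalDegree P)‖ with hb
  have hb0 : 0 < b := by
    have := hell (Pi.single i0 1) (by simp)
    rw [hb]
    refine norm_pos_iff.2 ?_
    convert this using 3
    funext i
    by_cases h : i = i0 <;> simp [h]
  refine ⟨Real.exp R / b, by positivity, fun φ hφ ξ => ?_⟩
  have key := circle_bound (symp i0 ξ (-σ) P) P.totalDegree (symp_deg _ _ _ _)
    (fun l : ℂ => ∫ x, ec i0 ξ l x * φ x) (hdiff i0 ξ hφ.sm hφ.cs)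
    (Real.exp R * ∫ x, ‖OpS σ P φ x‖) ?_
  · rw [symp_coeff, norm_mul, norm_pow, norm_neg, hσ, one_pow, one_mul, ← hb] at key
    have e : 𝓕 φ ξ = ∫ x, ec i0 ξ 0 x * φ x := by
      rw [fourier_ee]
      congr 1
      funext x
      simp [ec, mul_comm]
    rw [e, div_mul_eq_mul_div, le_div_iff₀ hb0, mul_comm]
    exact key
  · intro l hl
    rw [symp_eval, ← integral_const_mul]
    have e : ∫ x, sym (-σ) P (zv i0 ξ l) * (ec i0 ξ l x * φ x) = ∫ x, ec i0 ξ l x * OpS σ P φ x := by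
      rw [ibp_OpS (ec_smooth i0 ξ l) hφ.sm hφ.cs σ P]
      congr 1
      funext x
      rw [OpS_ec]; ring
    rw [e, ← integral_const_mul]
    refine norm_integral_le_of_norm_le ?_ (Eventually.of_forall fun x => ?_)
    · exact ((OpS_smooth hφ.sm σ P).continuous.integrable_of_hasCompactSupport
        (OpS_compact σ P hφ.cs)).norm.const_mul _
    · rw [norm_mul]
      by_cases hx : x ∈ tsupport φ
      · refine mul_le_mul_of_nonneg_right ?_ (norm_nonneg _)
        refine (ec_norm i0 ξ l x).trans (Real.exp_le_exp.2 ?_)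
        rw [hl, one_mul]
        simpa using hφ.ts hx
      · rw [OpS_zero_off σ P hx]; simp

lemma conj_two : (starRingEnd ℂ) (2 : ℂ) = 2 := by
  have := Complex.conj_ofReal 2
  simpa using this

lemma conv_fourier {φ ρ : EE d → ℂ} (hφ : IsT univ φ) (hρ : IsT univ ρ) {A : ℝ}
    (hA : ∀ ξ, ‖𝓕 φ ξ‖ ≤ A) (x : EE d) :
    ‖∫ y, φ y * ρ (x - y)‖ ≤ A * ∫ ξ, ‖𝓕 ρ ξ‖ := by
  have hψ : ContDiff ℝ ∞ (fun y => ρ (x - y)) := hρ.sm.comp (contDiff_const.sub contDiff_id)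
  have hψc : HasCompactSupport (fun y => ρ (x - y)) :=
    hρ.cs.comp_homeomorph (Homeomorph.subLeft x)
  let F := hφ.cs.toSchwartzMap hφ.sm
  let S := hψc.toSchwartzMap hψ
  let R := hρ.cs.toSchwartzMap hρ.sm
  have e1 : ∫ y, φ y * ρ (x - y) = ∫ ξ, 𝓕 F ξ * (𝓕⁻ S) ξ := by
    rw [SchwartzMap.integral_fourier_mul_eq]
    simp [F, S]
  have e2 : ∀ ξ, ‖(𝓕⁻ S) ξ‖ = ‖𝓕 ρ ξ‖ := by
    intro ξ
    have : (𝓕⁻ S) ξ = ∫ y, ρ (x - y) * (starRingEnd ℂ) (ee ξ y) := by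
      rw [SchwartzMap.fourierInv_coe, Real.fourierInv_eq']
      congr 1
      funext y
      rw [smul_eq_mul, mul_comm, ee, ← Complex.exp_conj]
      have e3 : S y = ρ (x - y) := rfl
      rw [e3]
      congr 2
      simp [conj_two]
      ring
    rw [this, fourier_ee, ← integral_sub_left_eq_self _ _ x]
    have : ∀ y, ρ (x - (x - y)) * (starRingEnd ℂ) (ee ξ (x - y)) =
        (starRingEnd ℂ) (ee ξ x) * (ρ y * ee ξ y) := by
      intro y
      have e4 : (starRingEnd ℂ) (ee ξ (x - y)) = (starRingEnd ℂ) (ee ξ x) * ee ξ y := by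
        unfold ee
        rw [← Complex.exp_conj, ← Complex.exp_conj, ← Complex.exp_add]
        congr 1
        simp [inner_sub_left, conj_two]
        ring
      rw [e4, sub_sub_cancel]
      ring
    simp only [this]
    rw [integral_const_mul, norm_mul, RCLike.norm_conj, ee_norm, one_mul]
  rw [e1, ← integral_const_mul]
  refine norm_integral_le_of_norm_le ?_ (Eventually.of_forall fun ξ => ?_)
  · have : Integrable (fun ξ => ‖(𝓕 R) ξ‖) := (𝓕 R).integrable.norm
    have := this.const_mul A
    have e3 : ((𝓕 R : SchwartzMap (EE d) ℂ) : EE d → ℂ) = 𝓕 ρ := by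
      rw [SchwartzMap.fourier_coe]; rfl
    rw [e3] at this
    exact this
  · rw [norm_mul, e2]
    refine mul_le_mul_of_nonneg_right ?_ (norm_nonneg _)
    rw [SchwartzMap.fourier_coe]
    exact hA ξ
end Aux6

section Aux7
open MeasureTheory Set Filter Topology
open scoped ContDiff Convolution Pointwise

variable {d : ℕ}

/-- Convolution. -/
def cv (f ρ : EE d → ℂ) (x : EE d) : ℂ := ∫ y, f y * ρ (x - y)

lemma cv_eq (f ρ : EE d → ℂ) : cv f ρ = (f ⋆[ContinuousLinearMap.mul ℝ ℂ, volume] ρ) := rfl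

lemma cv_cont {f ρ : EE d → ℂ} (hf : LocallyIntegrable f) (hρ : IsT univ ρ) :
    Continuous (cv f ρ) :=
  hρ.cs.continuous_convolution_right (ContinuousLinearMap.mul ℝ ℂ) hf hρ.sm.continuous

lemma cv_smooth {f ρ : EE d → ℂ} (hf : LocallyIntegrable f) (hρ : IsT univ ρ) :
    ContDiff ℝ ∞ (cv f ρ) :=
  hρ.cs.contDiff_convolution_right (ContinuousLinearMap.mul ℝ ℂ) hf hρ.sm

lemma IsT.loc {Ω : Set (EE d)} {φ : EE d → ℂ} (h : IsT Ω φ) : LocallyIntegrable φ :=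
  h.sm.continuous.locallyIntegrable

lemma IsT.integrable {Ω : Set (EE d)} {φ : EE d → ℂ} (h : IsT Ω φ) : Integrable φ :=
  h.sm.continuous.integrable_of_hasCompactSupport h.cs

lemma dd_cv {Ω : Set (EE d)} {θ ρ : EE d → ℂ} (hθ : IsT Ω θ) (hρ : IsT univ ρ) (w : EE d) :
    dd w (cv θ ρ) = cv (dd w θ) ρ := by
  funext x
  have h := hθ.cs.hasFDerivAt_convolution_left (ContinuousLinearMap.mul ℝ ℂ)
    (hθ.sm.of_le (by simp)) hρ.loc x
  unfold dd
  rw [cv_eq, h.fderiv]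
  have hi : Integrable (fun t => ((ContinuousLinearMap.mul ℝ ℂ).precompL (EE d)
      (fderiv ℝ θ t)) (ρ (x - t))) :=
    (hθ.cs.fderiv (𝕜 := ℝ)).convolutionExists_left ((ContinuousLinearMap.mul ℝ ℂ).precompL (EE d))
      (hθ.sm.continuous_fderiv (by simp)) hρ.loc x
  unfold convolution
  rw [ContinuousLinearMap.integral_apply hi]
  rfl

lemma wd_cv {Ω : Set (EE d)} {θ ρ : EE d → ℂ} (hθ : IsT Ω θ) (hρ : IsT univ ρ) (l : List (Fin d)) :
    wd l (cv θ ρ) = cv (wd l θ) ρ := by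
  induction l with
  | nil => rfl
  | cons i l ih =>
    simp only [wd]
    rw [ih, dd_cv ⟨wd_smooth hθ.sm l, wd_compact l hθ.cs, (wd_tsupport l θ).trans hθ.ts⟩ hρ]

lemma IsT.flip {ρ : EE d → ℂ} (hρ : IsT univ ρ) (x : EE d) : IsT univ (fun y => ρ (x - y)) :=
  ⟨hρ.sm.comp (contDiff_const.sub contDiff_id), hρ.cs.comp_homeomorph (Homeomorph.subLeft x),
    subset_univ _⟩

lemma OpS_cv {Ω : Set (EE d)} {θ ρ : EE d → ℂ} (hθ : IsT Ω θ) (hρ : IsT univ ρ) (σ : ℂ)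
    (P : MvPolynomial (Fin d) ℂ) :
    OpS σ P (cv θ ρ) = cv (OpS σ P θ) ρ := by
  funext x
  simp only [OpS, wd_cv hθ hρ]
  unfold cv
  simp only [OpS, Finset.sum_mul]
  rw [integral_finsetSum]
  · refine Finset.sum_congr rfl fun α _ => ?_
    rw [← integral_const_mul, ← integral_const_mul]
    congr 1
    funext y
    ring
  · intro α _
    have := int_mul (u := fun y => P.coeff α * (σ ^ (mword (fun i => α i)).length *
      wd (mword (fun i => α i)) θ y)) (φ := fun y => ρ (x - y)) ?_ (hρ.flip x).sm.continuous
      (hρ.flip x).cs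
    · exact this
    · exact continuous_const.mul (continuous_const.mul (wd_smooth hθ.sm _).continuous)

lemma cv_zero {f ρ : EE d → ℂ} {ε : ℝ} (hε : ∀ x, ε < ‖x‖ → ρ x = 0) {x : EE d}
    (hx : ∀ y ∈ Metric.closedBall x ε, f y = 0) : cv f ρ x = 0 := by
  unfold cv
  refine integral_eq_zero_of_ae (Eventually.of_forall fun y => ?_)
  by_cases h : y ∈ Metric.closedBall x ε
  · simp [hx y h]
  · have : ρ (x - y) = 0 := by
      apply hε
      rw [Metric.mem_closedBall, dist_comm, dist_eq_norm] at h
      linarith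
    simp [this]

lemma cv_test {Ω Ω' : Set (EE d)} {θ ρ : EE d → ℂ} {ε : ℝ} (hθ : IsT Ω θ) (hρ : IsT univ ρ)
    (hε : ∀ x, ε < ‖x‖ → ρ x = 0) (hΩ : ∀ x ∈ Ω, Metric.closedBall x ε ⊆ Ω') :
    IsT Ω' (cv θ ρ) := by
  have hc : IsCompact (tsupport θ + Metric.closedBall (0 : EE d) ε) :=
    hθ.cs.isCompact.add (isCompact_closedBall _ _)
  have hs : tsupport (cv θ ρ) ⊆ tsupport θ + Metric.closedBall (0 : EE d) ε := by
    refine closure_minimal (fun x hx => ?_) hc.isClosed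
    by_contra h
    refine hx (cv_zero hε fun y hy => ?_)
    by_contra h'
    refine h ⟨y, subset_tsupport _ h', x - y, ?_, by simp⟩
    rw [Metric.mem_closedBall, dist_comm, dist_eq_norm] at hy
    simpa using hy
  refine ⟨cv_smooth hθ.loc hρ, hc.of_isClosed_subset (isClosed_tsupport _) hs, hs.trans ?_⟩
  rintro _ ⟨y, hy, z, hz, rfl⟩
  refine hΩ y (hθ.ts hy) ?_
  simpa using hz

lemma cv_fubini {u θ ρ : EE d → ℂ} (hu : LocallyIntegrable u) (hθ : IsT univ θ) (hρ : IsT univ ρ)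
    (hev : ∀ x, ρ (-x) = ρ x) :
    ∫ x, cv u ρ x * θ x = ∫ y, u y * cv θ ρ y := by
  have hc : IsCompact (tsupport θ - tsupport ρ) := by
    have := (hθ.cs.isCompact.prod hρ.cs.isCompact).image continuous_sub
    convert this using 1
    exact (Set.image_prod (fun a b : EE d => a - b)).symm
  set B := tsupport θ - tsupport ρ with hB
  have hu' : Integrable (B.indicator u) :=
    (integrable_indicator_iff hc.measurableSet).2 (hu.integrableOn_isCompact hc)
  obtain ⟨M, hM⟩ := hρ.cs.exists_bound_of_continuous hρ.sm.continuous
  have hI : Integrable (fun p : EE d × EE d => ρ (p.1 - p.2) * (θ p.1 * B.indicator u p.2))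
      (volume.prod volume) := by
    refine (hθ.integrable.mul_prod hu').bdd_mul (c := M) ?_ (Eventually.of_forall fun p => hM _)
    exact (hρ.sm.continuous.comp (continuous_fst.sub continuous_snd)).aestronglyMeasurable
  have e : ∀ x y, ρ (x - y) * (θ x * B.indicator u y) = u y * ρ (x - y) * θ x := by
    intro x y
    by_cases hy : y ∈ B
    · rw [indicator_of_mem hy]; ring
    · rw [indicator_of_notMem hy]
      by_cases h1 : θ x = 0
      · simp [h1]
      · have : ρ (x - y) = 0 := by
          by_contra h2
          exact hy ⟨x, subset_tsupport _ h1, x - y, subset_tsupport _ h2, by simp⟩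
        simp [this]
  have h := integral_integral_swap (f := fun x y => ρ (x - y) * (θ x * B.indicator u y)) hI
  simp only [e] at h
  have l1 : ∀ x, cv u ρ x * θ x = ∫ y, u y * ρ (x - y) * θ x := fun x => by
    rw [cv, integral_mul_const]
  have l2 : ∀ y, u y * cv θ ρ y = ∫ x, u y * ρ (x - y) * θ x := fun y => by
    rw [cv, ← integral_const_mul]
    congr 1
    funext x
    rw [← hev (x - y), neg_sub]; ring
  simp only [l1, l2]
  exact h

/-- A mollifier of radius `ε`. -/
structure Mol (ε : ℝ) (ρ : EE d → ℂ) : Prop where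
  T : IsT univ ρ
  ev : ∀ x, ρ (-x) = ρ x
  z : ∀ x, ε < ‖x‖ → ρ x = 0
  ap : ∀ θ : EE d → ℂ, Continuous θ → ∀ x η, (∀ y ∈ Metric.ball x ε, dist (θ y) (θ x) ≤ η) →
    ‖cv θ ρ x - θ x‖ ≤ η

lemma exists_mol {ε : ℝ} (hε : 0 < ε) : ∃ ρ : EE d → ℂ, Mol ε ρ := by
  let φ : ContDiffBump (0 : EE d) := ⟨ε / 2, ε, by linarith, by linarith⟩
  refine ⟨fun x => ((φ.normed volume x : ℝ) : ℂ), ⟨?_, ?_, subset_univ _⟩, ?_, ?_, ?_⟩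
  · exact Complex.ofRealCLM.contDiff.comp φ.contDiff_normed
  · exact (φ.hasCompactSupport_normed (μ := volume)).comp_left (g := fun t : ℝ => (t : ℂ)) (by simp)
  · intro x; simp [φ.normed_neg]
  · intro x hx
    have : x ∉ Function.support (φ.normed volume) := by
      rw [φ.support_normed_eq]
      simpa using hx.le
    simpa using this
  · intro θ hθ x η h
    have := φ.dist_normed_convolution_le (μ := volume) hθ.aestronglyMeasurable h
    rw [dist_eq_norm] at this
    have e : cv θ (fun x => ((φ.normed volume x : ℝ) : ℂ)) x =
        (φ.normed volume ⋆[ContinuousLinearMap.lsmul ℝ ℝ, volume] θ) x := by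
      have h1 := integral_sub_left_eq_self (μ := (volume : Measure (EE d)))
        (fun y => θ y * ((φ.normed volume (x - y) : ℝ) : ℂ)) x
      have h2 : cv θ (fun x => ((φ.normed volume x : ℝ) : ℂ)) x =
        ∫ y, θ y * ((φ.normed volume (x - y) : ℝ) : ℂ) := rfl
      rw [h2, ← h1]
      unfold convolution
      refine integral_congr_ae (Eventually.of_forall fun y => ?_)
      simp [mul_comm]
    rw [e]
    exact this
end Aux7

section Aux8
open MeasureTheory Set Filter Topology
open scoped ContDiff FourierTransform

variable {d : ℕ}

/-- `L²` norm as a real number. -/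
def n2 (h : EE d → ℂ) : ℝ := (eLpNorm h 2 volume).toReal

lemma n2_nonneg (h : EE d → ℂ) : 0 ≤ n2 h := ENNReal.toReal_nonneg

lemma IsT.memLp {Ω : Set (EE d)} {φ : EE d → ℂ} (h : IsT Ω φ) : MemLp φ 2 volume :=
  h.sm.continuous.memLp_of_hasCompactSupport h.cs

lemma cs_int {h θ : EE d → ℂ} (hh : MemLp h 2 volume) (hθ : MemLp θ 2 volume) :
    Integrable (fun x => h x * θ x) := by
  have := hh.integrable_mul hθ
  exact this

lemma cs_le {h θ : EE d → ℂ} (hh : MemLp h 2 volume) (hθ : MemLp θ 2 volume) :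
    ∫ x, ‖h x * θ x‖ ≤ n2 h * n2 θ := by
  have h1 : eLpNorm (h • θ) 1 volume ≤ eLpNorm h 2 volume * eLpNorm θ 2 volume :=
    eLpNorm_smul_le_mul_eLpNorm hθ.1 hh.1
  rw [integral_norm_eq_lintegral_enorm (cs_int hh hθ).1]
  rw [eLpNorm_one_eq_lintegral_enorm] at h1
  unfold n2
  rw [← ENNReal.toReal_mul]
  exact ENNReal.toReal_mono (ENNReal.mul_ne_top hh.2.ne hθ.2.ne) h1

lemma cs_le' {h θ : EE d → ℂ} (hh : MemLp h 2 volume) (hθ : MemLp θ 2 volume) :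
    ‖∫ x, h x * θ x‖ ≤ n2 h * n2 θ :=
  (norm_integral_le_integral_norm _).trans (cs_le hh hθ)

lemma n2_tri {h k : EE d → ℂ} (hh : MemLp h 2 volume) (hk : MemLp k 2 volume) :
    n2 (fun x => h x + k x) ≤ n2 h + n2 k := by
  unfold n2
  rw [← ENNReal.toReal_add hh.2.ne hk.2.ne]
  exact ENNReal.toReal_mono (ENNReal.add_ne_top.2 ⟨hh.2.ne, hk.2.ne⟩)
    (eLpNorm_add_le hh.1 hk.1 (by norm_num))

lemma n2_neg (h : EE d → ℂ) : n2 (fun x => - h x) = n2 h := by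
  unfold n2
  congr 1
  exact eLpNorm_neg h 2 volume

lemma n2_flip (ρ : EE d → ℂ) (hρ : IsT univ ρ) (x : EE d) : n2 (fun y => ρ (x - y)) = n2 ρ := by
  unfold n2
  congr 1
  exact eLpNorm_comp_measurePreserving hρ.sm.continuous.aestronglyMeasurable
    (Measure.measurePreserving_sub_left volume x)

lemma IsT.sub {Ω : Set (EE d)} {φ ψ : EE d → ℂ} (h : IsT Ω φ) (h' : IsT Ω ψ) :
    IsT Ω (fun x => φ x - ψ x) :=
  ⟨h.sm.sub h'.sm, h.cs.sub h'.cs, by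
    have h1 : tsupport (fun x => φ x - ψ x) ⊆ tsupport φ ∪ tsupport ψ := tsupport_sub φ ψ
    exact h1.trans (union_subset h.ts h'.ts)⟩

lemma OpS_sub {f g : EE d → ℂ} (hf : ContDiff ℝ ∞ f) (hg : ContDiff ℝ ∞ g) (σ : ℂ)
    (P : MvPolynomial (Fin d) ℂ) :
    OpS σ P (fun x => f x - g x) = fun x => OpS σ P f x - OpS σ P g x := by
  have h1 : (fun x => f x - g x) = fun x => f x + (-1 : ℂ) * g x := by funext x; ring
  rw [h1, OpS_add hf (contDiff_const.mul hg), OpS_const_mul hg]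
  funext x; ring

lemma cv_sub {f g ρ : EE d → ℂ} (hf : LocallyIntegrable f) (hg : LocallyIntegrable g)
    (hρ : IsT univ ρ) (x : EE d) : cv (fun y => f y - g y) ρ x = cv f ρ x - cv g ρ x := by
  have h := fun (k : EE d → ℂ) (hk : LocallyIntegrable k) =>
    hρ.cs.convolutionExists_right (ContinuousLinearMap.mul ℝ ℂ) hk hρ.sm.continuous x
  unfold cv
  rw [← integral_sub]
  · congr 1
    funext y
    ring
  · exact h f hf
  · exact h g hg

lemma dual1 (hd : 2 ≤ d) {P : MvPolynomial (Fin d) ℂ} (hell : IsElliptic P)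
    {W L L' : Set (EE d)} {R ε ε0 : ℝ} (hW : W ⊆ Metric.closedBall 0 R)
    (hL' : IsCompact L') (hε : 0 < ε) (hε0 : 2 * ε ≤ ε0)
    (hLL' : ∀ x ∈ L, Metric.closedBall x ε0 ⊆ L')
    (hgeo : ∀ z ∉ L', ∃ C : Set (EE d), IsPreconnected C ∧ C ⊆ L'ᶜ ∧ z ∈ C ∧ ∃ w ∈ C,
      Disjoint (Metric.closedBall w ε0) W)
    {F : EE d → ℂ} (hF : IsT univ F) (hFL : ∀ x ∈ L', OpS 1 P F x = 0)
    {t : EE d → ℂ} (ht : MemLp t 2 volume) {φ : ℕ → EE d → ℂ} (hφ : ∀ j, IsT W (φ j))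
    (hlim : Tendsto (fun j => n2 (fun x => OpS (-1) P (φ j) x - t x)) atTop (𝓝 0))
    (hoff : ∀ θ, IsT univ θ → (∀ x ∈ L, θ x = 0) → ∫ x, t x * θ x = 0)
    {ρ : EE d → ℂ} (hρ : Mol ε ρ) : ∫ x, t x * cv F ρ x = 0 := by
  have hs1 : ‖(-1 : ℂ)‖ = 1 := by simp
  obtain ⟨C, hC, hmal⟩ := malgrange hd hell hs1 (max R 0) (le_max_right _ _)
  have hW' : W ⊆ Metric.closedBall 0 (max R 0) :=
    hW.trans (Metric.closedBall_subset_closedBall (le_max_left _ _))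
  obtain ⟨χ, hχ, hχ1⟩ := exists_cutoff (isCompact_closedBall (0 : EE d) (max R 0)) isOpen_univ
    (subset_univ _)
  have hχ1' : ∀ x ∈ Metric.closedBall (0 : EE d) (max R 0), χ x = 1 :=
    fun x hx => hχ1.self_of_nhdsSet x hx
  set a : ℕ → ℝ := fun j => n2 (fun x => OpS (-1) P (φ j) x - t x) with ha
  have ha0 : ∀ j, 0 ≤ a j := fun j => n2_nonneg _
  have hr : ∀ j, MemLp (fun x => OpS (-1) P (φ j) x - t x) 2 volume :=
    fun j => ((hφ j).op (-1) P).memLp.sub ht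
  set D : ℝ := C * n2 χ * ∫ ξ, ‖𝓕 ρ ξ‖ with hD
  have hI0 : 0 ≤ ∫ ξ, ‖𝓕 ρ ξ‖ := integral_nonneg fun ξ => norm_nonneg _
  have hD0 : 0 ≤ D := mul_nonneg (mul_nonneg hC (n2_nonneg _)) hI0
  have hcau : ∀ j k x, ‖cv (φ j) ρ x - cv (φ k) ρ x‖ ≤ D * (a j + a k) := by
    intro j k x
    have hT := (hφ j).sub (hφ k)
    rw [← cv_sub (hφ j).loc (hφ k).loc hρ.T]
    have h1 := hmal _ (hT.mono hW')
    have h2 : ∫ x, ‖OpS (-1) P (fun y => φ j y - φ k y) x‖ ≤ (a j + a k) * n2 χ := by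
      have e1 : ∀ x, ‖OpS (-1) P (fun y => φ j y - φ k y) x‖ =
          ‖OpS (-1) P (fun y => φ j y - φ k y) x * χ x‖ := by
        intro x
        by_cases hx : x ∈ tsupport (fun y => φ j y - φ k y)
        · rw [hχ1' x (hW' (hT.ts hx)), mul_one]
        · rw [OpS_zero_off _ _ hx, zero_mul]
      simp only [e1]
      refine (cs_le (hT.op (-1) P).memLp hχ.memLp).trans
        (mul_le_mul_of_nonneg_right ?_ (n2_nonneg _))
      rw [OpS_sub (hφ j).sm (hφ k).sm]
      have e2 := n2_tri (hr j) (hr k).neg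
      have e3 := n2_neg (fun x => OpS (-1) P (φ k) x - t x)
      calc n2 (fun x => OpS (-1) P (φ j) x - OpS (-1) P (φ k) x)
          = n2 (fun x => (OpS (-1) P (φ j) x - t x) +
            (-fun x => OpS (-1) P (φ k) x - t x) x) := by
            congr 1; funext x; simp
        _ ≤ _ := e2
        _ = a j + a k := congrArg (a j + ·) e3
    have h3 := conv_fourier (hT.mono (subset_univ _)) hρ.T h1 x
    refine h3.trans ?_
    rw [hD]
    have h4 : C * (∫ x, ‖OpS (-1) P (fun y => φ j y - φ k y) x‖) ≤ C * ((a j + a k) * n2 χ) :=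
      mul_le_mul_of_nonneg_left h2 hC
    calc _ ≤ C * ((a j + a k) * n2 χ) * ∫ ξ, ‖𝓕 ρ ξ‖ := mul_le_mul_of_nonneg_right h4 hI0
      _ = _ := by ring
  have hex : ∀ x, ∃ y, Tendsto (fun j => cv (φ j) ρ x) atTop (𝓝 y) := by
    intro x
    refine cauchySeq_tendsto_of_complete ?_
    rw [Metric.cauchySeq_iff']
    intro η hη
    have hl2 : Tendsto (fun j => D * a j) atTop (𝓝 0) := by
      have := hlim.const_mul D
      simpa using this
    obtain ⟨N, hN⟩ := eventually_atTop.1 (hl2.eventually (gt_mem_nhds (half_pos hη)))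
    refine ⟨N, fun n hn => ?_⟩
    rw [dist_eq_norm]
    have h1 := hN n hn
    have h2 := hN N le_rfl
    refine lt_of_le_of_lt (hcau n N x) ?_
    rw [mul_add]
    linarith
  choose Φ hΦ using hex
  have hΦb : ∀ j x, ‖cv (φ j) ρ x - Φ x‖ ≤ D * a j := by
    intro j x
    have h1 : Tendsto (fun k => ‖cv (φ j) ρ x - cv (φ k) ρ x‖) atTop (𝓝 ‖cv (φ j) ρ x - Φ x‖) :=
      (tendsto_const_nhds.sub (hΦ x)).norm
    have h2 : Tendsto (fun k => D * (a j + a k)) atTop (𝓝 (D * (a j + 0))) :=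
      (tendsto_const_nhds.add hlim).const_mul D
    rw [add_zero] at h2
    exact le_of_tendsto_of_tendsto' h1 h2 fun k => hcau j k x
  have hDa : Tendsto (fun j => D * a j) atTop (𝓝 0) := by
    have := hlim.const_mul D
    simpa using this
  have hunif : TendstoUniformly (fun j => cv (φ j) ρ) Φ atTop := by
    rw [Metric.tendstoUniformly_iff]
    intro η hη
    filter_upwards [hDa.eventually (gt_mem_nhds hη)] with j hj x
    rw [dist_comm, dist_eq_norm]
    exact lt_of_le_of_lt (hΦb j x) hj
  have hΦc : Continuous Φ :=
    hunif.continuous (Frequently.of_forall fun j => cv_cont (hφ j).loc hρ.T)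
  have hweak : ∀ θ, IsT univ θ → ∫ x, Φ x * OpS 1 P θ x = ∫ x, t x * cv θ ρ x := by
    intro θ hθ
    have hcvT : IsT univ (cv θ ρ) := cv_test hθ hρ.T hρ.z fun _ _ => subset_univ _
    have hop : IsT univ (OpS 1 P θ) := hθ.op 1 P
    have e1 : ∀ j, ∫ x, cv (φ j) ρ x * OpS 1 P θ x = ∫ x, OpS (-1) P (φ j) x * cv θ ρ x := by
      intro j
      rw [cv_fubini (hφ j).loc hop hρ.T hρ.ev, ← OpS_cv hθ hρ.T, ibp_OpS (hφ j).sm hcvT.sm hcvT.cs]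
    have l1 : Tendsto (fun j => ∫ x, cv (φ j) ρ x * OpS 1 P θ x) atTop
        (𝓝 (∫ x, Φ x * OpS 1 P θ x)) := by
      rw [tendsto_iff_norm_sub_tendsto_zero]
      refine squeeze_zero (fun _ => norm_nonneg _)
        (g := fun j => D * a j * ∫ x, ‖OpS 1 P θ x‖) (fun j => ?_) ?_
      · rw [← integral_sub, ← integral_const_mul]
        · refine norm_integral_le_of_norm_le (hop.integrable.norm.const_mul _)
            (Eventually.of_forall fun x => ?_)
          rw [← sub_mul, norm_mul]
          exact mul_le_mul_of_nonneg_right (hΦb j x) (norm_nonneg _)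
        · exact int_mul (cv_cont (hφ j).loc hρ.T) hop.sm.continuous hop.cs
        · exact int_mul hΦc hop.sm.continuous hop.cs
      · have := hDa.mul_const (∫ x, ‖OpS 1 P θ x‖)
        simpa using this
    have l2 : Tendsto (fun j => ∫ x, OpS (-1) P (φ j) x * cv θ ρ x) atTop
        (𝓝 (∫ x, t x * cv θ ρ x)) := by
      rw [tendsto_iff_norm_sub_tendsto_zero]
      refine squeeze_zero (fun _ => norm_nonneg _)
        (g := fun j => a j * n2 (cv θ ρ)) (fun j => ?_) ?_
      · rw [← integral_sub]
        · simp only [← sub_mul]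
          exact cs_le' (hr j) hcvT.memLp
        · exact cs_int ((hφ j).op (-1) P).memLp hcvT.memLp
        · exact cs_int ht hcvT.memLp
      · have := hlim.mul_const (n2 (cv θ ρ))
        simpa using this
    simp only [e1] at l1
    exact tendsto_nhds_unique l1 l2
  have hws : WSol (-1) P L'ᶜ Φ := by
    intro θ hθ
    have hθ' := hθ.mono (subset_univ _)
    rw [neg_neg, hweak θ hθ']
    refine hoff _ (cv_test hθ' hρ.T hρ.z fun _ _ => subset_univ _) fun x hx => ?_
    refine cv_zero hρ.z fun y hy => ?_
    have : y ∈ L' := hLL' x hx (Metric.closedBall_subset_closedBall (by linarith) hy)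
    exact image_eq_zero_of_notMem_tsupport fun h => hθ.ts h this
  have hop : IsOpen L'ᶜ := hL'.isClosed.isOpen_compl
  have hsol := hws.sol hd hell hs1 hop hΦc.continuousOn
  have hzero : ∀ x, x ∉ L' → Φ x = 0 := by
    intro z hz
    obtain ⟨C', hC', hCL, hzC, w, hw, hdis⟩ := hgeo z hz
    refine uc hd hell hs1 hop hsol hC' hCL hw ?_ z hzC
    filter_upwards [Metric.ball_mem_nhds w hε] with x hx
    refine tendsto_nhds_unique (hΦ x) ?_
    have : ∀ j, cv (φ j) ρ x = 0 := by
      intro j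
      refine cv_zero hρ.z fun y hy => ?_
      refine image_eq_zero_of_notMem_tsupport fun h => ?_
      refine disjoint_left.1 hdis ?_ ((hφ j).ts h)
      rw [Metric.mem_closedBall] at hy ⊢
      rw [Metric.mem_ball] at hx
      linarith [dist_triangle y x w]
    simp [this]
  rw [← hweak F hF]
  refine integral_eq_zero_of_ae (Eventually.of_forall fun x => ?_)
  by_cases hx : x ∈ L'
  · simp [hFL x hx]
  · simp [hzero x hx]
end Aux8

section Aux9
open MeasureTheory Set Filter Topology
open scoped ContDiff Pointwise

variable {d : ℕ}

lemma dual2 (hd : 2 ≤ d) {P : MvPolynomial (Fin d) ℂ} (hell : IsElliptic P)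
    {W L L' : Set (EE d)} {R ε0 : ℝ} (hW : W ⊆ Metric.closedBall 0 R)
    (hL' : IsCompact L') (hε0 : 0 < ε0)
    (hLL' : ∀ x ∈ L, Metric.closedBall x ε0 ⊆ L')
    (hgeo : ∀ z ∉ L', ∃ C : Set (EE d), IsPreconnected C ∧ C ⊆ L'ᶜ ∧ z ∈ C ∧ ∃ w ∈ C,
      Disjoint (Metric.closedBall w ε0) W)
    {F : EE d → ℂ} (hF : IsT univ F) (hFL : ∀ x ∈ L', OpS 1 P F x = 0)
    {t : EE d → ℂ} (ht : MemLp t 2 volume) {φ : ℕ → EE d → ℂ} (hφ : ∀ j, IsT W (φ j))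
    (hlim : Tendsto (fun j => n2 (fun x => OpS (-1) P (φ j) x - t x)) atTop (𝓝 0))
    (hoff : ∀ θ, IsT univ θ → (∀ x ∈ L, θ x = 0) → ∫ x, t x * θ x = 0) :
    ∫ x, t x * F x = 0 := by
  have hcB : IsCompact (tsupport F + Metric.closedBall (0 : EE d) 1) :=
    hF.cs.isCompact.add (isCompact_closedBall _ _)
  obtain ⟨χ, hχ, hχ1⟩ := exists_cutoff hcB isOpen_univ (subset_univ _)
  have hχ1' := fun x hx => hχ1.self_of_nhdsSet x hx
  set A := ∫ x, ‖t x * χ x‖ with hA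
  have hA0 : 0 ≤ A := integral_nonneg fun _ => norm_nonneg _
  have huc : UniformContinuous F := hF.cs.uniformContinuous_of_continuous hF.sm.continuous
  have key : ∀ η > 0, ‖∫ x, t x * F x‖ ≤ η * A := by
    intro η hη
    obtain ⟨ε, hε, hu⟩ := Metric.uniformContinuous_iff.1 huc η hη
    set ε' := min ε (min (ε0 / 2) 1) with hε'
    have he0 : 0 < ε' := lt_min hε (lt_min (by linarith) one_pos)
    have he1 : 2 * ε' ≤ ε0 := by
      have : ε' ≤ ε0 / 2 := (min_le_right _ _).trans (min_le_left _ _)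
      linarith
    have he2 : ε' ≤ 1 := (min_le_right _ _).trans (min_le_right _ _)
    obtain ⟨ρ, hρ⟩ := exists_mol (d := d) he0
    have h0 := dual1 hd hell hW hL' he0 he1 hLL' hgeo hF hFL ht hφ hlim hoff hρ
    have hcvT : IsT univ (cv F ρ) := cv_test hF hρ.T hρ.z fun _ _ => subset_univ _
    have e : ∫ x, t x * F x = ∫ x, (t x * F x - t x * cv F ρ x) := by
      rw [integral_sub (cs_int ht hF.memLp) (cs_int ht hcvT.memLp), h0, sub_zero]
    rw [e, hA, ← integral_const_mul]
    refine norm_integral_le_of_norm_le ((cs_int ht hχ.memLp).norm.const_mul _)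
      (Eventually.of_forall fun x => ?_)
    rw [← mul_sub, norm_mul, norm_mul]
    by_cases hx : x ∈ tsupport F + Metric.closedBall (0 : EE d) 1
    · rw [hχ1' x hx, norm_one, mul_one, mul_comm η]
      refine mul_le_mul_of_nonneg_left ?_ (norm_nonneg _)
      rw [norm_sub_rev]
      refine hρ.ap F hF.sm.continuous x η fun y hy => ?_
      exact (hu (lt_of_lt_of_le hy (min_le_left _ _))).le
    · have hz : ∀ y ∈ Metric.closedBall x ε', F y = 0 := by
        intro y hy
        refine image_eq_zero_of_notMem_tsupport fun h => hx ⟨y, h, x - y, ?_, by simp⟩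
        rw [Metric.mem_closedBall, dist_comm, dist_eq_norm] at hy
        simpa using hy.trans he2
      rw [cv_zero hρ.z hz, hz x (Metric.mem_closedBall_self he0.le)]
      simp only [sub_zero, norm_zero, mul_zero]
      positivity
  have h1 : ‖∫ x, t x * F x‖ ≤ 0 := by
    refine le_of_forall_pos_le_add fun η hη => ?_
    have := key (η / (A + 1)) (by positivity)
    refine this.trans ?_
    rw [zero_add, div_mul_eq_mul_div, div_le_iff₀ (by linarith)]
    nlinarith
  simpa using h1

abbrev L2 (d : ℕ) := Lp ℂ 2 (volume : Measure (EE d))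

lemma L2_inner (T G : L2 d) : inner ℂ T G = ∫ x, (starRingEnd ℂ) (T x) * G x := by
  rw [MeasureTheory.L2.inner_def]
  congr 1
  funext x
  rw [RCLike.inner_apply, mul_comm]

def Rsub (P : MvPolynomial (Fin d) ℂ) (W : Set (EE d)) : Submodule ℂ (L2 d) where
  carrier := {h | ∃ φ, IsT W φ ∧ h =ᵐ[volume] fun x => (starRingEnd ℂ) (OpS (-1) P φ x)}
  zero_mem' := by
    refine ⟨fun _ => 0, ⟨contDiff_const, HasCompactSupport.zero, ?_⟩, ?_⟩
    · have : tsupport (fun _ : EE d => (0 : ℂ)) = ∅ := by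
        rw [tsupport_eq_empty_iff]; rfl
      rw [this]; exact empty_subset _
    · filter_upwards [Lp.coeFn_zero ℂ 2 (volume : Measure (EE d))] with x hx
      rw [hx, OpS_zero_off]
      · simp
      · have : tsupport (fun _ : EE d => (0 : ℂ)) = ∅ := by
          rw [tsupport_eq_empty_iff]; rfl
        rw [this]; exact notMem_empty x
  add_mem' := by
    rintro a b ⟨φ, hφ, ha⟩ ⟨ψ, hψ, hb⟩
    refine ⟨fun x => φ x + ψ x, ⟨hφ.sm.add hψ.sm, hφ.cs.add hψ.cs, ?_⟩, ?_⟩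
    · have h1 : tsupport (fun x => φ x + ψ x) ⊆ tsupport φ ∪ tsupport ψ := tsupport_add φ ψ
      exact h1.trans (union_subset hφ.ts hψ.ts)
    · filter_upwards [ha, hb, Lp.coeFn_add a b] with x h1 h2 h3
      rw [h3, Pi.add_apply, h1, h2, OpS_add hφ.sm hψ.sm, map_add]
  smul_mem' := by
    rintro c a ⟨φ, hφ, ha⟩
    refine ⟨fun x => (starRingEnd ℂ) c * φ x, ⟨contDiff_const.mul hφ.sm, hφ.cs.mul_left, ?_⟩, ?_⟩
    · exact (tsupport_mul_subset_right).trans hφ.ts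
    · filter_upwards [ha, Lp.coeFn_smul c a] with x h1 h3
      rw [h3, Pi.smul_apply, h1, OpS_const_mul hφ.sm, map_mul, Complex.conj_conj, smul_eq_mul]

def Hoff (L : Set (EE d)) : Submodule ℂ (L2 d) where
  carrier := {h | ∀ᵐ x, x ∈ L → h x = 0}
  zero_mem' := by
    show ∀ᵐ x, x ∈ L → (0 : L2 d) x = 0
    filter_upwards [Lp.coeFn_zero ℂ 2 (volume : Measure (EE d))] with x hx _
    rw [hx]; rfl
  add_mem' := by
    intro a b ha hb
    show ∀ᵐ x, x ∈ L → (a + b : L2 d) x = 0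
    have ha' : ∀ᵐ x, x ∈ L → a x = 0 := ha
    have hb' : ∀ᵐ x, x ∈ L → b x = 0 := hb
    filter_upwards [ha', hb', Lp.coeFn_add a b] with x h1 h2 h3 hx
    rw [h3, Pi.add_apply, h1 hx, h2 hx, add_zero]
  smul_mem' := by
    intro c a ha
    show ∀ᵐ x, x ∈ L → (c • a : L2 d) x = 0
    have ha' : ∀ᵐ x, x ∈ L → a x = 0 := ha
    filter_upwards [ha', Lp.coeFn_smul c a] with x h1 h3 hx
    rw [h3, Pi.smul_apply, h1 hx, smul_zero]

lemma conj_memLp {f : EE d → ℂ} (hf : MemLp f 2 volume) :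
    MemLp (fun x => (starRingEnd ℂ) (f x)) 2 volume := by
  exact hf.star

lemma dense_F (hd : 2 ≤ d) {P : MvPolynomial (Fin d) ℂ} (hell : IsElliptic P)
    {W L L' : Set (EE d)} {R ε0 : ℝ} (hW : W ⊆ Metric.closedBall 0 R)
    (hL' : IsCompact L') (hε0 : 0 < ε0)
    (hLL' : ∀ x ∈ L, Metric.closedBall x ε0 ⊆ L')
    (hgeo : ∀ z ∉ L', ∃ C : Set (EE d), IsPreconnected C ∧ C ⊆ L'ᶜ ∧ z ∈ C ∧ ∃ w ∈ C,
      Disjoint (Metric.closedBall w ε0) W)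
    {F : EE d → ℂ} (hF : IsT univ F) (hFL : ∀ x ∈ L', OpS 1 P F x = 0) :
    hF.memLp.toLp F ∈ ((Rsub P W)ᗮ ⊔ Hoff L).topologicalClosure := by
  rw [← Submodule.orthogonal_orthogonal_eq_closure, Submodule.mem_orthogonal]
  intro T hT
  have hT1 : T ∈ (Rsub P W).topologicalClosure := by
    rw [← Submodule.orthogonal_orthogonal_eq_closure]
    exact Submodule.orthogonal_le le_sup_left hT
  have hT2 : T ∈ (Hoff L)ᗮ := Submodule.orthogonal_le le_sup_right hT
  have hT1' : T ∈ closure ((Rsub P W : Submodule ℂ (L2 d)) : Set (L2 d)) := hT1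
  obtain ⟨r, hr, hrT⟩ := mem_closure_iff_seq_limit.1 hT1'
  have hr' : ∀ j, ∃ φ, IsT W φ ∧ r j =ᵐ[volume] fun x => (starRingEnd ℂ) (OpS (-1) P φ x) := hr
  choose φ hφ hrφ using hr'
  rw [L2_inner]
  have e : ∫ x, (starRingEnd ℂ) (T x) * (hF.memLp.toLp F : L2 d) x =
      ∫ x, (starRingEnd ℂ) (T x) * F x := by
    refine integral_congr_ae ?_
    filter_upwards [hF.memLp.coeFn_toLp] with x hx
    rw [hx]
  rw [e]
  refine dual2 hd hell hW hL' hε0 hLL' hgeo hF hFL (t := fun x => (starRingEnd ℂ) (T x))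
    (conj_memLp (Lp.memLp T)) hφ ?_ ?_
  · rw [tendsto_iff_norm_sub_tendsto_zero] at hrT
    refine hrT.congr fun j => ?_
    rw [Lp.norm_def, n2]
    congr 1
    refine eLpNorm_congr_norm_ae ?_
    filter_upwards [hrφ j, Lp.coeFn_sub (r j) T] with x h1 h2
    rw [h2, Pi.sub_apply, h1, ← RCLike.norm_conj]
    simp
  · intro θ hθ hθL
    have hm : hθ.memLp.toLp θ ∈ Hoff L := by
      show ∀ᵐ x, x ∈ L → (hθ.memLp.toLp θ : L2 d) x = 0
      filter_upwards [hθ.memLp.coeFn_toLp] with x hx hxL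
      rw [hx, hθL x hxL]
    have h := (Submodule.mem_orthogonal' _ _).1 hT2 _ hm
    rw [L2_inner] at h
    rw [← h]
    refine integral_congr_ae ?_
    filter_upwards [hθ.memLp.coeFn_toLp] with x hx
    rw [hx]

/-- One step approximation. -/
lemma approx_step (hd : 2 ≤ d) {P : MvPolynomial (Fin d) ℂ} (hell : IsElliptic P)
    {W L L' K W' : Set (EE d)} {R ε0 : ℝ} (hW : W ⊆ Metric.closedBall 0 R)
    (hL' : IsCompact L') (hε0 : 0 < ε0)
    (hLL' : ∀ x ∈ L, Metric.closedBall x ε0 ⊆ L')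
    (hKL : ∀ x ∈ K, Metric.closedBall x ε0 ⊆ L)
    (hWW' : ∀ x ∈ W', Metric.closedBall x ε0 ⊆ W)
    (hgeo : ∀ z ∉ L', ∃ C : Set (EE d), IsPreconnected C ∧ C ⊆ L'ᶜ ∧ z ∈ C ∧ ∃ w ∈ C,
      Disjoint (Metric.closedBall w ε0) W)
    {F : EE d → ℂ} (hF : IsT univ F) (hFL : ∀ x ∈ L', OpS 1 P F x = 0) {η : ℝ} (hη : 0 < η) :
    ∃ g : EE d → ℂ, Continuous g ∧ WSol 1 P W' g ∧ ∀ y ∈ K, ‖g y - F y‖ < η := by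
  have huc : UniformContinuous F := hF.cs.uniformContinuous_of_continuous hF.sm.continuous
  obtain ⟨ε, hε, hu⟩ := Metric.uniformContinuous_iff.1 huc (η / 2) (by linarith)
  set ε' := min ε ε0 with hε'
  have he0 : 0 < ε' := lt_min hε hε0
  have he1 : ε' ≤ ε0 := min_le_right _ _
  obtain ⟨ρ, hρ⟩ := exists_mol (d := d) he0
  have hcl := dense_F hd hell hW hL' hε0 hLL' hgeo hF hFL
  have hcl' : hF.memLp.toLp F ∈ closure (((Rsub P W)ᗮ ⊔ Hoff L : Submodule ℂ (L2 d)) : Set (L2 d)) :=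
    hcl
  have hn := n2_nonneg ρ
  obtain ⟨v, hv, hvF⟩ := Metric.mem_closure_iff.1 hcl' (η / (2 * (n2 ρ + 1))) (by positivity)
  obtain ⟨g, hg, k, hk, rfl⟩ := Submodule.mem_sup.1 hv
  have hk' : ∀ᵐ x, x ∈ L → k x = 0 := hk
  have hgl : LocallyIntegrable (g : EE d → ℂ) volume :=
    (Lp.memLp g).locallyIntegrable (by norm_num)
  refine ⟨cv g ρ, cv_cont hgl hρ.T, ?_, ?_⟩
  · intro φ hφ
    have hφ' := hφ.mono (subset_univ _)
    rw [cv_fubini hgl (hφ'.op (-1) P) hρ.T hρ.ev, ← OpS_cv hφ hρ.T]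
    have hψ : IsT W (cv φ ρ) := cv_test hφ hρ.T hρ.z fun x hx =>
      (Metric.closedBall_subset_closedBall he1).trans (hWW' x hx)
    have hm := conj_memLp (hψ.op (-1) P).memLp
    have hR : hm.toLp _ ∈ Rsub P W := ⟨_, hψ, hm.coeFn_toLp⟩
    have h := (Submodule.mem_orthogonal _ _).1 hg _ hR
    rw [L2_inner] at h
    rw [← h]
    refine integral_congr_ae ?_
    filter_upwards [hm.coeFn_toLp] with x hx
    rw [hx, Complex.conj_conj, mul_comm]
  · intro y hy
    have h1 : ‖cv F ρ y - F y‖ ≤ η / 2 := by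
      refine hρ.ap F hF.sm.continuous y _ fun z hz => ?_
      exact (hu (lt_of_lt_of_le hz (min_le_left _ _))).le
    have hfl := (hρ.T.flip y)
    have e : cv g ρ y - cv F ρ y = ∫ z, ((g + k - hF.memLp.toLp F : L2 d) z) * ρ (y - z) := by
      rw [← cv_sub hgl hF.loc hρ.T]
      unfold cv
      refine integral_congr_ae ?_
      filter_upwards [hk', Lp.coeFn_sub (g + k) (hF.memLp.toLp F), Lp.coeFn_add g k,
        hF.memLp.coeFn_toLp] with z z1 z2 z3 z4
      rw [z2, Pi.sub_apply, z3, Pi.add_apply, z4]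
      by_cases hz : z ∈ Metric.closedBall y ε'
      · rw [z1 (hKL y hy (Metric.closedBall_subset_closedBall he1 hz)), add_zero]
      · have : ρ (y - z) = 0 := by
          apply hρ.z
          rw [Metric.mem_closedBall, dist_comm, dist_eq_norm] at hz
          linarith
        simp [this]
    have h2 : ‖cv g ρ y - cv F ρ y‖ < η / 2 := by
      rw [e]
      have h3 := cs_le' (Lp.memLp (g + k - hF.memLp.toLp F : L2 d)) hfl.memLp
      rw [n2_flip ρ hρ.T] at h3
      have h4 : n2 ((g + k - hF.memLp.toLp F : L2 d) : EE d → ℂ) < η / (2 * (n2 ρ + 1)) := by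
        rw [dist_comm, dist_eq_norm, Lp.norm_def] at hvF
        exact hvF
      refine lt_of_le_of_lt h3 ?_
      rw [lt_div_iff₀ (by positivity)] at h4
      have h5 := n2_nonneg ((g + k - hF.memLp.toLp F : L2 d) : EE d → ℂ)
      by_cases hz : n2 ((g + k - hF.memLp.toLp F : L2 d) : EE d → ℂ) = 0
      · rw [hz]; simp; exact hη
      · have h6 := lt_of_le_of_ne h5 (Ne.symm hz)
        nlinarith
    calc ‖cv g ρ y - F y‖ = ‖(cv g ρ y - cv F ρ y) + (cv F ρ y - F y)‖ := by congr 1; ring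
      _ ≤ _ := norm_add_le _ _
      _ < η := by linarith
end Aux9

section Aux10
open MeasureTheory Set Filter Topology
open scoped ContDiff

variable {d : ℕ}

/-- Closed exhaustion. -/
def Cx (X : Set (EE d)) (t : ℝ) : Set (EE d) := {x | ‖x‖ ≤ t ∧ ∀ w ∉ X, 1 / t ≤ dist x w}

lemma Cx_compact (X : Set (EE d)) (t : ℝ) : IsCompact (Cx X t) := by
  refine (isCompact_closedBall (0 : EE d) t).of_isClosed_subset ?_ fun x hx => by simpa using hx.1
  have : Cx X t = {x | ‖x‖ ≤ t} ∩ ⋂ w : EE d, ⋂ _ : w ∉ X, {x | 1 / t ≤ dist x w} := by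
    ext x; simp [Cx]
  rw [this]
  refine (isClosed_le continuous_norm continuous_const).inter
    (isClosed_iInter fun w => isClosed_iInter fun _ => isClosed_le continuous_const (by fun_prop))

lemma Cx_ball (X : Set (EE d)) {t s : ℝ} (ht : 0 < t) (hts : t < s) :
    ∃ ε > 0, ∀ x ∈ Cx X t, Metric.closedBall x ε ⊆ Cx X s := by
  have h1 : 1 / s < 1 / t := one_div_lt_one_div_of_lt ht hts
  refine ⟨min (s - t) (1 / t - 1 / s), lt_min (by linarith) (by linarith), fun x hx y hy => ?_⟩
  have hy1 : dist y x ≤ s - t := (Metric.mem_closedBall.1 hy).trans (min_le_left _ _)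
  have hy2 : dist y x ≤ 1 / t - 1 / s := (Metric.mem_closedBall.1 hy).trans (min_le_right _ _)
  refine ⟨?_, fun w hw => ?_⟩
  · have h2 := dist_triangle y x 0
    have h3 := hx.1
    rw [dist_zero_right, dist_zero_right] at h2
    linarith
  · have h2 := dist_triangle x y w
    have h3 := hx.2 w hw
    rw [dist_comm x y] at h2
    linarith

lemma Cx_sub (X : Set (EE d)) {t : ℝ} (ht : 0 < t) : Cx X t ⊆ X := by
  intro x hx
  by_contra h
  have := hx.2 x h
  rw [dist_self] at this
  have : 0 < 1 / t := by positivity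
  linarith

lemma Cx_mono (X : Set (EE d)) {t s : ℝ} (ht : 0 < t) (hts : t ≤ s) : Cx X t ⊆ Cx X s :=
  fun _ hx => ⟨hx.1.trans hts, fun w hw => (one_div_le_one_div_of_le ht hts).trans (hx.2 w hw)⟩

lemma Cx_exh {X : Set (EE d)} (hX : IsOpen X) {K : Set (EE d)} (hK : IsCompact K) (hKX : K ⊆ X) :
    ∃ N : ℕ, 1 ≤ N ∧ K ⊆ Cx X N := by
  obtain ⟨δ, hδ, hδX⟩ := hK.exists_thickening_subset_open hX hKX
  obtain ⟨R, hR⟩ := hK.isBounded.exists_norm_le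
  obtain ⟨N, hN⟩ := exists_nat_ge (max (max R (1 / δ)) 1)
  have hN1 : (1 : ℝ) ≤ N := (le_max_right _ _).trans hN
  have hN2 : R ≤ N := ((le_max_left _ _).trans (le_max_left _ _)).trans hN
  have hN3 : 1 / δ ≤ N := ((le_max_right _ _).trans (le_max_left _ _)).trans hN
  refine ⟨N, by exact_mod_cast hN1, fun x hx => ⟨(hR x hx).trans hN2, fun w hw => ?_⟩⟩
  have h1 : 1 / (N : ℝ) ≤ δ := by
    rw [div_le_iff₀ (by linarith)]
    rw [div_le_iff₀ hδ] at hN3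
    linarith
  by_contra h
  refine hw (hδX (Metric.mem_thickening_iff.2 ⟨x, hx, ?_⟩))
  rw [dist_comm]
  linarith

lemma exh_open {X : Set (EE d)} (hX : IsOpen X) (n : ℕ) : IsOpen (exhSet X n) := by
  have : exhSet X n = X ∩ ({x | ‖x‖ < (n : ℝ)} ∩
    {x | ENNReal.ofReal (1 / (n : ℝ)) < Metric.infEDist x Xᶜ}) := rfl
  rw [this]
  exact hX.inter ((isOpen_lt continuous_norm continuous_const).inter
    (isOpen_lt continuous_const Metric.continuous_infEDist))

lemma Cx_sub_exh (X : Set (EE d)) {t : ℝ} (ht : 0 < t) {n : ℕ} (htn : t < n) :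
    Cx X t ⊆ exhSet X n := by
  intro x hx
  refine ⟨Cx_sub X ht hx, lt_of_le_of_lt hx.1 htn, ?_⟩
  have h1 : 1 / (n : ℝ) < 1 / t := one_div_lt_one_div_of_lt ht htn
  refine lt_of_lt_of_le ((ENNReal.ofReal_lt_ofReal_iff (by positivity)).2 h1) ?_
  refine Metric.le_infEDist.2 fun w hw => ?_
  rw [edist_dist]
  exact ENNReal.ofReal_le_ofReal (hx.2 w hw)

lemma exh_compact {X : Set (EE d)} {n : ℕ} (hn : 1 ≤ n) {K : Set (EE d)} (hK : IsCompact K)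
    (hKn : K ⊆ exhSet X n) : ∃ t : ℝ, 0 < t ∧ t < n ∧ K ⊆ Cx X t := by
  have hn' : (1 : ℝ) ≤ n := by exact_mod_cast hn
  rcases K.eq_empty_or_nonempty with rfl | hne
  · exact ⟨(n : ℝ) / 2, by linarith, by linarith, empty_subset _⟩
  obtain ⟨r, hr, hKr⟩ := exists_lt_subset_ball (x := (0 : EE d)) (r := (n : ℝ)) hK.isClosed
    (fun y hy => by simpa using (hKn hy).2.1)
  obtain ⟨y0, hy0, hmin⟩ := hK.exists_isMinOn hne
    (Metric.continuous_infEDist (s := Xᶜ)).continuousOn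
  have h0 : ENNReal.ofReal (1 / (n : ℝ)) < Metric.infEDist y0 Xᶜ := (hKn hy0).2.2
  obtain ⟨s, hs1, hs2⟩ := ENNReal.lt_iff_exists_nnreal_btwn.1 h0
  have hs : 1 / (n : ℝ) < s := by
    rw [← ENNReal.ofReal_coe_nnreal] at hs1
    exact (ENNReal.ofReal_lt_ofReal_iff_of_nonneg (by positivity)).1 hs1
  have hs0 : 0 < (s : ℝ) := lt_of_le_of_lt (by positivity) hs
  have hs3 : 1 / (s : ℝ) < n := by
    rw [div_lt_iff₀ hs0]
    rw [div_lt_iff₀ (by linarith)] at hs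
    linarith
  refine ⟨max (max r (1 / (s : ℝ))) ((n : ℝ) / 2), ?_, ?_, fun y hy => ⟨?_, fun w hw => ?_⟩⟩
  · exact lt_of_lt_of_le (by linarith) (le_max_right _ _)
  · exact max_lt (max_lt hr hs3) (by linarith)
  · have : ‖y‖ < r := by simpa using hKr hy
    exact this.le.trans ((le_max_left _ _).trans (le_max_left _ _))
  · have h1 : (s : ENNReal) ≤ edist y w := hs2.le.trans ((hmin hy).trans
      (Metric.infEDist_le_edist_of_mem hw))
    rw [edist_dist, ← ENNReal.ofReal_coe_nnreal, ENNReal.ofReal_le_ofReal_iff dist_nonneg] at h1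
    refine le_trans ?_ h1
    have h2 : 1 / (s : ℝ) ≤ max (max r (1 / (s : ℝ))) ((n : ℝ) / 2) :=
      (le_max_right _ _).trans (le_max_left _ _)
    rw [div_le_iff₀ (lt_of_lt_of_le (by positivity) h2)]
    rw [div_le_iff₀ hs0] at h2
    linarith

/-- escaping segments -/
lemma escape (X : Set (EE d)) {t : ℝ} (ht : 0 < t) (M : ℝ) {z : EE d} (hz : z ∉ Cx X t) :
    ∃ w, segment ℝ z w ⊆ (Cx X t)ᶜ ∧ (w ∉ X ∨ M ≤ ‖w‖) := by
  by_cases h : ‖z‖ ≤ t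
  · have : ∃ w, w ∉ X ∧ dist z w < 1 / t := by
      by_contra h'
      push Not at h'
      exact hz ⟨h, h'⟩
    obtain ⟨w, hw, hd⟩ := this
    refine ⟨w, fun y hy hyC => ?_, Or.inl hw⟩
    have h1 := hyC.2 w hw
    have h2 : dist y w ≤ dist z w := by
      have h3 : segment ℝ z w ⊆ Metric.closedBall w (dist z w) :=
        (convex_closedBall w _).segment_subset (by simp) (by simp)
      exact h3 hy
    linarith
  · push Not at h
    have hz0 : 0 < ‖z‖ := ht.trans h
    set c := max 1 (M / ‖z‖) with hc
    have hc1 : 1 ≤ c := le_max_left _ _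
    refine ⟨c • z, fun y hy hyC => ?_, Or.inr ?_⟩
    · obtain ⟨a, b, ha, hb, hab, rfl⟩ := hy
      have h1 := hyC.1
      have e : a • z + b • c • z = (a + b * c) • z := by module
      rw [e, norm_smul, Real.norm_of_nonneg (by positivity)] at h1
      have : 1 ≤ a + b * c := by nlinarith
      nlinarith
    · rw [norm_smul, Real.norm_of_nonneg (by linarith)]
      have := le_max_right 1 (M / ‖z‖)
      rwa [div_le_iff₀ hz0] at this

lemma far {X : Set (EE d)} {T ε0 : ℝ} (hT : 0 < T) (h1 : ε0 < 1) (h2 : ε0 < 1 / T) {w : EE d}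
    (hw : w ∉ X ∨ T + 1 ≤ ‖w‖) : Disjoint (Metric.closedBall w ε0) (Cx X T) := by
  rw [disjoint_left]
  intro y hy hyC
  rw [Metric.mem_closedBall] at hy
  rcases hw with hw | hw
  · have := hyC.2 w hw
    linarith
  · have h3 := hyC.1
    have h4 := dist_triangle w y 0
    rw [dist_zero_right, dist_zero_right, dist_comm] at h4
    linarith

lemma first_hit {x z w : EE d} {r : ℝ} (hz : r ≤ dist z x)
    (hh : ∃ y ∈ segment ℝ z w, dist y x ≤ r) : ∃ C : Set (EE d), IsPreconnected C ∧
      C ⊆ segment ℝ z w ∧ z ∈ C ∧ (∀ y ∈ C, r ≤ dist y x) ∧ ∃ y ∈ C, y ∈ Metric.sphere x r := by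
  let p : ℝ → EE d := fun s => AffineMap.lineMap z w s
  have hp : Continuous p := AffineMap.lineMap_continuous
  have hseg : segment ℝ z w = p '' Icc 0 1 := segment_eq_image_lineMap ℝ z w
  let S : Set ℝ := Icc 0 1 ∩ {s | dist (p s) x ≤ r}
  have hS : IsCompact S := isCompact_Icc.inter_right
    (isClosed_le (hp.dist continuous_const) continuous_const)
  have hne : S.Nonempty := by
    obtain ⟨y, hy, hyr⟩ := hh
    rw [hseg] at hy
    obtain ⟨s, hs, rfl⟩ := hy
    exact ⟨s, hs, hyr⟩
  obtain ⟨s0, hs0, hleast⟩ := hS.exists_isLeast hne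
  have hp0 : p 0 = z := by simp [p]
  have hge : ∀ s ∈ Icc 0 s0, r ≤ dist (p s) x := by
    intro s hs
    by_contra hlt
    push Not at hlt
    have hmem : s ∈ S := ⟨⟨hs.1, hs.2.trans hs0.1.2⟩, hlt.le⟩
    have hss : s = s0 := le_antisymm hs.2 (hleast hmem)
    have hiv := intermediate_value_Icc' (hs.1) ((hp.dist continuous_const).continuousOn
      (s := Icc 0 s) : ContinuousOn (fun u => dist (p u) x) (Icc 0 s))
    obtain ⟨u, hu, hur⟩ := hiv (show r ∈ Icc (dist (p s) x) (dist (p 0) x) from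
      ⟨hlt.le, by rw [hp0]; exact hz⟩)
    have hur' : dist (p u) x = r := hur
    have humem : u ∈ S := ⟨⟨hu.1, hu.2.trans (hs.2.trans hs0.1.2)⟩, hur'.le⟩
    have h5 := hleast humem
    have h6 : u = s := le_antisymm hu.2 (hss ▸ h5)
    rw [h6] at hur'
    linarith
  refine ⟨p '' Icc 0 s0, isPreconnected_Icc.image p hp.continuousOn, ?_, ?_, ?_, ?_⟩
  · rw [hseg]
    exact image_mono (Icc_subset_Icc_right hs0.1.2)
  · exact ⟨0, ⟨le_rfl, hs0.1.1⟩, hp0⟩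
  · rintro _ ⟨s, hs, rfl⟩
    exact hge s hs
  · refine ⟨p s0, ⟨s0, ⟨hs0.1.1, le_rfl⟩, rfl⟩, ?_⟩
    rw [Metric.mem_sphere]
    exact le_antisymm hs0.2 (hge s0 ⟨hs0.1.1, le_rfl⟩)

lemma geo_ball (hd : 2 ≤ d) (X : Set (EE d)) {t T e ε ε0 : ℝ} (ht : 0 < t) (hT : 0 < T)
    (h1 : ε0 < 1) (h2 : ε0 < 1 / T) (x : EE d) (he0 : 0 < e) (he : e < ε)
    (hXb : Metric.closedBall x ε ⊆ X)
    (hdis : Disjoint (Metric.closedBall x ε) (Cx X t)) :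
    ∀ z ∉ Cx X t ∪ Metric.closedBall x e, ∃ C : Set (EE d), IsPreconnected C ∧
      C ⊆ (Cx X t ∪ Metric.closedBall x e)ᶜ ∧ z ∈ C ∧ ∃ w ∈ C,
      Disjoint (Metric.closedBall w ε0) (Cx X T) := by
  intro z hz
  rw [mem_union, not_or] at hz
  obtain ⟨w, hw, hw'⟩ := escape X ht (max (T + 1) (‖x‖ + ε + 1)) hz.1
  have hfar := far (X := X) hT h1 h2 (hw'.imp_right fun h => (le_max_left _ _).trans h)
  have hwx : ε < dist w x := by
    rcases hw' with h | h
    · by_contra hc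
      push Not at hc
      exact h (hXb hc)
    · have h4 := dist_triangle w x 0
      rw [dist_zero_right, dist_zero_right] at h4
      have := (le_max_right _ _).trans h
      linarith
  have hzx : e < dist z x := by simpa using hz.2
  by_cases hA : ∃ y ∈ segment ℝ z w, dist y x ≤ e
  · obtain ⟨r, hr1, hr2⟩ := exists_between (lt_min he hzx)
    have hrε : r < ε := hr2.trans_le (min_le_left _ _)
    have hrz : r < dist z x := hr2.trans_le (min_le_right _ _)
    obtain ⟨y, hy, hyr⟩ := hA
    obtain ⟨C1, c1, s1, m1, g1, y1, hy1, hy1'⟩ := first_hit (x := x) (w := w) hrz.le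
      ⟨y, hy, by linarith⟩
    obtain ⟨C2, c2, s2, m2, g2, y2, hy2, hy2'⟩ := first_hit (x := x) (z := w) (w := z) (r := r)
      (by linarith) ⟨y, by rwa [segment_symm], by linarith⟩
    rw [segment_symm] at s2
    have hrank : 1 < Module.rank ℝ (EE d) := by
      rw [← Module.finrank_eq_rank, finrank_euclideanSpace_fin]
      exact_mod_cast hd
    have hsp : IsPreconnected (Metric.sphere x r) := isPreconnected_sphere hrank x r
    have hu1 := IsPreconnected.union y1 hy1 hy1' c1 hsp
    have hu2 := IsPreconnected.union y2 (Or.inr hy2' : y2 ∈ C1 ∪ Metric.sphere x r) hy2 hu1 c2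
    refine ⟨_, hu2, ?_, Or.inl (Or.inl m1), w, Or.inr m2, hfar⟩
    have hsplit : ∀ q, q ∈ segment ℝ z w → r ≤ dist q x →
        q ∈ (Cx X t ∪ Metric.closedBall x e)ᶜ := by
      rintro q hq hqr (h | h)
      · exact hw hq h
      · rw [Metric.mem_closedBall] at h
        linarith
    rintro q ((h | h) | h)
    · exact hsplit q (s1 h) (g1 q h)
    · rintro (h' | h')
      · refine disjoint_left.1 hdis ?_ h'
        rw [Metric.mem_sphere] at h
        rw [Metric.mem_closedBall]
        linarith
      · rw [Metric.mem_sphere] at h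
        rw [Metric.mem_closedBall] at h'
        linarith
    · exact hsplit q (s2 h) (g2 q h)
  · push Not at hA
    refine ⟨segment ℝ z w, (convex_segment z w).isPreconnected, ?_, left_mem_segment ℝ z w, w,
      right_mem_segment ℝ z w, hfar⟩
    rintro q hq (h | h)
    · exact hw hq h
    · have := hA q hq
      rw [Metric.mem_closedBall] at h
      linarith

lemma geo_plain (X : Set (EE d)) {t T ε0 : ℝ} (ht : 0 < t) (hT : 0 < T)
    (h1 : ε0 < 1) (h2 : ε0 < 1 / T) :
    ∀ z ∉ Cx X t, ∃ C : Set (EE d), IsPreconnected C ∧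
      C ⊆ (Cx X t)ᶜ ∧ z ∈ C ∧ ∃ w ∈ C, Disjoint (Metric.closedBall w ε0) (Cx X T) := by
  intro z hz
  obtain ⟨w, hw, hw'⟩ := escape X ht (T + 1) hz
  exact ⟨segment ℝ z w, (convex_segment z w).isPreconnected, hw, left_mem_segment ℝ z w, w,
      right_mem_segment ℝ z w, far (X := X) hT h1 h2 hw'⟩
end Aux10

section Aux11
open MeasureTheory Set Filter Topology
open scoped ContDiff

variable {d : ℕ}

lemma Cx_bdd (X : Set (EE d)) (t : ℝ) : Cx X t ⊆ Metric.closedBall 0 t :=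
  fun x hx => by simpa using hx.1

lemma Cx_int (X : Set (EE d)) {t s : ℝ} (ht : 0 < t) (hts : t < s) :
    Cx X t ⊆ interior (Cx X s) := by
  obtain ⟨e, he, h⟩ := Cx_ball X ht hts
  intro x hx
  exact mem_interior_iff_mem_nhds.2 (Filter.mem_of_superset (Metric.closedBall_mem_nhds x he) (h x hx))

lemma step_ball (hd : 2 ≤ d) {P : MvPolynomial (Fin d) ℂ} (hell : IsElliptic P)
    {X : Set (EE d)} (hX : IsOpen X) {n : ℕ} (hn : 1 ≤ n) {x : EE d} {ε : ℝ} (hε : 0 < ε)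
    (hball : Metric.closedBall x ε ⊆ X \ closure (exhSet X n))
    {f : EE d → ℂ} (hf : ContDiffOn ℝ ∞ f (exhSet X n ∪ Metric.ball x ε))
    (hPf : ∀ y ∈ exhSet X n ∪ Metric.ball x ε, OpS 1 P f y = 0)
    {K : Set (EE d)} (hK : IsCompact K) (hKY : K ⊆ exhSet X n ∪ Metric.ball x ε)
    {η : ℝ} (hη : 0 < η) {T : ℝ} (hT : 0 < T) :
    ∃ g : EE d → ℂ, Continuous g ∧ WSol 1 P (Cx X T) g ∧ ∀ y ∈ K, ‖g y - f y‖ < η := by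
  have hYo : IsOpen (exhSet X n ∪ Metric.ball x ε) := (exh_open hX n).union Metric.isOpen_ball
  obtain ⟨t0, ht0, ht0n, hK1⟩ := exh_compact (X := X) hn (hK.diff (Metric.isOpen_ball (x := x) (ε := ε)))
    (fun y hy => (hKY hy.1).resolve_right hy.2)
  obtain ⟨r, hr, hK2⟩ := exists_lt_subset_ball (x := x) (r := ε)
    (hK.diff (exh_open hX n)).isClosed (fun y hy => (hKY hy.1).resolve_left hy.2)
  obtain ⟨e0, he0, he0ε, hre⟩ : ∃ e0, 0 < e0 ∧ e0 < ε ∧ r ≤ e0 :=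
    ⟨max r (ε / 2), lt_of_lt_of_le (by linarith) (le_max_right _ _), max_lt hr (by linarith),
      le_max_left _ _⟩
  have hKK : K ⊆ Cx X t0 ∪ Metric.closedBall x e0 := by
    intro y hy
    by_cases hyb : y ∈ Metric.ball x ε
    · right
      have hy2 : y ∉ exhSet X n := fun h =>
        (hball (Metric.ball_subset_closedBall hyb)).2 (subset_closure h)
      have := hK2 ⟨hy, hy2⟩
      exact Metric.closedBall_subset_closedBall hre (Metric.ball_subset_closedBall this)
    · exact Or.inl (hK1 ⟨hy, hyb⟩)
  obtain ⟨t1, h01, h1n⟩ := exists_between ht0n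
  obtain ⟨t2, h12, h2n⟩ := exists_between h1n
  obtain ⟨e1, g01, g1ε⟩ := exists_between he0ε
  obtain ⟨e2, g12, g2ε⟩ := exists_between g1ε
  obtain ⟨a1, ha1, hb1⟩ := Cx_ball X ht0 h01
  obtain ⟨a2, ha2, hb2⟩ := Cx_ball X (ht0.trans h01) h12
  obtain ⟨a3, ha3, hb3⟩ := Cx_ball X hT (lt_add_one T)
  have ht2 : 0 < t2 := ht0.trans (h01.trans h12)
  have hT1 : 0 < T + 1 := by linarith
  obtain ⟨ε0, hε0, l1, l2, l3, l4, l5, l6, l7⟩ : ∃ ε0 : ℝ, 0 < ε0 ∧ ε0 ≤ a1 ∧ ε0 ≤ a2 ∧ ε0 ≤ a3 ∧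
      ε0 ≤ e1 - e0 ∧ ε0 ≤ e2 - e1 ∧ ε0 < 1 ∧ ε0 < 1 / (T + 1) := by
    have hev : ∀ a : ℝ, 0 < a → ∀ᶠ e in 𝓝[>] (0 : ℝ), e < a := fun a ha =>
      mem_nhdsWithin_of_mem_nhds (Iio_mem_nhds ha)
    have := (self_mem_nhdsWithin (s := Ioi (0 : ℝ)) (a := 0))
    obtain ⟨e, h0, h1, h2, h3, h4, h5, h6, h7⟩ := (Filter.Eventually.and this ((hev a1 ha1).and ((hev a2 ha2).and ((hev a3 ha3).and
      ((hev _ (sub_pos.2 g01)).and ((hev _ (sub_pos.2 g12)).and ((hev 1 one_pos).and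
      (hev _ (one_div_pos.2 hT1))))))))).exists
    exact ⟨e, h0, h1.le, h2.le, h3.le, h4.le, h5.le, h6, h7⟩
  have hL'Y : Cx X t2 ∪ Metric.closedBall x e2 ⊆ exhSet X n ∪ Metric.ball x ε :=
    union_subset_union (Cx_sub_exh X ht2 h2n) (Metric.closedBall_subset_ball g2ε)
  have hL'c : IsCompact (Cx X t2 ∪ Metric.closedBall x e2) :=
    (Cx_compact X t2).union (isCompact_closedBall x e2)
  obtain ⟨F, hF, hFf⟩ := exists_local hYo hf hL'c hL'Y
  have hcb : ∀ {a b : ℝ}, ε0 ≤ b - a → ∀ y ∈ Metric.closedBall x a,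
      Metric.closedBall y ε0 ⊆ Metric.closedBall x b := by
    intro a b hab y hy
    refine Metric.closedBall_subset_closedBall' ?_
    rw [Metric.mem_closedBall] at hy
    linarith
  obtain ⟨g, hg, hgW, hgK⟩ := approx_step hd hell (W := Cx X (T + 1)) (W' := Cx X T)
    (L := Cx X t1 ∪ Metric.closedBall x e1) (L' := Cx X t2 ∪ Metric.closedBall x e2)
    (K := Cx X t0 ∪ Metric.closedBall x e0) (F := F) (η := η) (ε0 := ε0) (Cx_bdd X _) hL'c hε0
    (by
      rintro y (hy | hy)
      · exact ((Metric.closedBall_subset_closedBall l2).trans (hb2 y hy)).trans subset_union_left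
      · exact (hcb l5 y hy).trans subset_union_right)
    (by
      rintro y (hy | hy)
      · exact ((Metric.closedBall_subset_closedBall l1).trans (hb1 y hy)).trans subset_union_left
      · exact (hcb l4 y hy).trans subset_union_right)
    (fun y hy => (Metric.closedBall_subset_closedBall l3).trans (hb3 y hy))
    (geo_ball hd X ht2 hT1 l6 l7 x (by linarith) g2ε (fun y hy => (hball hy).1)
      (Set.disjoint_left.2 fun y hy hy2 => (hball hy).2
        (subset_closure (Cx_sub_exh X ht2 h2n hy2))))
    (hF.mono (subset_univ _))
    (fun y hy => by rw [OpS_congr (hFf y hy)]; exact hPf y (hL'Y hy)) hη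
  refine ⟨g, hg, hgW, fun y hy => ?_⟩
  have hy2 : y ∈ Cx X t2 ∪ Metric.closedBall x e2 :=
    union_subset_union (Cx_mono X ht0 (by linarith))
      (Metric.closedBall_subset_closedBall (by linarith)) (hKK hy)
  rw [← (hFf y hy2).eq_of_nhds]
  exact hgK y (hKK hy)

lemma step_plain (hd : 2 ≤ d) {P : MvPolynomial (Fin d) ℂ} (hell : IsElliptic P)
    (X : Set (EE d)) {s : ℝ} (hs : 0 < s) {f : EE d → ℂ} (hfc : Continuous f)
    (hf : WSol 1 P (Cx X (s + 1)) f) {η : ℝ} (hη : 0 < η) {T : ℝ} (hT : 0 < T) :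
    ∃ g : EE d → ℂ, Continuous g ∧ WSol 1 P (Cx X T) g ∧ ∀ y ∈ Cx X s, ‖g y - f y‖ < η := by
  have hYo : IsOpen (interior (Cx X (s + 1))) := isOpen_interior
  have hsol := (hf.mono interior_subset).sol hd hell (by simp) hYo hfc.continuousOn
  have h01 : s < s + 1 / 4 := by linarith
  have h12 : s + 1 / 4 < s + 1 / 2 := by linarith
  have h23 : s + 1 / 2 < s + 1 := by linarith
  obtain ⟨a1, ha1, hb1⟩ := Cx_ball X hs h01
  obtain ⟨a2, ha2, hb2⟩ := Cx_ball X (hs.trans h01) h12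
  obtain ⟨a3, ha3, hb3⟩ := Cx_ball X hT (lt_add_one T)
  have ht2 : 0 < s + 1 / 2 := by linarith
  have hT1 : 0 < T + 1 := by linarith
  obtain ⟨ε0, hε0, l1, l2, l3, l6, l7⟩ : ∃ ε0 : ℝ, 0 < ε0 ∧ ε0 ≤ a1 ∧ ε0 ≤ a2 ∧ ε0 ≤ a3 ∧
      ε0 < 1 ∧ ε0 < 1 / (T + 1) := by
    have hev : ∀ a : ℝ, 0 < a → ∀ᶠ e in 𝓝[>] (0 : ℝ), e < a := fun a ha =>
      mem_nhdsWithin_of_mem_nhds (Iio_mem_nhds ha)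
    have := (self_mem_nhdsWithin (s := Ioi (0 : ℝ)) (a := 0))
    obtain ⟨e, h0, h1, h2, h3, h6, h7⟩ := (Filter.Eventually.and this ((hev a1 ha1).and
      ((hev a2 ha2).and ((hev a3 ha3).and ((hev 1 one_pos).and
      (hev _ (one_div_pos.2 hT1))))))).exists
    exact ⟨e, h0, h1.le, h2.le, h3.le, h6, h7⟩
  have hL'Y : Cx X (s + 1 / 2) ⊆ interior (Cx X (s + 1)) := Cx_int X ht2 h23
  obtain ⟨F, hF, hFf⟩ := exists_local hYo hsol.sm (Cx_compact X (s + 1 / 2)) hL'Y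
  obtain ⟨g, hg, hgW, hgK⟩ := approx_step hd hell (W := Cx X (T + 1)) (W' := Cx X T)
    (L := Cx X (s + 1 / 4)) (L' := Cx X (s + 1 / 2))
    (K := Cx X s) (F := F) (η := η) (ε0 := ε0) (Cx_bdd X _) (Cx_compact X _) hε0
    (fun y hy => (Metric.closedBall_subset_closedBall l2).trans (hb2 y hy))
    (fun y hy => (Metric.closedBall_subset_closedBall l1).trans (hb1 y hy))
    (fun y hy => (Metric.closedBall_subset_closedBall l3).trans (hb3 y hy))
    (geo_plain X ht2 hT1 l6 l7)
    (hF.mono (subset_univ _))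
    (fun y hy => by rw [OpS_congr (hFf y hy)]; exact hsol.eq y (hL'Y hy)) hη
  refine ⟨g, hg, hgW, fun y hy => ?_⟩
  rw [← (hFf y (Cx_mono X hs (by linarith) hy)).eq_of_nhds]
  exact hgK y hy

lemma ml_step (hd : 2 ≤ d) {P : MvPolynomial (Fin d) ℂ} (hell : IsElliptic P)
    {X : Set (EE d)} (hX : IsOpen X) {N : ℝ} (hN : 0 < N) {g0 : EE d → ℂ} (hg0 : Continuous g0)
    (hW0 : WSol 1 P (Cx X (N + 1)) g0) {δ : ℝ} (hδ : 0 < δ) :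
    ∃ G : EE d → ℂ, ContinuousOn G X ∧ WSol 1 P X G ∧ ∀ y ∈ Cx X N, ‖G y - g0 y‖ ≤ δ := by
  have hNk : ∀ k : ℕ, 0 < N + k := fun k => by positivity
  have hstep : ∀ (k : ℕ) (g : EE d → ℂ), ∃ g' : EE d → ℂ,
      (Continuous g ∧ WSol 1 P (Cx X (N + k + 1)) g) →
      (Continuous g' ∧ WSol 1 P (Cx X (N + (k + 1 : ℕ) + 1)) g') ∧
        ∀ y ∈ Cx X (N + k), ‖g' y - g y‖ < δ / 2 / 2 ^ k := by
    intro k g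
    by_cases h : Continuous g ∧ WSol 1 P (Cx X (N + k + 1)) g
    · obtain ⟨g', h1, h2, h3⟩ := step_plain hd hell X (hNk k) h.1 h.2
        (η := δ / 2 / 2 ^ k) (by positivity) (T := N + (k + 1 : ℕ) + 1) (by positivity)
      exact ⟨g', fun _ => ⟨⟨h1, h2⟩, h3⟩⟩
    · exact ⟨g, fun h' => absurd h' h⟩
  choose nxt hnxt using hstep
  let s : ℕ → EE d → ℂ := fun k => Nat.rec g0 (fun k g => nxt k g) k
  have hs0 : s 0 = g0 := rfl
  have hss : ∀ k, s (k + 1) = nxt k (s k) := fun k => rfl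
  have hgood : ∀ k, Continuous (s k) ∧ WSol 1 P (Cx X (N + k + 1)) (s k) := by
    intro k
    induction k with
    | zero => rw [hs0]; exact ⟨hg0, by simpa using hW0⟩
    | succ k ih => rw [hss]; exact (hnxt k _ ih).1
  have hdist : ∀ k : ℕ, ∀ y ∈ Cx X (N + k), ‖s (k + 1) y - s k y‖ < δ / 2 / 2 ^ k := fun k =>
    (hnxt k _ (hgood k)).2
  have hmono : ∀ k m : ℕ, Cx X (N + k) ⊆ Cx X (N + (m + k : ℕ)) := fun k m =>
    Cx_mono X (hNk k) (by push_cast; linarith [(Nat.cast_nonneg m : (0 : ℝ) ≤ m)])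
  have hgeo : ∀ k : ℕ, ∀ y ∈ Cx X (N + k), ∀ m : ℕ,
      dist (s (m + k) y) (s (m + 1 + k) y) ≤ δ / 2 ^ k / 2 / 2 ^ m := by
    intro k y hy m
    rw [dist_comm, dist_eq_norm, show m + 1 + k = (m + k) + 1 by ring]
    refine (hdist (m + k) y (hmono k m hy)).le.trans (le_of_eq ?_)
    rw [pow_add]; field_simp
  have hexh : ∀ {K : Set (EE d)}, IsCompact K → K ⊆ X → ∃ k : ℕ, K ⊆ Cx X (N + k) := by
    intro K hK hKX
    obtain ⟨M, hM, h⟩ := Cx_exh hX hK hKX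
    exact ⟨M, h.trans (Cx_mono X (by exact_mod_cast hM) (by linarith))⟩
  have hlim : ∀ y, ∃ v, y ∈ X → Tendsto (fun m => s m y) atTop (𝓝 v) := by
    intro y
    by_cases hy : y ∈ X
    · obtain ⟨k, hk⟩ := hexh isCompact_singleton (singleton_subset_iff.2 hy)
      obtain ⟨v, hv⟩ := cauchySeq_tendsto_of_complete
        (cauchySeq_of_le_geometric_two (hgeo k y (hk rfl)))
      exact ⟨v, fun _ => (tendsto_add_atTop_iff_nat k).1 hv⟩
    · exact ⟨0, fun h => absurd h hy⟩
  choose G hG using hlim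
  have hbd : ∀ k : ℕ, ∀ y ∈ Cx X (N + k), ∀ m : ℕ, dist (s (m + k) y) (G y) ≤ δ / 2 ^ k / 2 ^ m := by
    intro k y hy m
    exact dist_le_of_le_geometric_two_of_tendsto (hgeo k y hy)
      ((tendsto_add_atTop_iff_nat k).2 (hG y (Cx_sub X (hNk k) hy))) m
  have hunif : ∀ k : ℕ, TendstoUniformlyOn (fun m => s (m + k)) G atTop (Cx X (N + k)) := by
    intro k
    rw [Metric.tendstoUniformlyOn_iff]
    intro e he
    have h1 : Tendsto (fun m : ℕ => δ / 2 ^ k / 2 ^ m) atTop (𝓝 0) :=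
      tendsto_const_nhds.div_atTop (tendsto_pow_atTop_atTop_of_one_lt (by norm_num))
    filter_upwards [h1.eventually (Iio_mem_nhds he)] with m hm y hy
    rw [dist_comm]
    exact (hbd k y hy m).trans_lt hm
  have hGc : ∀ k : ℕ, ContinuousOn G (Cx X (N + k)) := fun k =>
    (hunif k).continuousOn (Frequently.of_forall fun m => (hgood (m + k)).1.continuousOn)
  refine ⟨G, ?_, ?_, ?_⟩
  · intro y hy
    obtain ⟨k, hk⟩ := hexh isCompact_singleton (singleton_subset_iff.2 hy)
    have h1 : y ∈ interior (Cx X (N + (k + 1 : ℕ))) :=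
      Cx_int X (hNk k) (by push_cast; linarith) (hk rfl)
    exact ((hGc (k + 1)).continuousAt (mem_interior_iff_mem_nhds.1 h1)).continuousWithinAt
  · intro φ hφ
    obtain ⟨k, hk⟩ := hexh hφ.cs hφ.ts
    have hψ := hφ.op (-1) P
    have hψc : Continuous (OpS (-1) P φ) := hψ.sm.continuous
    have hzero : ∀ y, y ∉ Cx X (N + k) → OpS (-1) P φ y = 0 := fun y hy =>
      OpS_zero_off _ _ fun h => hy (hk h)
    have hlim : Tendsto (fun m => ∫ y, s (m + k) y * OpS (-1) P φ y) atTop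
        (𝓝 (∫ y, G y * OpS (-1) P φ y)) := by
      refine tendsto_integral_of_dominated_convergence
        (fun y => ‖s k y * OpS (-1) P φ y‖ + 2 * δ * ‖OpS (-1) P φ y‖) ?_ ?_ ?_ ?_
      · exact fun m => ((hgood _).1.mul hψc).aestronglyMeasurable
      · exact (int_mul (hgood k).1 hψc hψ.cs).norm.add
          ((hψc.integrable_of_hasCompactSupport hψ.cs).norm.const_mul _)
      · refine fun m => Eventually.of_forall fun y => ?_
        by_cases hy : y ∈ Cx X (N + k)
        · rw [norm_mul, norm_mul, ← add_mul]
          refine mul_le_mul_of_nonneg_right ?_ (norm_nonneg _)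
          have hle : ∀ m : ℕ, δ / 2 ^ k / 2 ^ m ≤ δ := fun m =>
            (div_le_self (by positivity) (one_le_pow₀ (by norm_num))).trans
              (div_le_self hδ.le (one_le_pow₀ (by norm_num)))
          have h1 := (hbd k y hy m).trans (hle m)
          have h2 := (hbd k y hy 0).trans (hle 0)
          rw [zero_add] at h2
          have h3 := dist_triangle_right (s (m + k) y) (s k y) (G y)
          rw [dist_eq_norm (s (m + k) y) (s k y)] at h3
          have h4 := norm_le_norm_add_norm_sub' (s (m + k) y) (s k y)
          linarith
        · simp [hzero y hy]
      · refine Eventually.of_forall fun y => ?_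
        by_cases hy : y ∈ Cx X (N + k)
        · exact ((tendsto_add_atTop_iff_nat k).2 (hG y (Cx_sub X (hNk k) hy))).mul_const _
        · simp [hzero y hy]
    refine tendsto_nhds_unique hlim (tendsto_const_nhds.congr fun m => ?_)
    refine ((hgood (m + k)).2 φ ⟨hφ.sm, hφ.cs, ?_⟩).symm
    exact (hk.trans (hmono k m)).trans (Cx_mono X (hNk _) (by linarith))
  · intro y hy
    have := hbd 0 y (by simpa using hy) 0
    rw [norm_sub_rev]
    simpa [dist_eq_norm, hs0] using this

theorem final_aux (hd : 2 ≤ d) (P : MvPolynomial (Fin d) ℂ) (hell : IsElliptic P)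
    (X : Set (EE d)) (hX : IsOpen X) (n : ℕ) (hn : 1 ≤ n) (x : EE d) (ε : ℝ) (hε : 0 < ε)
    (hball : Metric.closedBall x ε ⊆ X \ closure (exhSet X n)) :
    ∀ f : EE d → ℂ, ContDiffOn ℝ ∞ f (exhSet X n ∪ Metric.ball x ε) →
      (∀ y ∈ exhSet X n ∪ Metric.ball x ε, PDop P f y = 0) →
      ∀ K : Set (EE d), IsCompact K → K ⊆ exhSet X n ∪ Metric.ball x ε →
        ∀ δ : ℝ, 0 < δ → ∃ g : EE d → ℂ, ContDiffOn ℝ ∞ g X ∧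
            (∀ y ∈ X, PDop P g y = 0) ∧ ∀ y ∈ K, ‖g y - f y‖ < δ := by
  intro f hf hPf K hK hKY δ hδ
  have hKX : K ⊆ X := hKY.trans (union_subset (fun y hy => hy.1)
    fun y hy => (hball (Metric.ball_subset_closedBall hy)).1)
  obtain ⟨N, hN, hKN⟩ := Cx_exh hX hK hKX
  have hN' : (0 : ℝ) < N := by exact_mod_cast hN
  rw [PDop_eq] at hPf
  obtain ⟨g0, h1, h2, h3⟩ := step_ball hd hell hX hn hε hball hf hPf hK hKY (half_pos hδ)
    (T := (N : ℝ) + 1) (by linarith)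
  obtain ⟨G, hG1, hG2, hG3⟩ := ml_step hd hell hX hN' h1 h2 (half_pos hδ)
  have hs := hG2.sol hd hell (by simp) hX hG1
  refine ⟨G, hs.sm, by rw [PDop_eq]; exact hs.eq, fun y hy => ?_⟩
  have h4 := h3 y hy
  have h5 := hG3 y (hKN hy)
  have h6 := norm_sub_le_norm_sub_add_norm_sub (G y) (g0 y) (f y)
  linarith
end Aux11

/-- For an elliptic polynomial `P` in `d ≥ 2` variables, the restriction
map `C_P^∞(X) → C_P^∞(X_n ∪ B(x,ε))` has dense range for the compact-open topology. -/
theorem dense_restriction_elliptic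
    {d : ℕ} (hd : 2 ≤ d) (P : MvPolynomial (Fin d) ℂ) (hell : IsElliptic P)
    (X : Set (EuclideanSpace ℝ (Fin d))) (hX : IsOpen X)
    (n : ℕ) (hn : 1 ≤ n)
    (x : EuclideanSpace ℝ (Fin d)) (hx : x ∈ X \ exhSet X n)
    (ε : ℝ) (hε : 0 < ε)
    (hball : Metric.closedBall x ε ⊆ X \ closure (exhSet X n)) :
    ∀ f : EuclideanSpace ℝ (Fin d) → ℂ,
      ContDiffOn ℝ (⊤ : ℕ∞) f (exhSet X n ∪ Metric.ball x ε) →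
      (∀ y ∈ exhSet X n ∪ Metric.ball x ε, PDop P f y = 0) →
      ∀ K : Set (EuclideanSpace ℝ (Fin d)), IsCompact K →
        K ⊆ exhSet X n ∪ Metric.ball x ε →
        ∀ δ : ℝ, 0 < δ →
          ∃ g : EuclideanSpace ℝ (Fin d) → ℂ, ContDiffOn ℝ (⊤ : ℕ∞) g X ∧
            (∀ y ∈ X, PDop P g y = 0) ∧ ∀ y ∈ K, ‖g y - f y‖ < δ := by
  exact final_aux hd P hell X hX n hn x ε hε hball

end
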